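/- Suppose in addition that the mapping r ↦ f(r,t) is strictly decreasing on [0,R] for every t ∈ [0, max_{closure(B_R)} u]. Then every weak solution u of problem (P) is radially symmetric and radially non-increasing. -/

import Mathlib

open Set Metric MeasureTheory Bornology
open scoped RealInnerProductSpace Classical

noncomputable section

/-- The vector field `y ↦ (g(|y|)/|y|)·y`, with the convention that it vanishes at `y = 0`. -/
def gvec {N : ℕ} (g : ℝ → ℝ) (y : EuclideanSpace ℝ (Fin N)) : EuclideanSpace ℝ (Fin N) :=
  if y = 0 then 0 else (g ‖y‖ / ‖y‖) • y

/-- `φ` is a smooth test function compactly supported in `Ω`. -/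
def IsTestFun {N : ℕ} (Ω : Set (EuclideanSpace ℝ (Fin N)))
    (φ : EuclideanSpace ℝ (Fin N) → ℝ) : Prop :=
  ContDiff ℝ (⊤ : ℕ∞) φ ∧ HasCompactSupport φ ∧ tsupport φ ⊆ Ω

/-- Conditions (2.1)-(2.2): `g ∈ C[0,∞) ∩ C¹(0,∞)`, `g(0) = 0`, `g'(t) > 0` for `t > 0`. -/
def GCond (g : ℝ → ℝ) : Prop :=
  ContinuousOn g (Ici 0) ∧ ContDiffOn ℝ 1 g (Ioi 0) ∧ g 0 = 0 ∧
    ∀ t : ℝ, 0 < t → 0 < deriv g t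

/-- Conditions (2.3)-(2.4): `f ∈ C([0,R] × [0,∞))`, `r ↦ f(r,t)` non-increasing. -/
def FCond (R : ℝ) (f : ℝ → ℝ → ℝ) : Prop :=
  ContinuousOn (fun q : ℝ × ℝ => f q.1 q.2) (Icc 0 R ×ˢ Ici 0) ∧
    ∀ t : ℝ, 0 ≤ t → ∀ r₁ ∈ Icc (0:ℝ) R, ∀ r₂ ∈ Icc (0:ℝ) R, r₁ ≤ r₂ → f r₂ t ≤ f r₁ t

/-- `u` solves `-div((g(|∇u|)/|∇u|)∇u) = f(|x|,u)` distributionally in the ball `B_R`. -/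
def IsDistribSolBall {N : ℕ} (R : ℝ) (g : ℝ → ℝ) (f : ℝ → ℝ → ℝ)
    (u : EuclideanSpace ℝ (Fin N) → ℝ) : Prop :=
  ∀ φ : EuclideanSpace ℝ (Fin N) → ℝ, IsTestFun (ball 0 R) φ →
    (∫ x in ball (0:EuclideanSpace ℝ (Fin N)) R, ⟪gvec g (gradient u x), gradient φ x⟫) =
      ∫ x in ball (0:EuclideanSpace ℝ (Fin N)) R, f ‖x‖ (u x) * φ x

/-- `u` is a weak solution of problem (P): `u ∈ C¹(clos B_R)`, `u ≥ 0`, `u ≢ 0`,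
`u = 0` on `∂B_R`, and the equation holds distributionally. -/
def IsWeakSolP {N : ℕ} (R : ℝ) (g : ℝ → ℝ) (f : ℝ → ℝ → ℝ)
    (u : EuclideanSpace ℝ (Fin N) → ℝ) : Prop :=
  ContDiffOn ℝ 1 u (closedBall 0 R) ∧
  (∀ x ∈ closedBall (0:EuclideanSpace ℝ (Fin N)) R, 0 ≤ u x) ∧
  (∃ x ∈ closedBall (0:EuclideanSpace ℝ (Fin N)) R, u x ≠ 0) ∧
  (∀ x ∈ sphere (0:EuclideanSpace ℝ (Fin N)) R, u x = 0) ∧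
  IsDistribSolBall R g f u

/-- `U` is `C¹` on `[a,b]` with (continuous) derivative `U'`. -/
def C1On (U U' : ℝ → ℝ) (a b : ℝ) : Prop :=
  ContinuousOn U' (Icc a b) ∧ ∀ r ∈ Icc a b, HasDerivWithinAt U (U' r) (Icc a b) r

/-- Definition 2.1: `u` is locally symmetric in `B_R`. -/
def LocallySymmetric {N : ℕ} (R : ℝ) (u : EuclideanSpace ℝ (Fin N) → ℝ) : Prop :=
  ∃ (K : Set ℕ) (z : ℕ → EuclideanSpace ℝ (Fin N)) (ri ro : ℕ → ℝ) (U U' : ℕ → ℝ → ℝ),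
    (∀ k ∈ K, z k ∈ ball (0:EuclideanSpace ℝ (Fin N)) R ∧ 0 ≤ ri k ∧ ri k < ro k) ∧
    K.PairwiseDisjoint (fun k => ball (z k) (ro k) \ closedBall (z k) (ri k)) ∧
    ball (0:EuclideanSpace ℝ (Fin N)) R =
      (⋃ k ∈ K, ball (z k) (ro k) \ closedBall (z k) (ri k)) ∪
        {x ∈ ball (0:EuclideanSpace ℝ (Fin N)) R | gradient u x = 0} ∧
    ∀ k ∈ K,
      C1On (U k) (U' k) (ri k) (ro k) ∧
      (∀ x ∈ ball (z k) (ro k) \ closedBall (z k) (ri k), u x = U k ‖x - z k‖) ∧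
      (∀ r ∈ Ioo (ri k) (ro k), U' k r < 0) ∧
      (∀ x ∈ ball (z k) (ri k), U k (ri k) ≤ u x)

/-- `H(t) = t·g(t) - ∫₀ᵗ g(s) ds`. -/
def Hfun (g : ℝ → ℝ) (t : ℝ) : ℝ := t * g t - ∫ s in (0:ℝ)..t, g s

/-- The inverse of `H` on `[0,∞)`. -/
def Hinv (g : ℝ → ℝ) : ℝ → ℝ := Function.invFunOn (Hfun g) (Ici 0)

/-- The class `A_g` of Definition 3.1. -/
def MemAg (g φ : ℝ → ℝ) : Prop :=
  ContinuousOn φ (Ici 0) ∧ (∀ t : ℝ, 0 ≤ t → 0 ≤ φ t) ∧ φ 0 = 0 ∧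
  ((∃ d > (0:ℝ), ∀ t ∈ Icc (0:ℝ) d, φ t = 0) ∨
    ∃ δ > (0:ℝ), (∀ t ∈ Ioo (0:ℝ) δ, 0 < φ t) ∧
      ∫⁻ t in Ioc (0:ℝ) δ, ENNReal.ofReal (1 / Hinv g (∫ s in (0:ℝ)..t, φ s)) = ⊤)

/-- `u` satisfies `div((g(|∇u|)/|∇u|)∇u) ≤ φ(u)` distributionally in `Ω`. -/
def DistribSupIneq {N : ℕ} (Ω : Set (EuclideanSpace ℝ (Fin N))) (g φ : ℝ → ℝ)
    (u : EuclideanSpace ℝ (Fin N) → ℝ) : Prop :=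
  ∀ ψ : EuclideanSpace ℝ (Fin N) → ℝ, IsTestFun Ω ψ → (∀ x, 0 ≤ ψ x) →
    -(∫ x in Ω, ⟪gvec g (gradient u x), gradient ψ x⟫) ≤ ∫ x in Ω, φ (u x) * ψ x

/-- Condition (a) of Lemma 3.7. -/
def CondA (R : ℝ) (g : ℝ → ℝ) (f : ℝ → ℝ → ℝ) : Prop :=
  ∀ ρ ∈ Ico (0:ℝ) R, ∀ τ : ℝ, 0 < τ → f ρ τ = 0 →
    ∃ δ ∈ Ioo (0:ℝ) τ, ∃ φ : ℝ → ℝ, MemAg g φ ∧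
      ∀ t ∈ Icc (τ - δ) τ, ∀ r ∈ Icc (ρ - δ) (ρ + δ) ∩ Icc (0:ℝ) R, f r t ≤ φ (τ - t)

/-- Condition (b) of Lemma 3.8. -/
def CondB (R : ℝ) (g : ℝ → ℝ) (f : ℝ → ℝ → ℝ) : Prop :=
  ∀ ρ ∈ Ico (0:ℝ) R, f ρ 0 = 0 →
    ∃ δ > (0:ℝ), ∃ φ : ℝ → ℝ, MemAg g φ ∧
      ∀ r ∈ Ico (0:ℝ) R, ∀ t ∈ Icc (0:ℝ) δ, -f r t ≤ φ t

/-- Condition (c) of Theorem 3.9. -/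
def CondC (R : ℝ) (g : ℝ → ℝ) (f : ℝ → ℝ → ℝ) : Prop :=
  ∀ ρ ∈ Ico (0:ℝ) R, ∀ τ : ℝ, 0 ≤ τ → f ρ τ = 0 →
    ∃ δ > (0:ℝ), ∃ φ : ℝ → ℝ, MemAg g φ ∧
      ∀ t ∈ Icc τ (τ + δ), ∀ r ∈ Icc (ρ - δ) (ρ + δ) ∩ Icc (0:ℝ) R, -f r t ≤ φ (t - τ)

/-- `u` solves `-div((g(|∇u|)/|∇u|)∇u) = f(u)` distributionally in `Ω` (autonomous case). -/
def IsDistribSolAut {N : ℕ} (Ω : Set (EuclideanSpace ℝ (Fin N))) (g f : ℝ → ℝ)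
    (u : EuclideanSpace ℝ (Fin N) → ℝ) : Prop :=
  ∀ φ : EuclideanSpace ℝ (Fin N) → ℝ, IsTestFun Ω φ →
    (∫ x in Ω, ⟪gvec g (gradient u x), gradient φ x⟫) = ∫ x in Ω, f (u x) * φ x

/-- `u` is a weak solution of problem (P) with autonomous right-hand side `f = f(u)`. -/
def IsWeakSolPAut {N : ℕ} (R : ℝ) (g f : ℝ → ℝ) (u : EuclideanSpace ℝ (Fin N) → ℝ) : Prop :=
  ContDiffOn ℝ 1 u (closedBall 0 R) ∧
  (∀ x ∈ closedBall (0:EuclideanSpace ℝ (Fin N)) R, 0 ≤ u x) ∧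
  (∃ x ∈ closedBall (0:EuclideanSpace ℝ (Fin N)) R, u x ≠ 0) ∧
  (∀ x ∈ sphere (0:EuclideanSpace ℝ (Fin N)) R, u x = 0) ∧
  IsDistribSolAut (ball 0 R) g f u

/-- `G(t) = ∫₀ᵗ g(s) ds`. -/
def Gfun (g : ℝ → ℝ) (t : ℝ) : ℝ := ∫ s in (0:ℝ)..t, g s

/-- The variational functional `J(v) = ∫_Ω (G(|∇v|) - F(v)) dx`. -/
def Jfun {N : ℕ} (g f : ℝ → ℝ) (Ω : Set (EuclideanSpace ℝ (Fin N)))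
    (v : EuclideanSpace ℝ (Fin N) → ℝ) : ℝ :=
  ∫ x in Ω, (Gfun g ‖gradient v x‖ - Gfun f (v x))

/-- `v ∈ X`, i.e. `v ∈ C¹(clos Ω)` with `v = 0` on `∂Ω`. -/
def MemX {N : ℕ} (Ω : Set (EuclideanSpace ℝ (Fin N)))
    (v : EuclideanSpace ℝ (Fin N) → ℝ) : Prop :=
  ContDiffOn ℝ 1 v (closure Ω) ∧ ∀ x ∈ frontier Ω, v x = 0

/-- `u` is a global minimizer of `J` in `X`. -/
def IsGlobalMinJ {N : ℕ} (g f : ℝ → ℝ) (Ω : Set (EuclideanSpace ℝ (Fin N)))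
    (u : EuclideanSpace ℝ (Fin N) → ℝ) : Prop :=
  MemX Ω u ∧ ∀ v, MemX Ω v → Jfun g f Ω u ≤ Jfun g f Ω v

/-- `u` is a local minimizer of `J` in `X` (w.r.t. the `C¹` distance). -/
def IsLocalMinJ {N : ℕ} (g f : ℝ → ℝ) (Ω : Set (EuclideanSpace ℝ (Fin N)))
    (u : EuclideanSpace ℝ (Fin N) → ℝ) : Prop :=
  MemX Ω u ∧ ∃ ε > (0:ℝ), ∀ v, MemX Ω v →
    (∀ x ∈ Ω, |v x - u x| + ‖gradient v x - gradient u x‖ < ε) →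
    Jfun g f Ω u ≤ Jfun g f Ω v

/-- `Ω` has `C¹` boundary: near every boundary point, `Ω` is the sublevel set of a `C¹`
defining function with nonvanishing gradient. -/
def HasC1Boundary {N : ℕ} (Ω : Set (EuclideanSpace ℝ (Fin N))) : Prop :=
  ∀ y ∈ frontier Ω, ∃ (V : Set (EuclideanSpace ℝ (Fin N))) (ρ : EuclideanSpace ℝ (Fin N) → ℝ),
    IsOpen V ∧ y ∈ V ∧ ContDiffOn ℝ 1 ρ V ∧ (∀ x ∈ V, (x ∈ Ω ↔ ρ x < 0)) ∧ gradient ρ y ≠ 0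

/-- The Neumann condition `∂u/∂ν = 0` on `∂Ω`; for `u ∈ X` (so that `u` vanishes on the
boundary and all tangential derivatives vanish) this is equivalent to the vanishing of the
full derivative of `u` (within `clos Ω`) at every boundary point. -/
def NeumannZero {N : ℕ} (Ω : Set (EuclideanSpace ℝ (Fin N)))
    (u : EuclideanSpace ℝ (Fin N) → ℝ) : Prop :=
  ∀ y ∈ frontier Ω, HasFDerivWithinAt u (0 : EuclideanSpace ℝ (Fin N) →L[ℝ] ℝ) (closure Ω) y

/-- `u` is radially symmetric and radially non-increasing on `clos B_R`, with `C¹`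
profile `U` (with derivative `U'`). -/
def RadialNonincreasing {N : ℕ} (R : ℝ) (u : EuclideanSpace ℝ (Fin N) → ℝ)
    (U U' : ℝ → ℝ) : Prop :=
  C1On U U' 0 R ∧ AntitoneOn U (Icc 0 R) ∧
    ∀ x ∈ closedBall (0:EuclideanSpace ℝ (Fin N)) R, u x = U ‖x‖

end

/-! One-dimensional continuous symmetrization of open sets via an obstacle problem. -/

noncomputable def qf (κ : ℝ) (A : Set ℝ) (s : ℝ) : ℝ := A.indicator (fun _ => (1:ℝ)) s - κ

noncomputable def ten (κ : ℝ) (A : Set ℝ) (x y : ℝ) : ℝ := ∫ s in x..y, (y - s) * qf κ A s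

def NN (κ : ℝ) (A : Set ℝ) : Set ℝ := {x | ∃ y, 0 < ten κ A x y}

lemma ind_ii {A : Set ℝ} (hA : MeasurableSet A) (a b : ℝ) :
    IntervalIntegrable (A.indicator (fun _ => (1:ℝ))) volume a b := by
  rw [intervalIntegrable_iff]
  exact (integrableOn_const (by simp) (by simp)).indicator hA

lemma qf_ii {κ : ℝ} {A : Set ℝ} (hA : MeasurableSet A) (a b : ℝ) :
    IntervalIntegrable (qf κ A) volume a b :=
  (ind_ii hA a b).sub (intervalIntegrable_const)

lemma mul_qf_ii {κ : ℝ} {A : Set ℝ} (hA : MeasurableSet A) (y a b : ℝ) :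
    IntervalIntegrable (fun s => (y - s) * qf κ A s) volume a b :=
  (qf_ii hA a b).continuousOn_mul (by fun_prop)

lemma mul_ind_ii {A : Set ℝ} (hA : MeasurableSet A) (y a b : ℝ) :
    IntervalIntegrable (fun s => (y - s) * A.indicator (fun _ => (1:ℝ)) s) volume a b :=
  (ind_ii hA a b).continuousOn_mul (by fun_prop)

lemma integral_lin (y a b : ℝ) : ∫ s in a..b, (y - s) = ((y - a)^2 - (y-b)^2)/2 := by
  rw [intervalIntegral.integral_sub (by simp) (by simp)]
  simp
  ring

lemma ten_eq {κ : ℝ} {A : Set ℝ} (hA : MeasurableSet A) (x y : ℝ) :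
    ten κ A x y = (∫ s in x..y, (y - s) * A.indicator (fun _ => (1:ℝ)) s) - κ * (y-x)^2/2 := by
  have : ∀ s, (y - s) * qf κ A s = (y - s) * A.indicator (fun _ => (1:ℝ)) s - κ * (y - s) := by
    intro s; simp only [qf]; ring
  simp only [ten, this]
  rw [intervalIntegral.integral_sub (mul_ind_ii hA y x y), intervalIntegral.integral_const_mul,
    integral_lin]
  · ring
  · exact Continuous.intervalIntegrable (by fun_prop) _ _

lemma ten_neg (κ : ℝ) (A : Set ℝ) (x y : ℝ) : ten κ (-A) (-x) (-y) = ten κ A x y := by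
  unfold ten
  have := intervalIntegral.integral_comp_neg (a := x) (b := y)
    (fun s => (-y - s) * qf κ (-A) s)
  rw [intervalIntegral.integral_symm, ← this, ← intervalIntegral.integral_neg]
  congr 1; ext s
  simp only [qf, indicator, Set.mem_neg, neg_neg]
  ring

lemma NN_neg (κ : ℝ) (A : Set ℝ) (x : ℝ) : -x ∈ NN κ (-A) ↔ x ∈ NN κ A := by
  constructor
  · rintro ⟨y, hy⟩
    refine ⟨-y, ?_⟩
    rw [← ten_neg]; simpa using hy
  · rintro ⟨y, hy⟩
    exact ⟨-y, by rwa [ten_neg]⟩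

/-- Taylor-type identity. -/
lemma ten_add {κ : ℝ} {A : Set ℝ} (hA : MeasurableSet A) (x y z : ℝ) :
    ten κ A x z = ten κ A x y + (z - y) * (∫ s in x..y, qf κ A s) + ten κ A y z := by
  unfold ten
  rw [← intervalIntegral.integral_add_adjacent_intervals (mul_qf_ii hA z x y) (mul_qf_ii hA z y z)]
  congr 1
  rw [← intervalIntegral.integral_const_mul, ← intervalIntegral.integral_add (mul_qf_ii hA y x y)]
  · congr 1; ext s; ring
  · exact (qf_ii hA x y).const_mul _

@[simp] lemma ten_self (κ : ℝ) (A : Set ℝ) (x : ℝ) : ten κ A x x = 0 := by simp [ten]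

lemma ten_mono_right {κ : ℝ} {A B : Set ℝ} (hA : MeasurableSet A) (hB : MeasurableSet B)
    (hAB : A ⊆ B) {x y : ℝ} (hxy : x ≤ y) : ten κ A x y ≤ ten κ B x y := by
  rw [ten_eq hA, ten_eq hB]
  gcongr
  apply intervalIntegral.integral_mono_on hxy (mul_ind_ii hA _ _ _) (mul_ind_ii hB _ _ _)
  intro s hs
  apply mul_le_mul_of_nonneg_left _ (by linarith [hs.2])
  exact indicator_le_indicator_of_subset hAB (fun _ => zero_le_one) s

lemma ten_mono {κ : ℝ} {A B : Set ℝ} (hA : MeasurableSet A) (hB : MeasurableSet B)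
    (hAB : A ⊆ B) (x y : ℝ) : ten κ A x y ≤ ten κ B x y := by
  rcases le_total x y with h | h
  · exact ten_mono_right hA hB hAB h
  · rw [← ten_neg κ A, ← ten_neg κ B]
    exact ten_mono_right hA.neg hB.neg (Set.neg_subset_neg.2 hAB) (by linarith)

lemma NN_mono {κ : ℝ} {A B : Set ℝ} (hA : MeasurableSet A) (hB : MeasurableSet B)
    (hAB : A ⊆ B) : NN κ A ⊆ NN κ B := by
  rintro x ⟨y, hy⟩
  exact ⟨y, hy.trans_le (ten_mono hA hB hAB x y)⟩

lemma ten_le_sq {κ : ℝ} {A : Set ℝ} (hA : MeasurableSet A) (x y : ℝ) :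
    ten κ A x y ≤ (1 - κ) * (y-x)^2/2 := by
  have h1 := ten_mono (κ := κ) hA MeasurableSet.univ (subset_univ _) x y
  refine h1.trans_eq ?_
  rw [ten_eq MeasurableSet.univ]
  simp only [indicator_univ, mul_one, integral_lin]
  ring

lemma le_ten_sq {κ : ℝ} {A : Set ℝ} (hA : MeasurableSet A) (x y : ℝ) :
    - κ * (y-x)^2/2 ≤ ten κ A x y := by
  have h1 := ten_mono (κ := κ) MeasurableSet.empty hA (empty_subset _) x y
  refine le_trans (le_of_eq ?_) h1
  rw [ten_eq MeasurableSet.empty]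
  simp
  ring

lemma continuous_qint {κ : ℝ} {A : Set ℝ} (hA : MeasurableSet A) (a : ℝ) :
    Continuous (fun x => ∫ s in a..x, qf κ A s) :=
  intervalIntegral.continuous_primitive (fun x y => qf_ii hA x y) a

lemma hasDerivAt_ten {κ : ℝ} (h0 : 0 < κ) (h1 : κ < 1) {A : Set ℝ} (hA : MeasurableSet A)
    (a x : ℝ) : HasDerivAt (fun y => ten κ A a y) (∫ s in a..x, qf κ A s) x := by
  rw [hasDerivAt_iff_isLittleO]
  have : (fun x' => ten κ A a x' - ten κ A a x - (x' - x) • ∫ s in a..x, qf κ A s)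
      = fun x' => ten κ A x x' := by
    ext x'
    rw [ten_add hA a x x']; simp only [smul_eq_mul]; ring
  rw [this]
  have hb : (fun x' => ten κ A x x') =O[nhds x] fun x' => (x' - x)^2 := by
    apply Asymptotics.IsBigO.of_bound 1
    filter_upwards with x'
    rw [Real.norm_eq_abs, Real.norm_eq_abs, abs_of_nonneg (sq_nonneg (x' - x)), abs_le]
    have e1 := ten_le_sq (κ := κ) hA x x'
    have e2 := le_ten_sq (κ := κ) hA x x'
    constructor <;> nlinarith [sq_nonneg (x' - x)]
  refine hb.trans_isLittleO ?_
  have := (Asymptotics.isLittleO_pow_id (𝕜 := ℝ) (n := 2) (by norm_num)).comp_tendsto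
    (show Filter.Tendsto (fun x' => x' - x) (nhds x) (nhds 0) from by
      have : Filter.Tendsto (fun x' => x' - x) (nhds x) (nhds (x - x)) :=
        (continuous_id.sub continuous_const).tendsto x
      simpa using this)
  exact this

lemma continuous_ten_left {κ : ℝ} {A : Set ℝ} (h0 : 0 < κ) (h1 : κ < 1) (hA : MeasurableSet A)
    (y : ℝ) : Continuous (fun x => ten κ A x y) := by
  have : (fun x => ten κ A x y)
      = fun x => ten κ A 0 y - ten κ A 0 x - (y - x) * ∫ s in (0:ℝ)..x, qf κ A s := by
    ext x
    rw [ten_add hA 0 x y]; ring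
  rw [this]
  have hc : Continuous (fun x => ten κ A 0 x) :=
    continuous_iff_continuousAt.2 fun x => (hasDerivAt_ten h0 h1 hA 0 x).continuousAt
  have := continuous_qint (κ := κ) hA 0
  fun_prop

lemma isOpen_NN {κ : ℝ} {A : Set ℝ} (h0 : 0 < κ) (h1 : κ < 1) (hA : MeasurableSet A) :
    IsOpen (NN κ A) := by
  have : NN κ A = ⋃ y, {x | 0 < ten κ A x y} := by ext x; simp [NN]
  rw [this]
  exact isOpen_iUnion fun y => isOpen_lt continuous_const (continuous_ten_left h0 h1 hA y)

lemma subset_NN {κ : ℝ} {A : Set ℝ} (h0 : 0 < κ) (h1 : κ < 1) (hA : IsOpen A) : A ⊆ NN κ A := by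
  intro x hx
  obtain ⟨ε, hε, hb⟩ := Metric.isOpen_iff.1 hA x hx
  refine ⟨x + ε/2, ?_⟩
  have hm := hA.measurableSet
  rw [ten_eq hm]
  have : ∫ s in x..(x+ε/2), (x + ε/2 - s) * A.indicator (fun _ => (1:ℝ)) s
      = ∫ s in x..(x+ε/2), (x + ε/2 - s) := by
    apply intervalIntegral.integral_congr
    intro s hs
    rw [uIcc_of_le (by linarith)] at hs
    have : s ∈ A := hb (by rw [Metric.mem_ball, Real.dist_eq, abs_lt]; constructor <;> linarith [hs.1, hs.2])
    simp [this]
  rw [this, integral_lin]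
  nlinarith [mul_pos hε hε]

lemma comp_le {κ : ℝ} {A : Set ℝ} (hA : MeasurableSet A) {α β : ℝ} (hαβ : α < β)
    (hα : α ∉ NN κ A) (hβ : β ∉ NN κ A) : ∫ s in α..β, qf κ A s ≤ 0 := by
  have h1 : ten κ A α β ≤ 0 := not_lt.1 fun h => hα ⟨_, h⟩
  have h2 : ten κ A β α ≤ 0 := not_lt.1 fun h => hβ ⟨_, h⟩
  have h3 := ten_add (κ := κ) hA α β α
  simp only [ten_self] at h3
  by_contra h
  push Not at h
  nlinarith

lemma comp_eq {κ : ℝ} (h0 : 0 < κ) (h1 : κ < 1) {A : Set ℝ} (hA : MeasurableSet A) {α β : ℝ}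
    (hαβ : α < β) (hα : α ∉ NN κ A) (hβ : β ∉ NN κ A) (hN : Ioo α β ⊆ NN κ A) :
    ∫ s in α..β, qf κ A s = 0 := by
  refine le_antisymm (comp_le hA hαβ hα hβ) ?_
  by_contra hneg
  push Not at hneg
  have hα' : ∀ y, ten κ A α y ≤ 0 := fun y => not_lt.1 fun h => hα ⟨_, h⟩
  have hβ' : ∀ y, ten κ A β y ≤ 0 := fun y => not_lt.1 fun h => hβ ⟨_, h⟩
  set w := ∫ s in α..β, qf κ A s with hw
  set c := w / 2 with hc
  have hder : ∀ x, HasDerivAt (fun y => ten κ A α y - c * (y - α))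
      ((∫ s in α..x, qf κ A s) - c) x := by
    intro x
    have e1 := hasDerivAt_ten h0 h1 hA α x
    have e2 : HasDerivAt (fun y => c * (y - α)) (c * 1) x :=
      ((hasDerivAt_id x).sub_const α).const_mul c
    rw [mul_one] at e2
    exact e1.sub e2
  set ψ := fun y => ten κ A α y - c * (y - α) with hψ
  have hcont : Continuous ψ := continuous_iff_continuousAt.2 fun x => (hder x).continuousAt
  obtain ⟨x, hx, hmax⟩ := isCompact_Icc.exists_isMaxOn (nonempty_Icc.2 hαβ.le) hcont.continuousOn
  have hψα : ψ α = 0 := by simp [hψ]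
  -- `x` is not `α`
  have hxα : x ≠ α := by
    rintro rfl
    have hd := hder x
    simp only [intervalIntegral.integral_same] at hd
    have hev : ∀ᶠ y in nhdsWithin x (Ioi x), ψ x < ψ y := by
      have := (hasDerivWithinAt_iff_tendsto_slope' (notMem_Ioi.2 le_rfl)).1 (hd.hasDerivWithinAt (s := Ioi x))
      have hpos : (0:ℝ) < 0 - c := by linarith
      filter_upwards [this.eventually (lt_mem_nhds hpos), self_mem_nhdsWithin] with y hy hyx
      rw [slope_def_field] at hy
      have hyx' : 0 < y - x := sub_pos.2 hyx
      have := (div_pos_iff_of_pos_right hyx').1 hy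
      linarith
    obtain ⟨y, hy1, hy2⟩ := (hev.and (Ioo_mem_nhdsGT hαβ)).exists
    exact absurd (hmax ⟨hy2.1.le, hy2.2.le⟩) (not_le.2 hy1)
  have hxβ : x ≠ β := by
    rintro rfl
    have hd := hder x
    have hev : ∀ᶠ y in nhdsWithin x (Iio x), ψ x < ψ y := by
      have := (hasDerivWithinAt_iff_tendsto_slope' (notMem_Iio.2 le_rfl)).1 (hd.hasDerivWithinAt (s := Iio x))
      have hpos : w - c < 0 := by linarith
      filter_upwards [this.eventually (gt_mem_nhds hpos), self_mem_nhdsWithin] with y hy hyx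
      rw [slope_def_field] at hy
      have hyx' : y - x < 0 := sub_neg.2 hyx
      have h3 := (div_lt_iff_of_neg hyx').1 hy
      linarith
    obtain ⟨y, hy1, hy2⟩ := (hev.and (Ioo_mem_nhdsLT hαβ)).exists
    exact absurd (hmax ⟨hy2.1.le, hy2.2.le⟩) (not_le.2 hy1)
  have hxI : x ∈ Ioo α β := ⟨lt_of_le_of_ne hx.1 (Ne.symm hxα), lt_of_le_of_ne hx.2 hxβ⟩
  have hloc : IsLocalMax ψ x := hmax.isLocalMax (Icc_mem_nhds hxI.1 hxI.2)
  have hWx : (∫ s in α..x, qf κ A s) = c := by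
    have := hloc.hasDerivAt_eq_zero (hder x); linarith
  obtain ⟨y, hy⟩ := hN hxI
  have hadd := ten_add (κ := κ) hA α x y
  rw [hWx] at hadd
  have hle : ψ y ≤ ψ x := by
    rcases lt_or_ge y α with hya | hya
    · have h3 : ψ α ≤ ψ x := hmax ⟨le_rfl, hαβ.le⟩
      have h4 : ψ y ≤ 0 := by
        simp only [hψ]
        nlinarith [hα' y]
      linarith
    · rcases le_or_gt y β with hyb | hyb
      · exact hmax ⟨hya, hyb⟩
      · have h3 : ψ β ≤ ψ x := hmax ⟨hαβ.le, le_rfl⟩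
        have h4 := ten_add (κ := κ) hA α β y
        have h5 : ψ y ≤ ψ β := by
          simp only [hψ]
          rw [h4, ← hw]
          nlinarith [hβ' y]
        linarith
  simp only [hψ] at hle
  linarith

lemma exists_right_cert {κ : ℝ} (h0 : 0 < κ) (h1 : κ < 1) {A : Set ℝ} (hA : MeasurableSet A)
    {α β : ℝ} (hα : α ∉ NN κ A) (hβ : β ∉ NN κ A) (hN : Ioo α β ⊆ NN κ A)
    {γ : ℝ} (hγ : γ ∈ Ioo α β) : ∃ t ∈ Ioo α γ, ∃ y, t < y ∧ 0 < ten κ A t y := by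
  have hαβ : α < β := hγ.1.trans hγ.2
  by_contra hcon
  push Not at hcon
  have hα' : ∀ y, ten κ A α y ≤ 0 := fun y => not_lt.1 fun h => hα ⟨_, h⟩
  have hβ' : ∀ y, ten κ A β y ≤ 0 := fun y => not_lt.1 fun h => hβ ⟨_, h⟩
  have hw := comp_eq h0 h1 hA hαβ hα hβ hN
  have hzero : ten κ A α β = 0 := by
    have h3 := ten_add (κ := κ) hA α β α
    rw [hw] at h3
    simp only [ten_self] at h3
    linarith [hα' β, hβ' α]
  have hneg : ∀ t ∈ Ioo α γ, ten κ A α t < 0 := by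
    intro t ht
    refine lt_of_le_of_ne (hα' t) fun heq => ?_
    have hloc : IsLocalMax (fun y => ten κ A α y) t := by
      filter_upwards with y; simp only [heq]; exact hα' y
    have hd := hloc.hasDerivAt_eq_zero (hasDerivAt_ten h0 h1 hA α t)
    obtain ⟨y, hy⟩ := hN ⟨ht.1, ht.2.trans hγ.2⟩
    have h3 := ten_add (κ := κ) hA α t y
    rw [hd, heq] at h3
    linarith [hα' y]
  have hW : ∀ t ∈ Ioo α γ, 0 < ∫ s in α..t, qf κ A s := by
    intro t ht
    have h3 := ten_add (κ := κ) hA α t β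
    have h4 := hcon t ht β (ht.2.trans hγ.2)
    have h5 := hneg t ht
    have h6 : 0 < β - t := by linarith [ht.2, hγ.2]
    by_contra hle
    push Not at hle
    nlinarith
  have hmono : MonotoneOn (fun y => ten κ A α y) (Icc α γ) := by
    apply monotoneOn_of_deriv_nonneg (convex_Icc _ _)
    · exact (continuous_iff_continuousAt.2
        fun x => (hasDerivAt_ten h0 h1 hA α x).continuousAt).continuousOn
    · exact fun x _ => (hasDerivAt_ten h0 h1 hA α x).differentiableAt.differentiableWithinAt
    · intro x hx
      rw [interior_Icc] at hx
      rw [(hasDerivAt_ten h0 h1 hA α x).deriv]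
      exact (hW x hx).le
  obtain ⟨t, ht⟩ := exists_between hγ.1
  have h3 := hmono ⟨le_rfl, hγ.1.le⟩ ⟨ht.1.le, ht.2.le⟩ ht.1.le
  simp only [ten_self] at h3
  linarith [hneg t ht]

lemma NN_cases {κ : ℝ} {A : Set ℝ} {x : ℝ} (hx : x ∈ NN κ A) :
    (∃ y, x < y ∧ 0 < ten κ A x y) ∨ (∃ y, -x < y ∧ 0 < ten κ (-A) (-x) y) := by
  obtain ⟨y, hy⟩ := hx
  rcases lt_trichotomy x y with h | h | h
  · exact Or.inl ⟨y, h, hy⟩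
  · subst h; simp at hy
  · refine Or.inr ⟨-y, by linarith, ?_⟩
    rwa [ten_neg]

lemma ten_set {κ : ℝ} {A : Set ℝ} (hA : MeasurableSet A) {x y : ℝ} (hxy : x ≤ y) :
    ten κ A x y = (∫ s in A ∩ Ioc x y, (y - s)) - κ * (y-x)^2/2 := by
  rw [ten_eq hA, intervalIntegral.integral_of_le hxy]
  congr 1
  rw [inter_comm, ← setIntegral_indicator hA]
  congr 1; ext s
  by_cases h : s ∈ A <;> simp [h]

lemma lin_intOn (y a b : ℝ) : IntegrableOn (fun s : ℝ => y - s) (Icc a b) :=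
  (by fun_prop : Continuous (fun s : ℝ => y - s)).continuousOn.integrableOn_Icc

lemma lin_intOn' (y : ℝ) {S : Set ℝ} {a b : ℝ} (hS : S ⊆ Icc a b) :
    IntegrableOn (fun s : ℝ => y - s) S :=
  (lin_intOn y a b).mono_set hS

lemma lin_Icc (y : ℝ) {p q : ℝ} (hpq : p ≤ q) :
    ∫ s in Icc p q, (y - s) = ((y-p)^2 - (y-q)^2)/2 := by
  rw [integral_Icc_eq_integral_Ioc, ← intervalIntegral.integral_of_le hpq, integral_lin]

lemma lin_mono {y : ℝ} {S T : Set ℝ} {a b : ℝ} (hT : MeasurableSet T) (hST : S ⊆ T)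
    (hTb : T ⊆ Icc a b) (hb : b ≤ y) : ∫ s in S, (y - s) ≤ ∫ s in T, (y - s) := by
  apply setIntegral_mono_set (lin_intOn' y hTb)
  · rw [Filter.EventuallyLE, ae_restrict_iff' hT]
    filter_upwards with s hs
    have := (hTb hs).2
    simp; linarith
  · exact hST.eventuallyLE

lemma lin_le_Icc {y p q : ℝ} {S : Set ℝ} (hS : S ⊆ Icc p q) (hpq : p ≤ q) (hq : q ≤ y) :
    ∫ s in S, (y - s) ≤ ((y-p)^2 - (y-q)^2)/2 := by
  rw [← lin_Icc y hpq]
  exact lin_mono measurableSet_Icc hS subset_rfl hq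

lemma lin_le_Icc2 {y p q p' : ℝ} {S : Set ℝ} (hS : S ⊆ Icc p q ∪ Icc p' y)
    (hpq : p ≤ q) (hqp : q < p') (hq : p' ≤ y) :
    ∫ s in S, (y - s) ≤ ((y-p)^2 - (y-q)^2)/2 + (y-p')^2/2 := by
  have h1 : ∫ s in Icc p q ∪ Icc p' y, (y - s) = ((y-p)^2 - (y-q)^2)/2 + (y-p')^2/2 := by
    rw [setIntegral_union _ measurableSet_Icc (lin_intOn _ _ _) (lin_intOn _ _ _), lin_Icc _ hpq,
      lin_Icc _ hq]
    · ring
    · rw [Set.disjoint_left]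
      intro s h1 h2
      linarith [h1.2, h2.1]
  rw [← h1]
  refine lin_mono (a := p) (b := y) (measurableSet_Icc.union measurableSet_Icc) hS ?_ le_rfl
  rintro s (h | h)
  · exact ⟨h.1, by linarith [h.2]⟩
  · exact ⟨by linarith [h.1], h.2⟩

lemma lin_le_mul {ρ x y : ℝ} (hρ : 0 ≤ ρ) (hxy : x ≤ y) {A : Set ℝ} (hA : MeasurableSet A)
    (hAρ : A ⊆ Ioo (-ρ) ρ) :
    ∫ s in A ∩ Ioc x y, (y - s) ≤ 2 * ρ * (y - x) := by
  have h1 : ∫ s in A ∩ Ioc x y, (y - s) ≤ ∫ s in A ∩ Ioc x y, (y - x) := by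
    apply setIntegral_mono_on
    · exact lin_intOn' y (a := x) (b := y) fun s hs => ⟨hs.2.1.le, hs.2.2⟩
    · exact integrableOn_const (measure_ne_top_of_subset inter_subset_right (by simp)) (by simp)
    · exact hA.inter measurableSet_Ioc
    · intro s hs; linarith [hs.2.1]
  refine h1.trans ?_
  rw [setIntegral_const, smul_eq_mul]
  apply mul_le_mul_of_nonneg_right _ (by linarith)
  have : volume.real (A ∩ Ioc x y) ≤ volume.real (Ioo (-ρ) ρ) :=
    measureReal_mono (inter_subset_left.trans hAρ) (by rw [Real.volume_Ioo]; exact ENNReal.ofReal_ne_top)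
  rw [Real.volume_real_Ioo_of_le (by linarith)] at this
  linarith

lemma cert_len {κ ρ x y : ℝ} (h0 : 0 < κ) (hρ : 0 ≤ ρ) (hxy : x < y) {A : Set ℝ}
    (hA : MeasurableSet A) (hAρ : A ⊆ Ioo (-ρ) ρ) (h : 0 < ten κ A x y) :
    κ * (y - x) < 4 * ρ := by
  rw [ten_set hA hxy.le] at h
  have := lin_le_mul hρ hxy.le hA hAρ
  have h3 : 0 < y - x := by linarith
  by_contra hc
  push Not at hc
  nlinarith

/-- interval estimate, one certificate -/
lemma interval_calc {κ a b x y : ℝ} (h0 : 0 < κ) (h1 : κ < 1) (hab : a ≤ b) {A : Set ℝ}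
    (hA : MeasurableSet A) (hAI : A ∩ Ioc x y ⊆ Icc a b) (hxy : x < y)
    (hx : 2 * κ * x ≤ κ * (a + b) - (b - a)) : ten κ A x y ≤ 0 := by
  have hxa : x ≤ a := by nlinarith
  rw [ten_set hA hxy.le]
  rcases le_or_gt b y with hby | hby
  · have := lin_le_Icc hAI hab hby
    set m := y - (a+b)/2
    set l := b - a
    have hm : 0 ≤ m := by simp only [m]; linarith
    have hr : κ * m + l/2 ≤ κ * (y - x) := by simp only [m, l]; nlinarith
    have e : ((y-a)^2 - (y-b)^2)/2 = l * m := by simp only [m, l]; ring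
    rw [e] at this
    have hl : 0 ≤ l := by simp only [l]; linarith
    have h2 : (κ * m + l/2)^2 ≤ (κ * (y-x))^2 := by gcongr
    have h3 : 2 * κ * l * m ≤ (κ * (y-x))^2 := by nlinarith [sq_nonneg (κ * m - l/2)]
    have h4 : 2 * l * m ≤ κ * (y-x)^2 := by
      by_contra hc
      push Not at hc
      nlinarith
    linarith
  · rcases le_or_gt a y with hay | hay
    · have hAI' : A ∩ Ioc x y ⊆ Icc a y := fun s hs => ⟨(hAI hs).1, hs.2.2⟩
      have := lin_le_Icc hAI' hay le_rfl
      set w := y - a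
      have hw : 0 ≤ w := by simp only [w]; linarith
      have hr : w * (1 + κ) ≤ 2 * κ * (y - x) := by simp only [w]; nlinarith
      have h2 : (w * (1+κ))^2 ≤ (2 * κ * (y-x))^2 := by gcongr
      have h3 : κ * w^2 ≤ κ * (κ * (y-x)^2) := by nlinarith [mul_nonneg (sq_nonneg w) (sq_nonneg (1 - κ))]
      have h4 := le_of_mul_le_mul_left h3 h0
      simp only [sub_self] at this
      nlinarith
    · have : A ∩ Ioc x y = ∅ := by
        ext s; simp only [mem_empty_iff_false, iff_false]
        intro hs
        linarith [(hAI hs).1, hs.2.2]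
      rw [this]
      simp
      positivity

lemma NN_interval_left {κ a b x : ℝ} (h0 : 0 < κ) (h1 : κ < 1) (hab : a ≤ b) {A : Set ℝ}
    (hA : MeasurableSet A) (hAI : A ⊆ Ioo a b) (hx : x ∈ NN κ A) :
    κ * (a + b) - (b - a) < 2 * κ * x := by
  by_contra hc
  push Not at hc
  have hxa : x ≤ a := by nlinarith
  rcases NN_cases hx with ⟨y, hy, h⟩ | ⟨y, hy, h⟩
  · have := interval_calc h0 h1 hab hA
      (fun s hs => ⟨(hAI hs.1).1.le, (hAI hs.1).2.le⟩) hy hc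
    linarith
  · have hem : (-A) ∩ Ioc (-x) y = ∅ := by
      ext s; simp only [mem_empty_iff_false, iff_false]
      rintro ⟨h1, h2⟩
      have := (hAI h1).1
      linarith [h2.1]
    rw [ten_set hA.neg hy.le, hem] at h
    simp at h
    nlinarith [sq_nonneg (y + x)]

lemma NN_ball {κ ρ x : ℝ} (h0 : 0 < κ) (h1 : κ < 1) (hρ : 0 ≤ ρ) {A : Set ℝ}
    (hA : MeasurableSet A) (hAI : A ⊆ Ioo (-ρ) ρ) (hx : x ∈ NN κ A) : κ * x ∈ Ioo (-ρ) ρ := by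
  have e1 := NN_interval_left h0 h1 (by linarith) hA hAI hx
  have hneg : -A ⊆ Ioo (-ρ) ρ := by
    intro s hs
    have := hAI hs
    exact ⟨by linarith [this.2], by linarith [this.1]⟩
  have e2 := NN_interval_left h0 h1 (by linarith) hA.neg hneg ((NN_neg κ A x).2 hx)
  exact ⟨by linarith, by linarith⟩

lemma NN_gap_left {κ c p q x : ℝ} (h0 : 1/2 ≤ κ) (h1 : κ < 1) (hq : -c < q) (hqc : q < c)
    (hqp : q < p) (hκ : (1 - κ) * 64 * c^2 ≤ (p - q)^2) {A : Set ℝ} (hA : MeasurableSet A)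
    (hAI : A ⊆ Ioo (-c) q ∪ Ioo p c) (hx : x ∈ NN κ A) :
    -c + (1 - κ) * (c - q) / 2 ≤ κ * x := by
  have hκ0 : 0 < κ := by linarith
  have hAc : A ⊆ Ioo (-c) c := by
    intro s hs
    rcases hAI hs with h | h
    · exact ⟨h.1, h.2.trans hqc⟩
    · exact ⟨by linarith [h.1], h.2⟩
  by_contra hc
  push Not at hc
  have hxc : x ≤ -c := by nlinarith
  rcases NN_cases hx with ⟨y, hy, h⟩ | ⟨y, hy, h⟩
  · rcases le_or_gt y p with hyp | hyp
    · have hsub : A ∩ Ioc x y ⊆ Icc (-c) q := by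
        rintro s ⟨hs, hs2⟩
        rcases hAI hs with h | h
        · exact ⟨h.1.le, h.2.le⟩
        · linarith [h.1, hs2.2]
      have := interval_calc hκ0 h1 hq.le hA hsub hy (by linarith)
      linarith
    · have hlen := cert_len hκ0 (by linarith) hy hA hAc h
      rw [ten_set hA hy.le] at h
      have hsub : A ∩ Ioc x y ⊆ Icc (-c) q ∪ Icc p y := by
        rintro s ⟨hs, hs2⟩
        rcases hAI hs with h | h
        · exact Or.inl ⟨h.1.le, h.2.le⟩
        · exact Or.inr ⟨h.1.le, hs2.2⟩
      have := lin_le_Icc2 hsub hq.le hqp hyp.le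
      have hr : y - x ≤ 8 * c := by nlinarith
      have hr2 : (y-x)^2 ≤ (8*c)^2 := by
        have : 0 < y - x := by linarith
        gcongr
      have h3 : (y + c)^2 ≤ (y - x)^2 := by
        have : 0 ≤ y + c := by linarith
        have : y + c ≤ y - x := by linarith
        gcongr
      have h4 : (y-q)^2 - (y-p)^2 ≥ (p-q)^2 := by nlinarith
      have h5 : (1-κ) * (y-x)^2 ≤ (p-q)^2 := by nlinarith
      have e : (y - -c)^2 = (y+c)^2 := by ring
      rw [e] at this
      nlinarith
  · have hem : (-A) ∩ Ioc (-x) y = ∅ := by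
      ext s; simp only [mem_empty_iff_false, iff_false]
      rintro ⟨h1, h2⟩
      have := (hAc h1).1
      linarith [h2.1]
    rw [ten_set hA.neg hy.le, hem] at h
    simp at h
    nlinarith [sq_nonneg (y + x)]

lemma NN_disp {κ ρ x : ℝ} (h0 : 1/2 ≤ κ) (h1 : κ < 1) (hρ : 0 ≤ ρ) {A : Set ℝ}
    (hA : MeasurableSet A) (hAI : A ⊆ Ioo (-ρ) ρ) (hx : x ∈ NN κ A) :
    ∃ a ∈ A, |a - x| ≤ 8 * ρ * (1 - κ) := by
  have hκ0 : 0 < κ := by linarith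
  have key : ∀ {A : Set ℝ} {x y : ℝ}, MeasurableSet A → A ⊆ Ioo (-ρ) ρ → x < y →
      0 < ten κ A x y → ∃ a ∈ A, |a - x| ≤ 8 * ρ * (1 - κ) := by
    intro A x y hA hAI hy h
    by_contra hcon
    push Not at hcon
    have hlen := cert_len hκ0 hρ hy hA hAI h
    have hlen' : y - x ≤ 8 * ρ := by nlinarith
    rw [ten_set hA hy.le] at h
    set δ := 8 * ρ * (1 - κ)
    have hδ : 0 ≤ δ := by simp only [δ]; have : 0 ≤ 1 - κ := by linarith
                          positivity
    have hδr : (y - x) * (1 - κ) ≤ δ := by simp only [δ]; nlinarith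
    have hsub : A ∩ Ioc x y ⊆ Icc (x + δ) y := by
      rintro s ⟨hs, hs2⟩
      have := hcon s hs
      rw [abs_of_pos (by linarith [hs2.1])] at this
      exact ⟨by linarith, hs2.2⟩
    rcases le_or_gt (x + δ) y with hc | hc
    · have := lin_le_Icc hsub hc le_rfl
      have h3 : y - (x+δ) ≤ κ * (y-x) := by linarith
      have h4 : (y - (x+δ))^2 ≤ (κ * (y-x))^2 := by
        have : 0 ≤ y - (x+δ) := by linarith
        gcongr
      have h5 : (κ * (y-x))^2 ≤ κ * (y-x)^2 := by nlinarith [mul_nonneg (mul_nonneg hκ0.le (by linarith : (0:ℝ) ≤ 1 - κ)) (sq_nonneg (y-x))]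
      simp only [sub_self] at this
      nlinarith
    · rw [Icc_eq_empty (not_le.2 hc)] at hsub
      rw [subset_empty_iff.1 hsub] at h
      simp at h
      nlinarith [sq_nonneg (y - x)]
  rcases NN_cases hx with ⟨y, hy, h⟩ | ⟨y, hy, h⟩
  · exact key hA hAI hy h
  · obtain ⟨a, ha, hax⟩ := key hA.neg (fun s hs => by
      have := hAI hs
      exact ⟨by linarith [this.2], by linarith [this.1]⟩) hy h
    refine ⟨-a, ha, ?_⟩
    rw [show -a - x = -(a - -x) by ring, abs_neg]; exact hax

lemma NN_iUnion {κ x : ℝ} {A : ℕ → Set ℝ} (hA : ∀ n, MeasurableSet (A n)) (hm : Monotone A)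
    (hx : x ∈ NN κ (⋃ n, A n)) : ∃ n, x ∈ NN κ (A n) := by
  have key : ∀ {A : ℕ → Set ℝ} {x y : ℝ}, (∀ n, MeasurableSet (A n)) → Monotone A → x < y →
      0 < ten κ (⋃ n, A n) x y → ∃ n, 0 < ten κ (A n) x y := by
    intro A x y hA hm hy h
    have ht : Filter.Tendsto (fun n => ten κ (A n) x y) Filter.atTop
        (nhds (ten κ (⋃ n, A n) x y)) := by
      simp_rw [ten_set (hA _) hy.le]
      rw [ten_set (MeasurableSet.iUnion hA) hy.le]
      apply Filter.Tendsto.sub_const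
      have := tendsto_setIntegral_of_monotone (μ := volume) (f := fun s : ℝ => y - s)
        (s := fun n => A n ∩ Ioc x y) (fun n => (hA n).inter measurableSet_Ioc)
        (fun m n hmn => inter_subset_inter_left _ (hm hmn)) ?_
      · rwa [← iUnion_inter] at this
      · exact lin_intOn' y (a := x) (b := y)
          (iUnion_subset fun n s hs => ⟨hs.2.1.le, hs.2.2⟩)
    exact (ht.eventually (lt_mem_nhds h)).exists
  rcases NN_cases hx with ⟨y, hy, h⟩ | ⟨y, hy, h⟩
  · obtain ⟨n, hn⟩ := key hA hm hy h
    exact ⟨n, y, hn⟩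
  · rw [Set.iUnion_neg] at h
    obtain ⟨n, hn⟩ := key (fun n => (hA n).neg) (fun m n hmn => Set.neg_subset_neg.2 (hm hmn)) hy h
    exact ⟨n, (NN_neg _ _ _).1 ⟨y, hn⟩⟩

lemma exists_comp {O : Set ℝ} (hO : IsOpen O) {ρ : ℝ} (hb : O ⊆ Ioo (-ρ) ρ) {x : ℝ} (hx : x ∈ O) :
    ∃ α β, x ∈ Ioo α β ∧ α ∉ O ∧ β ∉ O ∧ Ioo α β ⊆ O := by
  have hcl : IsClosed Oᶜ := hO.isClosed_compl
  have hxρ := hb hx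
  have c1 : IsClosed (Oᶜ ∩ Iic x) := hcl.inter isClosed_Iic
  have c2 : IsClosed (Oᶜ ∩ Ici x) := hcl.inter isClosed_Ici
  have n1 : (Oᶜ ∩ Iic x).Nonempty := ⟨-ρ, fun h => lt_irrefl _ (hb h).1, hxρ.1.le⟩
  have n2 : (Oᶜ ∩ Ici x).Nonempty := ⟨ρ, fun h => lt_irrefl _ (hb h).2, hxρ.2.le⟩
  have b1 : BddAbove (Oᶜ ∩ Iic x) := ⟨x, fun y hy => hy.2⟩
  have b2 : BddBelow (Oᶜ ∩ Ici x) := ⟨x, fun y hy => hy.2⟩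
  have m1 := c1.csSup_mem n1 b1
  have m2 := c2.csInf_mem n2 b2
  refine ⟨sSup (Oᶜ ∩ Iic x), sInf (Oᶜ ∩ Ici x), ⟨lt_of_le_of_ne m1.2 ?_, lt_of_le_of_ne m2.2 ?_⟩,
    m1.1, m2.1, ?_⟩
  · intro h; exact m1.1 (by rw [h]; exact hx)
  · intro h; exact m2.1 (by rw [← h]; exact hx)
  · intro y hy
    by_contra hyO
    rcases le_total y x with h | h
    · exact absurd (le_csSup b1 ⟨hyO, h⟩) (not_le.2 hy.1)
    · exact absurd (csInf_le b2 ⟨hyO, h⟩) (not_le.2 hy.2)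

lemma integral_zero_of_comp {O : Set ℝ} (hO : IsOpen O) {ρ : ℝ} (hb : O ⊆ Ioo (-ρ) ρ) {q : ℝ → ℝ}
    (hq : IntegrableOn q O)
    (h : ∀ α β, α < β → α ∉ O → β ∉ O → Ioo α β ⊆ O → ∫ s in Ioo α β, q s = 0) :
    ∫ s in O, q s = 0 := by
  set I : Set (ℝ × ℝ) := {p | p.1 < p.2 ∧ p.1 ∉ O ∧ p.2 ∉ O ∧ Ioo p.1 p.2 ⊆ O} with hI
  have hdis : I.PairwiseDisjoint (fun p => Ioo p.1 p.2) := by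
    intro p hp p' hp' hne
    rw [Function.onFun, Set.disjoint_left]
    intro s hs hs'
    apply hne
    have e1 : p.1 = p'.1 := by
      rcases lt_trichotomy p.1 p'.1 with h | h | h
      · exact absurd (hp.2.2.2 ⟨h, hs'.1.trans hs.2⟩) hp'.2.1
      · exact h
      · exact absurd (hp'.2.2.2 ⟨h, hs.1.trans hs'.2⟩) hp.2.1
    have e2 : p.2 = p'.2 := by
      rcases lt_trichotomy p.2 p'.2 with h | h | h
      · exact absurd (hp'.2.2.2 ⟨hs'.1.trans hs.2, h⟩) hp.2.2.1
      · exact h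
      · exact absurd (hp.2.2.2 ⟨hs.1.trans hs'.2, h⟩) hp'.2.2.1
    exact Prod.ext e1 e2
  have hcount : I.Countable := hdis.countable_of_isOpen (fun _ _ => isOpen_Ioo)
    (fun p hp => nonempty_Ioo.2 hp.1)
  have : Countable I := hcount.to_subtype
  have hU : O = ⋃ p : I, Ioo p.1.1 p.1.2 := by
    apply Subset.antisymm
    · intro x hx
      obtain ⟨α, β, h1, h2, h3, h4⟩ := exists_comp hO hb hx
      exact mem_iUnion.2 ⟨⟨(α, β), h1.1.trans h1.2, h2, h3, h4⟩, h1⟩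
    · exact iUnion_subset fun p => p.2.2.2.2
  rw [hU] at hq ⊢
  rw [integral_iUnion (fun _ => measurableSet_Ioo) _ hq]
  · rw [← tsum_zero (α := ℝ) (β := I)]
    congr 1; ext p
    exact h _ _ p.2.1 p.2.2.1 p.2.2.2.1 p.2.2.2.2
  · intro p p' hne
    exact hdis p.2 p'.2 (fun h => hne (Subtype.ext h))

lemma NN_bdd {κ ρ : ℝ} (h0 : 0 < κ) (h1 : κ < 1) (hρ : 0 ≤ ρ) {A : Set ℝ}
    (hA : MeasurableSet A) (hAI : A ⊆ Ioo (-ρ) ρ) : NN κ A ⊆ Ioo (-(ρ/κ)) (ρ/κ) := by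
  intro x hx
  have := NN_ball h0 h1 hρ hA hAI hx
  constructor
  · rw [neg_lt, lt_div_iff₀ h0]; linarith [this.1]
  · rw [lt_div_iff₀ h0]; linarith [this.2]

lemma NN_measure {κ ρ : ℝ} (h0 : 0 < κ) (h1 : κ < 1) (hρ : 0 ≤ ρ) {A : Set ℝ}
    (hA : IsOpen A) (hAI : A ⊆ Ioo (-ρ) ρ) : κ * volume.real (NN κ A) = volume.real A := by
  have hO := isOpen_NN h0 h1 hA.measurableSet
  have hb := NN_bdd h0 h1 hρ hA.measurableSet hAI
  have hfin : volume (NN κ A) ≠ ⊤ := measure_ne_top_of_subset hb (by rw [Real.volume_Ioo]; exact ENNReal.ofReal_ne_top)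
  have i1 : IntegrableOn (A.indicator (fun _ => (1:ℝ))) (NN κ A) :=
    (integrableOn_const hfin (by simp)).indicator hA.measurableSet
  have i2 : IntegrableOn (fun _ => κ) (NN κ A) := integrableOn_const hfin (by simp)
  have hz := integral_zero_of_comp (q := qf κ A) hO hb (i1.sub i2) ?_
  · have e : ∫ s in NN κ A, qf κ A s = (∫ s in NN κ A, A.indicator (fun _ => (1:ℝ)) s) - ∫ s in NN κ A, κ :=
      integral_sub i1 i2
    rw [e, setIntegral_indicator hA.measurableSet, inter_eq_right.2 (subset_NN h0 h1 hA)] at hz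
    simp at hz
    linarith
  · intro α β hαβ hα hβ hN
    rw [← integral_Ioc_eq_integral_Ioo, ← intervalIntegral.integral_of_le hαβ.le]
    exact comp_eq h0 h1 hA.measurableSet hαβ hα hβ hN

lemma bathtub {B : Set ℝ} (hB : MeasurableSet B) {p Y : ℝ} (hBs : B ⊆ Icc p Y) :
    ∫ s in B, (Y - s) ≤ volume.real B * (Y - p) - (volume.real B)^2/2 := by
  set v := volume.real B with hv
  have hv0 : 0 ≤ v := measureReal_nonneg
  have hfin : volume B ≠ ⊤ := measure_ne_top_of_subset hBs (by rw [Real.volume_Icc]; exact ENNReal.ofReal_ne_top)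
  have h1 : ∫ s in B, (p + v - s) ≤ v^2/2 := by
    have e : ∫ s in Icc p (p+v), (p + v - s) = v^2/2 := by rw [lin_Icc _ (by linarith)]; ring
    have iB : IntegrableOn (fun s => p + v - s) B := lin_intOn' _ hBs
    rw [← e, ← integral_indicator hB, ← integral_indicator measurableSet_Icc]
    apply integral_mono
    · exact iB.integrable_indicator hB
    · exact (lin_intOn _ _ _).integrable_indicator measurableSet_Icc
    · intro s
      by_cases h : s ∈ B <;> by_cases h' : s ∈ Icc p (p+v)
      · simp only [indicator, h, h', if_true]; exact le_rfl
      · simp only [indicator, h, h', if_true, if_false]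
        have := (hBs h).1
        have : p + v < s := by by_contra hc; push Not at hc; exact h' ⟨this, hc⟩
        linarith
      · simp only [indicator, h, h', if_true, if_false]
        linarith [h'.2]
      · simp only [indicator, h, h', if_false]; exact le_rfl
  have h2 : ∫ s in B, (Y - s) = (∫ s in B, (p + v - s)) + ∫ s in B, (Y - p - v) := by
    rw [← integral_add (lin_intOn' _ hBs) (integrableOn_const hfin (by simp))]
    congr 1; ext s; ring
  rw [h2, setIntegral_const, smul_eq_mul, ← hv]
  nlinarith

lemma dil_right {κ h : ℝ} (h0 : 0 < κ) (h1 : κ < 1) (hh : 0 ≤ h) {A B : Set ℝ}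
    (hA : MeasurableSet A) (hB : MeasurableSet B) (hAB : ∀ a ∈ A, ∀ θ, |θ| ≤ h → a + θ ∈ B)
    {x Y : ℝ} (hxY : x < Y) (hc : 0 < ten κ A x Y) : 0 < ten κ B (x - h/κ) (Y + h/κ) := by
  set H := h / κ with hH
  have hhH : h = κ * H := by rw [hH]; field_simp
  have hH0 : 0 ≤ H := by positivity
  have hhle : h ≤ H := by rw [hhH]; nlinarith
  rw [ten_set hA hxY.le] at hc
  rw [ten_set hB (by linarith)]
  set C := A ∩ Ioc x Y with hC
  have hCm : MeasurableSet C := hA.inter measurableSet_Ioc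
  have hCne : C.Nonempty := by
    by_contra hne
    rw [not_nonempty_iff_eq_empty] at hne
    rw [hne] at hc
    simp at hc
    nlinarith [sq_nonneg (Y - x)]
  have hCb : BddBelow C := ⟨x, fun s hs => hs.2.1.le⟩
  set e0 := sInf C with he0
  have he0x : x ≤ e0 := le_csInf hCne fun s hs => hs.2.1.le
  have he0Y : e0 ≤ Y := by obtain ⟨s, hs⟩ := hCne; exact (csInf_le hCb hs).trans hs.2.2
  have hCs : C ⊆ Icc e0 Y := fun s hs => ⟨csInf_le hCb hs, hs.2.2⟩
  have hbt := bathtub hCm hCs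
  set v := volume.real C with hv
  have hv0 : 0 ≤ v := measureReal_nonneg
  have hCfin : volume C ≠ ⊤ := measure_ne_top_of_subset hCs (by rw [Real.volume_Icc]; exact ENNReal.ofReal_ne_top)
  -- key inequality
  have hkey : 2 * κ * (e0 - x) ≤ v * (1 - κ) := by
    set r := Y - x
    set ρ0 := e0 - x
    have e : Y - e0 = r - ρ0 := by simp only [r, ρ0]; ring
    rw [e] at hbt
    have h3 : κ * r^2/2 < v * (r - ρ0) - v^2/2 := by linarith
    have hvp : 0 < v := by
      rcases hv0.lt_or_eq with h | h
      · exact h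
      · rw [← h] at h3; nlinarith [sq_nonneg r]
    have h4 : 2 * κ * v * ρ0 ≤ v * (v * (1-κ)) := by nlinarith [sq_nonneg (κ * r - v)]
    by_contra hcon
    push Not at hcon
    nlinarith
  -- the two pieces
  set D := Ioo (e0 - h) (e0 + h) with hD
  set C' := (fun s => s + h) '' C with hC'
  have hC'm : MeasurableSet C' := (measurableEmbedding_addRight h).measurableSet_image.2 hCm
  have hDB : D ⊆ B := by
    intro t ht
    obtain ⟨a, ha, hat⟩ := exists_lt_of_csInf_lt hCne (show e0 < t + h by linarith [ht.1])
    have hae := csInf_le hCb ha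
    have := hAB a ha.1 (t - a) (by rw [abs_le]; constructor <;> linarith [ht.1, ht.2])
    simpa using this
  have hC'B : C' ⊆ B := by
    rintro _ ⟨a, ha, rfl⟩
    exact hAB a ha.1 h (by rw [abs_of_nonneg hh])
  have hdis : Disjoint D C' := by
    rw [Set.disjoint_left]
    rintro s hs ⟨a, ha, rfl⟩
    have := csInf_le hCb ha
    simp only [D, mem_Ioo] at hs
    linarith [hs.2]
  have hDs : D ⊆ Icc (x - H) (Y + H) := fun s hs => ⟨by linarith [hs.1], by linarith [hs.2]⟩
  have hC's : C' ⊆ Icc (x - H) (Y + H) := by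
    rintro _ ⟨a, ha, rfl⟩
    exact ⟨by linarith [ha.2.1], by simp only; linarith [ha.2.2]⟩
  have hsub : D ∪ C' ⊆ B ∩ Ioc (x - H) (Y + H) := by
    rintro s (hs | ⟨a, ha, rfl⟩)
    · exact ⟨hDB hs, by linarith [hs.1], by linarith [hs.2]⟩
    · exact ⟨hC'B ⟨a, ha, rfl⟩, by simp only; linarith [ha.2.1], by simp only; linarith [ha.2.2]⟩
  have hlow : ∫ s in D ∪ C', (Y + H - s) ≤ ∫ s in B ∩ Ioc (x - H) (Y + H), (Y + H - s) :=
    lin_mono (a := x - H) (b := Y + H) (hB.inter measurableSet_Ioc) hsub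
      (fun s hs => ⟨hs.2.1.le, hs.2.2⟩) le_rfl
  rw [setIntegral_union hdis hC'm (lin_intOn' _ hDs) (lin_intOn' _ hC's)] at hlow
  have i1 : ∫ s in D, (Y + H - s) = 2 * h * (Y + H - e0) := by
    rw [hD, ← integral_Icc_eq_integral_Ioo, lin_Icc _ (by linarith)]; ring
  have i2 : ∫ s in C', (Y + H - s) = (∫ s in C, (Y - s)) + v * (H - h) := by
    rw [hC', (measurePreserving_add_right volume h).setIntegral_image_emb
      (measurableEmbedding_addRight h)]
    have : ∀ s, Y + H - (s + h) = (Y - s) + (H - h) := by intro s; ring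
    simp only [this]
    rw [integral_add (lin_intOn' _ hCs) (integrableOn_const hCfin (by simp)), setIntegral_const,
      smul_eq_mul]
  rw [i1, i2] at hlow
  have h5 : H * (2 * κ * (e0 - x)) ≤ H * (v * (1 - κ)) := by gcongr
  have e2 : Y + H - (x - H) = (Y - x) + 2 * H := by ring
  rw [e2]
  rw [hhH] at hlow
  nlinarith

lemma dil_left {κ ρ d : ℝ} (h0 : 0 < κ) (h1 : κ < 1) (hρ : 0 ≤ ρ) (hd : 0 ≤ d) {A B : Set ℝ}
    (hA : IsOpen A) (hAI : A ⊆ Ioo (-ρ) ρ)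
    (hB : MeasurableSet B) (hAB : ∀ a ∈ A, ∀ θ, |θ| ≤ κ * d → a + θ ∈ B)
    {x : ℝ} (hx : x ∈ NN κ A) : x - d ∈ NN κ B := by
  have hAm := hA.measurableSet
  have hABs : A ⊆ B := fun a ha => by simpa using hAB a ha 0 (by simp; positivity)
  by_cases hxd : x - d ∈ NN κ A
  · exact NN_mono hAm hB hABs hxd
  obtain ⟨α, β, hxI, hα, hβ, hN⟩ := exists_comp (isOpen_NN h0 h1 hAm) (NN_bdd h0 h1 hρ hAm hAI) hx
  have hxα : x - d ≤ α := by
    by_contra hc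
    push Not at hc
    exact hxd (hN ⟨hc, by linarith [hxI.2]⟩)
  obtain ⟨t, ht, y, hty, hy⟩ := exists_right_cert h0 h1 hAm hα hβ hN hxI
  have hle : t - (x - d) ≤ d := by linarith [ht.2]
  have := dil_right (h := κ * (t - (x - d))) h0 h1 (mul_nonneg h0.le (by linarith [ht.1])) hAm hB
    (fun a ha θ hθ => hAB a ha θ (hθ.trans (by gcongr))) hty hy
  refine ⟨y + κ * (t - (x - d)) / κ, ?_⟩
  · have e : t - κ * (t - (x-d)) / κ = x - d := by field_simp; ring
    rwa [e] at this

lemma NN_dil {κ ρ h d : ℝ} (h0 : 0 < κ) (h1 : κ < 1) (hρ : 0 ≤ ρ) (hd : κ * |d| ≤ h) {A B : Set ℝ}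
    (hA : IsOpen A) (hAI : A ⊆ Ioo (-ρ) ρ)
    (hB : MeasurableSet B) (hAB : ∀ a ∈ A, ∀ θ, |θ| ≤ h → a + θ ∈ B)
    {x : ℝ} (hx : x ∈ NN κ A) : x + d ∈ NN κ B := by
  rcases le_total d 0 with hd0 | hd0
  · rw [abs_of_nonpos hd0] at hd
    have := dil_left (d := -d) h0 h1 hρ (by linarith) hA hAI hB (fun a ha θ hθ => hAB a ha θ (hθ.trans hd)) hx
    simpa using this
  · rw [abs_of_nonneg hd0] at hd
    have := dil_left (A := -A) (B := -B) (d := d) (x := -x) h0 h1 hρ hd0 hA.neg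
      (fun s hs => by
        have := hAI hs
        exact ⟨by linarith [this.2], by linarith [this.1]⟩) hB.neg
      (fun a ha θ hθ => by
        have := hAB (-a) ha (-θ) (by rw [abs_neg]; exact hθ.trans hd)
        rw [Set.mem_neg]
        rwa [neg_add]) ((NN_neg _ _ _).2 hx)
    rw [show -x - d = -(x + d) by ring] at this
    exact (NN_neg _ _ _).1 this

/-- continuous symmetrization of a one-dimensional set, parameter `κ = exp (-t)` -/
def SS (κ : ℝ) (A : Set ℝ) : Set ℝ := {t | t / κ ∈ NN κ A}

/-- symmetric and star-shaped about the origin -/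
def StarS (D : Set ℝ) : Prop := ∀ t t' : ℝ, |t| ≤ |t'| → t' ∈ D → t ∈ D

lemma SS_mono {κ : ℝ} {A B : Set ℝ} (hA : MeasurableSet A) (hB : MeasurableSet B)
    (hAB : A ⊆ B) : SS κ A ⊆ SS κ B := fun _ ht => NN_mono hA hB hAB ht

lemma isOpen_SS {κ : ℝ} {A : Set ℝ} (h0 : 0 < κ) (h1 : κ < 1) (hA : MeasurableSet A) :
    IsOpen (SS κ A) :=
  (isOpen_NN h0 h1 hA).preimage (continuous_id.div_const κ)

lemma SS_ball {κ ρ : ℝ} (h0 : 0 < κ) (h1 : κ < 1) (hρ : 0 ≤ ρ) {A : Set ℝ}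
    (hA : MeasurableSet A) (hAI : A ⊆ Ioo (-ρ) ρ) : SS κ A ⊆ Ioo (-ρ) ρ := by
  intro t ht
  have := NN_ball h0 h1 hρ hA hAI ht
  rwa [mul_div_cancel₀ _ h0.ne'] at this

lemma SS_vol {κ ρ : ℝ} (h0 : 0 < κ) (h1 : κ < 1) (hρ : 0 ≤ ρ) {A : Set ℝ}
    (hA : IsOpen A) (hAI : A ⊆ Ioo (-ρ) ρ) : volume (SS κ A) = volume A := by
  have h := NN_measure h0 h1 hρ hA hAI
  have hfinI : ∀ a b : ℝ, volume (Ioo a b) ≠ ⊤ := fun a b => by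
    rw [Real.volume_Ioo]; exact ENNReal.ofReal_ne_top
  have hA' : volume A ≠ ⊤ := measure_ne_top_of_subset hAI (hfinI _ _)
  have hN' : volume (NN κ A) ≠ ⊤ :=
    measure_ne_top_of_subset (NN_bdd h0 h1 hρ hA.measurableSet hAI) (hfinI _ _)
  have e : SS κ A = (fun t => κ⁻¹ * t) ⁻¹' (NN κ A) := by
    ext t; simp [SS, div_eq_inv_mul]
  rw [e, Real.volume_preimage_mul_left (inv_ne_zero h0.ne'), inv_inv, abs_of_pos h0]
  rw [← ofReal_measureReal hN', ← ofReal_measureReal hA', ← ENNReal.ofReal_mul h0.le, h]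

lemma SS_dil {κ ρ h t t' : ℝ} (h0 : 0 < κ) (h1 : κ < 1) (hρ : 0 ≤ ρ) (hd : |t' - t| ≤ h)
    {A B : Set ℝ} (hA : IsOpen A) (hAI : A ⊆ Ioo (-ρ) ρ)
    (hB : MeasurableSet B) (hAB : ∀ a ∈ A, ∀ θ, |θ| ≤ h → a + θ ∈ B)
    (ht : t ∈ SS κ A) : t' ∈ SS κ B := by
  have := NN_dil (d := (t' - t)/κ) (h := h) h0 h1 hρ (by
    rw [abs_div, abs_of_pos h0, mul_div_cancel₀ _ h0.ne']; exact hd) hA hAI hB hAB ht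
  rw [← add_div] at this
  simpa [SS] using this

lemma SS_iUnion {κ t : ℝ} {A : ℕ → Set ℝ} (hA : ∀ n, MeasurableSet (A n)) (hm : Monotone A)
    (ht : t ∈ SS κ (⋃ n, A n)) : ∃ n, t ∈ SS κ (A n) := NN_iUnion hA hm ht

lemma SS_disp {κ ρ t : ℝ} (h0 : 1/2 ≤ κ) (h1 : κ < 1) (hρ : 0 ≤ ρ) {A : Set ℝ}
    (hA : MeasurableSet A) (hAI : A ⊆ Ioo (-ρ) ρ) (ht : t ∈ SS κ A) :
    ∃ a ∈ A, |a - t| ≤ 10 * ρ * (1 - κ) := by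
  have hκ : 0 < κ := by linarith
  obtain ⟨a, ha, h⟩ := NN_disp h0 h1 hρ hA hAI ht
  refine ⟨a, ha, ?_⟩
  have hb := SS_ball hκ h1 hρ hA hAI ht
  have e : a - t = (a - t/κ) + (t/κ) * (1 - κ) := by field_simp; ring
  rw [e]
  refine (abs_add_le _ _).trans ?_
  rw [abs_mul, abs_div, abs_of_pos hκ, abs_of_pos (show 0 < 1 - κ by linarith)]
  have h2 : |t| / κ ≤ 2 * ρ := by
    rw [div_le_iff₀ hκ]
    have := abs_le.2 ⟨hb.1.le, hb.2.le⟩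
    nlinarith
  have := mul_le_mul_of_nonneg_right h2 (show 0 ≤ 1 - κ by linarith)
  linarith

lemma mul_mem_SS {κ a : ℝ} (h0 : 0 < κ) (h1 : κ < 1) {A : Set ℝ} (hA : IsOpen A) (ha : a ∈ A) :
    κ * a ∈ SS κ A := by
  have := subset_NN h0 h1 hA ha
  simpa [SS, mul_div_cancel_left₀ _ h0.ne'] using this

lemma SS_star {κ : ℝ} (h0 : 0 < κ) (h1 : κ < 1) {A D : Set ℝ} (hm : MeasurableSet (A ∩ D))
    (hD : StarS D) : SS κ (A ∩ D) ⊆ D := by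
  intro t ht
  by_contra hc
  have hs : A ∩ D ⊆ Ioo (-|t|) |t| := by
    intro s hs
    by_contra hc'
    refine hc (hD t s ?_ hs.2)
    by_contra h
    push Not at h
    exact hc' (abs_lt.1 h)
  have := abs_lt.2 (SS_ball h0 h1 (abs_nonneg t) hm hs ht)
  exact lt_irrefl _ this

lemma SS_vol_inter {κ ρ : ℝ} (h0 : 0 < κ) (h1 : κ < 1) (hρ : 0 ≤ ρ) {A D : Set ℝ}
    (hA : IsOpen A) (hAI : A ⊆ Ioo (-ρ) ρ) (hD : IsOpen D) (hDs : StarS D) :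
    volume (A ∩ D) ≤ volume (SS κ A ∩ D) := by
  rw [← SS_vol h0 h1 hρ (hA.inter hD) (inter_subset_left.trans hAI)]
  apply measure_mono
  exact subset_inter (SS_mono (hA.inter hD).measurableSet hA.measurableSet inter_subset_left)
    (SS_star h0 h1 (hA.inter hD).measurableSet hDs)

lemma StarS.eq_Ioo {D : Set ℝ} (hD : IsOpen D) (hs : StarS D) {a b : ℝ} (ha : 0 < a)
    (haD : a ∈ D) (hb : 0 < b) (hbD : b ∉ D) : ∃ c, a ≤ c ∧ c ≤ b ∧ D = Ioo (-c) c := by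
  have hbd : ∀ t ∈ D, |t| < b := by
    intro t ht
    by_contra h
    push Not at h
    exact hbD (hs b t (by rwa [abs_of_pos hb]) ht)
  have hB : BddAbove D := ⟨b, fun t ht => (le_abs_self t).trans (hbd t ht).le⟩
  set c := sSup D
  have hac : a ≤ c := le_csSup hB haD
  have hnc : c ∉ D := by
    intro hc
    obtain ⟨ε, hε, h⟩ := Metric.isOpen_iff.1 hD c hc
    have : c + ε/2 ∈ D := h (by rw [Metric.mem_ball, Real.dist_eq, abs_lt]; constructor <;> linarith)
    linarith [le_csSup hB this]
  refine ⟨c, hac, csSup_le ⟨a, haD⟩ fun t ht => (le_abs_self t).trans (hbd t ht).le, ?_⟩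
  ext t
  constructor
  · intro ht
    rw [mem_Ioo, ← abs_lt]
    have h2 : |t| ∈ D := hs _ t (by simp) ht
    refine lt_of_le_of_ne (le_csSup hB h2) ?_
    intro h; exact hnc (by rw [← h]; exact h2)
  · intro ht
    rw [mem_Ioo, ← abs_lt] at ht
    obtain ⟨s, hsD, hs2⟩ := exists_lt_of_lt_csSup ⟨a, haD⟩ ht
    exact hs t s (hs2.le.trans (le_abs_self s)) hsD

lemma SS_gain {κ ρ δ τ0 τ1 : ℝ} (h0 : 1/2 ≤ κ) (h1 : κ < 1) (hρ : 0 ≤ ρ) (hδ : 0 < δ)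
    (hτ : |τ0| + 2 * δ < τ1) (hκ1 : (1 - κ) * 64 * (τ1 + δ)^2 ≤ δ^2)
    (hκ2 : τ1 + δ/2 < κ * (τ1 + δ)) {A D : Set ℝ}
    (hA : IsOpen A) (hAI : A ⊆ Ioo (-ρ) ρ) (hD : IsOpen D) (hDs : StarS D)
    (hτ1 : Ioo (τ1 - δ) (τ1 + δ) ⊆ A) (hτ0 : ∀ t ∈ Ioo (τ0 - δ) (τ0 + δ), t ∉ A)
    (hDa : τ1 - δ/2 ∈ D) (hDb : τ1 + δ/2 ∉ D) :
    volume (A ∩ D) + ENNReal.ofReal ((1 - κ) * δ) ≤ volume (SS κ A ∩ D) := by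
  have hκ : 0 < κ := by linarith
  have habs := abs_nonneg τ0
  have hneg := neg_abs_le τ0
  have hpos := le_abs_self τ0
  obtain ⟨c, hc1, hc2, rfl⟩ := hDs.eq_Ioo hD (by linarith) hDa (by linarith) hDb
  have hAD : IsOpen (A ∩ Ioo (-c) c) := hA.inter hD
  set q := τ0 + δ/2
  set p := τ0 - δ/2
  have hgap : ∀ t ∈ SS κ (A ∩ Ioo (-c) c), t ≤ c - (1 - κ) * (c + q)/2 := by
    intro t ht
    have hx : -(t/κ) ∈ NN κ (-(A ∩ Ioo (-c) c)) := (NN_neg _ _ _).2 ht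
    have := NN_gap_left (c := c) (p := -p) (q := -q) h0 h1 (by simp only [q]; linarith)
      (by simp only [q]; linarith) (by simp only [p, q]; linarith) (by
        have e : (-p - -q) = δ := by simp only [p, q]; ring
        rw [e]
        refine le_trans ?_ hκ1
        have : 0 ≤ 1 - κ := by linarith
        have : 0 ≤ c := by linarith
        gcongr
        linarith) hAD.measurableSet.neg (by
        intro s hs
        have hs1 : -s ∈ A := hs.1
        have hs2 : -s ∈ Ioo (-c) c := hs.2
        have : -s ∉ Ioo (τ0 - δ) (τ0 + δ) := fun h => hτ0 _ h hs1
        rcases lt_or_ge (-s) (τ0 + δ) with h | h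
        · right
          have : -s ≤ τ0 - δ := by
            by_contra hcc; push Not at hcc; exact this ⟨hcc, h⟩
          exact ⟨by simp only [p]; linarith, by linarith [hs2.1]⟩
        · left
          exact ⟨by linarith [hs2.2], by simp only [q]; linarith⟩) hx
    have e : κ * -(t/κ) = -t := by field_simp
    rw [e] at this
    linarith
  set G := Ioo (c - (1 - κ) * (c + q)/2) c with hG
  have hq : 2 * δ ≤ c + q := by simp only [q]; linarith
  have h1κ : 0 < 1 - κ := by linarith
  have hqc : q < c := by simp only [q]; linarith
  have hGs : G ⊆ SS κ A ∩ Ioo (-c) c := by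
    intro t ht
    have htc : κ * c < t := by nlinarith [ht.1]
    refine ⟨subset_NN hκ h1 hA (hτ1 ⟨?_, ?_⟩), ?_, ht.2⟩
    · rw [lt_div_iff₀ hκ]; nlinarith
    · rw [div_lt_iff₀ hκ]; nlinarith [ht.2]
    · nlinarith
  have hdis : Disjoint (SS κ (A ∩ Ioo (-c) c)) G := by
    rw [Set.disjoint_left]
    intro t ht ht2
    linarith [hgap t ht, ht2.1]
  have hsub : SS κ (A ∩ Ioo (-c) c) ∪ G ⊆ SS κ A ∩ Ioo (-c) c := by
    apply union_subset _ hGs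
    exact subset_inter (SS_mono hAD.measurableSet hA.measurableSet inter_subset_left)
      (SS_star hκ h1 hAD.measurableSet hDs)
  refine le_trans ?_ (measure_mono hsub)
  rw [measure_union hdis measurableSet_Ioo, SS_vol hκ h1 hρ hAD (inter_subset_left.trans hAI)]
  gcongr
  rw [hG, Real.volume_Ioo]
  apply ENNReal.ofReal_le_ofReal
  nlinarith

section operator
variable {E : Type*} [NormedAddCommGroup E] [InnerProductSpace ℝ E]

/-- one-dimensional superlevel sets along lines of direction `e` -/
def slc (e : E) (u : E → ℝ) (x : E) (s : ℝ) : Set ℝ := {τ | s < u (x + (τ - ⟪e, x⟫) • e)}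

/-- continuous symmetrization of functions in direction `e` -/
noncomputable def SSu (κ : ℝ) (e : E) (u : E → ℝ) (x : E) : ℝ :=
  sSup {s | 0 ≤ s ∧ ⟪e, x⟫ ∈ SS κ (slc e u x s)}

/-- admissible functions -/
structure Adm (ρ M : ℝ) (u : E → ℝ) : Prop where
  cont : Continuous u
  nonneg : ∀ x, 0 ≤ u x
  le : ∀ x, u x ≤ M
  supp : ∀ x, ρ ≤ ‖x‖ → u x = 0
  rho : 0 ≤ ρ

lemma inner_line {e : E} (he : ‖e‖ = 1) (x : E) (τ : ℝ) :
    ⟪e, x + (τ - ⟪e, x⟫) • e⟫ = τ := by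
  rw [inner_add_right, inner_smul_right, real_inner_self_eq_norm_sq, he]; ring

lemma abs_inner_le {e : E} (he : ‖e‖ = 1) (x : E) : |⟪e, x⟫| ≤ ‖x‖ := by
  have := abs_real_inner_le_norm e x
  rwa [he, one_mul] at this

variable {ρ M κ : ℝ} {e : E} {u : E → ℝ}

lemma Adm.isOpen_slc (hu : Adm ρ M u) (x : E) (s : ℝ) : IsOpen (slc e u x s) := by
  have := hu.cont
  exact isOpen_lt continuous_const (by fun_prop)

lemma Adm.slc_sub (hu : Adm ρ M u) (he : ‖e‖ = 1) (x : E) {s : ℝ} (hs : 0 ≤ s) :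
    slc e u x s ⊆ Ioo (-ρ) ρ := by
  intro τ hτ
  rw [mem_Ioo, ← abs_lt]
  by_contra hc
  push Not at hc
  have h1 := abs_inner_le he (x + (τ - ⟪e, x⟫) • e)
  rw [inner_line he] at h1
  have := hu.supp _ (hc.trans h1)
  simp only [slc, mem_setOf_eq, this] at hτ
  linarith

lemma slc_anti (x : E) {s s' : ℝ} (h : s ≤ s') : slc e u x s' ⊆ slc e u x s :=
  fun _ hτ => h.trans_lt hτ

lemma Adm.lev_le (hu : Adm ρ M u) (h0 : 0 < κ) (h1 : κ < 1) {x : E} {s : ℝ}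
    (h : ⟪e, x⟫ ∈ SS κ (slc e u x s)) : s ≤ M := by
  by_contra hc
  push Not at hc
  have : slc e u x s = ∅ := by
    ext τ; simp only [slc, mem_setOf_eq, mem_empty_iff_false, iff_false, not_lt]
    exact (hu.le _).trans hc.le
  rw [this] at h
  have := SS_ball (ρ := 0) h0 h1 le_rfl MeasurableSet.empty (empty_subset _) h
  simp at this

lemma Adm.bdd (hu : Adm ρ M u) (h0 : 0 < κ) (h1 : κ < 1) (x : E) :
    BddAbove {s | 0 ≤ s ∧ ⟪e, x⟫ ∈ SS κ (slc e u x s)} :=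
  ⟨M, fun _ hs => hu.lev_le h0 h1 hs.2⟩

lemma SSu_nonneg (x : E) : 0 ≤ SSu κ e u x := Real.sSup_nonneg fun _ hs => hs.1

lemma Adm.M_nonneg (hu : Adm ρ M u) : 0 ≤ M := (hu.nonneg 0).trans (hu.le 0)

lemma Adm.SSu_le (hu : Adm ρ M u) (h0 : 0 < κ) (h1 : κ < 1) (x : E) : SSu κ e u x ≤ M := by
  apply Real.sSup_le (fun _ hs => hu.lev_le h0 h1 hs.2) hu.M_nonneg

lemma Adm.lt_SSu (hu : Adm ρ M u) (h0 : 0 < κ) (h1 : κ < 1) (x : E) {s : ℝ} (hs : 0 ≤ s) :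
    s < SSu κ e u x ↔ ⟪e, x⟫ ∈ SS κ (slc e u x s) := by
  constructor
  · intro h
    have hne : {s | 0 ≤ s ∧ ⟪e, x⟫ ∈ SS κ (slc e u x s)}.Nonempty := by
      by_contra hc
      rw [not_nonempty_iff_eq_empty] at hc
      rw [SSu, hc, Real.sSup_empty] at h
      linarith
    obtain ⟨s', hs', hlt⟩ := exists_lt_of_lt_csSup hne h
    exact SS_mono (hu.isOpen_slc _ _).measurableSet (hu.isOpen_slc _ _).measurableSet
      (slc_anti x hlt.le) hs'.2
  · intro h
    have hU : slc e u x s = ⋃ n : ℕ, slc e u x (s + 1/((n:ℝ)+1)) := by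
      ext τ
      simp only [slc, mem_setOf_eq, mem_iUnion]
      constructor
      · intro hτ
        obtain ⟨n, hn⟩ := exists_nat_one_div_lt (sub_pos.2 hτ)
        exact ⟨n, by linarith⟩
      · rintro ⟨n, hn⟩
        have : (0:ℝ) < 1/((n:ℝ)+1) := by positivity
        linarith
    rw [hU] at h
    obtain ⟨n, hn⟩ := SS_iUnion (fun n => (hu.isOpen_slc _ _).measurableSet) (by
      intro m n hmn
      apply slc_anti
      have : (1:ℝ)/((n:ℝ)+1) ≤ 1/((m:ℝ)+1) := by
        apply one_div_le_one_div_of_le (by positivity)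
        have : (m:ℝ) ≤ n := by exact_mod_cast hmn
        linarith
      linarith) h
    have hp : (0:ℝ) < 1/((n:ℝ)+1) := by positivity
    have := le_csSup (hu.bdd h0 h1 x) ⟨(by linarith : 0 ≤ s + 1/((n:ℝ)+1)), hn⟩
    exact lt_of_lt_of_le (by linarith) this

/-- Comparison principle. -/
lemma SSu_comp {ρ' M' : ℝ} {a b : E → ℝ} (ha : Adm ρ M a) (hb : Adm ρ' M' b) (he : ‖e‖ = 1)
    (h0 : 0 < κ) (h1 : κ < 1) {ζ : E} {c : ℝ} (hc : 0 ≤ c)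
    (hab : ∀ (x : E) (θ : ℝ), |θ| ≤ |⟪e, ζ⟫| → a (x + (ζ - ⟪e, ζ⟫ • e + θ • e)) ≤ b x + c) (x : E) :
    SSu κ e a (x + ζ) ≤ SSu κ e b x + c := by
  by_contra hcon
  push Not at hcon
  set s0 := SSu κ e b x with hs0
  have hs00 : 0 ≤ s0 := SSu_nonneg x
  rw [ha.lt_SSu h0 h1 _ (by linarith)] at hcon
  have := SS_dil (t' := ⟪e, x⟫) (B := slc e b x s0) (h := |⟪e, ζ⟫|) h0 h1 ha.rho (by
    rw [inner_add_right, ← abs_neg]; simp) (ha.isOpen_slc _ _) (ha.slc_sub he _ (by linarith))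
    (hb.isOpen_slc _ _).measurableSet ?_ hcon
  · rw [← hb.lt_SSu h0 h1 _ hs00] at this
    exact lt_irrefl _ this
  · intro τ hτ θ hθ
    have h2 := hab (x + (τ + θ - ⟪e, x⟫) • e) (-θ) (by rwa [abs_neg])
    simp only [slc, mem_setOf_eq] at hτ ⊢
    have e1 : x + (τ + θ - ⟪e, x⟫) • e + (ζ - ⟪e, ζ⟫ • e + (-θ) • e)
        = x + ζ + (τ - ⟪e, x + ζ⟫) • e := by
      rw [inner_add_right]; module
    rw [e1] at h2
    linarith

lemma norm_perp {e : E} (he : ‖e‖ = 1) (ζ : E) {θ : ℝ} (hθ : |θ| ≤ |⟪e, ζ⟫|) :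
    ‖ζ - ⟪e, ζ⟫ • e + θ • e‖ ≤ ‖ζ‖ := by
  apply le_of_sq_le_sq _ (norm_nonneg _)
  have hee : ⟪e, e⟫ = 1 := by rw [real_inner_self_eq_norm_sq, he]; norm_num
  have h1 : ‖ζ - ⟪e, ζ⟫ • e + θ • e‖^2 = ‖ζ‖^2 - ⟪e, ζ⟫^2 + θ^2 := by
    rw [← real_inner_self_eq_norm_sq, ← real_inner_self_eq_norm_sq]
    simp only [inner_add_left, inner_add_right, inner_sub_left, inner_sub_right, inner_smul_left,
      inner_smul_right, hee, real_inner_comm e ζ]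
    simp
    ring
  rw [h1]
  have := sq_le_sq.2 hθ
  linarith

lemma SSu_lip {K : ℝ} (hK : 0 ≤ K) (hu : Adm ρ M u) (he : ‖e‖ = 1) (h0 : 0 < κ) (h1 : κ < 1)
    (hL : ∀ x y, |u x - u y| ≤ K * ‖x - y‖) (x y : E) :
    |SSu κ e u x - SSu κ e u y| ≤ K * ‖x - y‖ := by
  have key : ∀ x y, SSu κ e u x ≤ SSu κ e u y + K * ‖x - y‖ := by
    intro x y
    have := SSu_comp (ζ := x - y) (c := K * ‖x - y‖) hu hu he h0 h1 (by positivity) (by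
      intro z θ hθ
      have h2 := (abs_le.1 (hL (z + (x - y - ⟪e, x - y⟫ • e + θ • e)) z)).2
      rw [add_sub_cancel_left] at h2
      have h3 := mul_le_mul_of_nonneg_left (norm_perp he (x - y) hθ) hK
      linarith) y
    rwa [add_sub_cancel] at this
  rw [abs_le]
  constructor
  · have := key y x
    rw [norm_sub_rev] at this
    linarith
  · linarith [key x y]

lemma SSu_mono' {ρ' M' : ℝ} {a b : E → ℝ} (ha : Adm ρ M a) (hb : Adm ρ' M' b) (he : ‖e‖ = 1)
    (h0 : 0 < κ) (h1 : κ < 1) (hab : ∀ x, a x ≤ b x) (x : E) : SSu κ e a x ≤ SSu κ e b x := by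
  have := SSu_comp (ζ := 0) (c := 0) ha hb he h0 h1 le_rfl (by
    intro z θ hθ
    have : θ = 0 := by simpa using hθ
    simp [this, hab z]) x
  simpa using this

lemma SSu_supp (hu : Adm ρ M u) (he : ‖e‖ = 1) (h0 : 0 < κ) (h1 : κ < 1) (x : E) (hx : ρ ≤ ‖x‖) :
    SSu κ e u x = 0 := by
  refine le_antisymm ?_ (SSu_nonneg x)
  by_contra hc
  push Not at hc
  rw [hu.lt_SSu h0 h1 x le_rfl] at hc
  -- use star-shaped set
  set D : Set ℝ := {t | ‖x + (t - ⟪e, x⟫) • e‖ < ρ} with hD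
  have hn : ∀ t, ‖x + (t - ⟪e, x⟫) • e‖^2 = ‖x‖^2 - ⟪e, x⟫^2 + t^2 := by
    intro t
    have hee : ⟪e, e⟫ = 1 := by rw [real_inner_self_eq_norm_sq, he]; norm_num
    rw [← real_inner_self_eq_norm_sq, ← real_inner_self_eq_norm_sq]
    simp only [inner_add_left, inner_add_right, inner_smul_left,
      inner_smul_right, hee, real_inner_comm e x]
    simp
    ring
  have hstar : StarS D := by
    intro t t' htt ht'
    simp only [hD, mem_setOf_eq] at ht' ⊢
    refine lt_of_le_of_lt ?_ ht'
    apply le_of_sq_le_sq _ (norm_nonneg _)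
    rw [hn, hn]
    have := sq_le_sq.2 htt
    linarith
  have hsub : slc e u x 0 ∩ D = slc e u x 0 := by
    apply inter_eq_left.2
    intro t ht
    by_contra hcc
    simp only [hD, mem_setOf_eq, not_lt] at hcc
    have := hu.supp _ hcc
    simp only [slc, mem_setOf_eq, this] at ht
    exact lt_irrefl _ ht
  have := SS_star h0 h1 (A := slc e u x 0) (D := D)
    (by rw [hsub]; exact (hu.isOpen_slc _ _).measurableSet) hstar
  rw [hsub] at this
  have h2 := this hc
  simp [hD] at h2
  linarith

lemma SSu_close {K : ℝ} (hK : 0 ≤ K) (hu : Adm ρ M u) (he : ‖e‖ = 1) (h0 : 1/2 ≤ κ) (h1 : κ < 1)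
    (hL : ∀ x y, |u x - u y| ≤ K * ‖x - y‖) (x : E) :
    |SSu κ e u x - u x| ≤ 10 * K * ρ * (1 - κ) := by
  have hκ : 0 < κ := by linarith
  have h1κ : 0 < 1 - κ := by linarith
  have hρ := hu.rho
  have hline : ∀ τ, |u (x + (τ - ⟪e, x⟫) • e) - u x| ≤ K * |τ - ⟪e, x⟫| := by
    intro τ
    have := hL (x + (τ - ⟪e, x⟫) • e) x
    rwa [add_sub_cancel_left, norm_smul, he, mul_one, Real.norm_eq_abs] at this
  rw [abs_le]
  constructor
  · rcases le_or_gt |⟪e, x⟫| ρ with ht | ht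
    · have h2 := hline (⟪e, x⟫/κ)
      have h3 : |⟪e, x⟫/κ - ⟪e, x⟫| ≤ 2 * ρ * (1 - κ) := by
        have e1 : ⟪e, x⟫/κ - ⟪e, x⟫ = ⟪e, x⟫/κ * (1 - κ) := by field_simp
        rw [e1, abs_mul, abs_of_pos h1κ, abs_div, abs_of_pos hκ]
        apply mul_le_mul_of_nonneg_right _ h1κ.le
        rw [div_le_iff₀ hκ]
        nlinarith
      have h4 : u (x + (⟪e, x⟫/κ - ⟪e, x⟫) • e) ≤ SSu κ e u x := by
        by_contra hc
        push Not at hc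
        have : ⟪e, x⟫/κ ∈ slc e u x (SSu κ e u x) := hc
        have := mul_mem_SS hκ h1 (hu.isOpen_slc _ _) this
        rw [mul_div_cancel₀ _ hκ.ne', ← hu.lt_SSu hκ h1 x (SSu_nonneg x)] at this
        exact lt_irrefl _ this
      have h5 := (abs_le.1 h2).1
      have h6 := mul_le_mul_of_nonneg_left h3 hK
      have h7 : 0 ≤ K * ρ * (1 - κ) := by positivity
      nlinarith
    · have : u x = 0 := hu.supp x (ht.le.trans (abs_inner_le he x))
      have h2 := SSu_nonneg (κ := κ) (e := e) (u := u) x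
      have : 0 ≤ 10 * K * ρ * (1 - κ) := by positivity
      linarith
  · by_contra hc
    push Not at hc
    have h7 : 0 ≤ K * ρ * (1 - κ) := by positivity
    have h8 := hu.nonneg x
    have hlt : u x + 10 * K * ρ * (1 - κ) < SSu κ e u x := by linarith
    rw [hu.lt_SSu hκ h1 x (by linarith)] at hlt
    obtain ⟨a, ha, hat⟩ := SS_disp h0 h1 hρ (hu.isOpen_slc _ _).measurableSet
      (hu.slc_sub he _ (by linarith)) hlt
    have h2 := (abs_le.1 (hline a)).2
    have h3 := mul_le_mul_of_nonneg_left hat hK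
    simp only [slc, mem_setOf_eq] at ha
    linarith

end operator

section fub
variable {E : Type*} [NormedAddCommGroup E] [InnerProductSpace ℝ E]

/-- splitting of the space along a unit vector -/
noncomputable def splitE (e : E) (he : ‖e‖ = 1) : ((ℝ ∙ e)ᗮ × ℝ) ≃ₗ[ℝ] E where
  toFun p := (p.1 : E) + p.2 • e
  map_add' p q := by simp only [Prod.fst_add, Prod.snd_add, Submodule.coe_add]; module
  map_smul' c p := by simp only [Prod.smul_fst, Prod.smul_snd, Submodule.coe_smul, RingHom.id_apply, smul_eq_mul]; module
  invFun x := (⟨x - ⟪e, x⟫ • e, by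
    rw [Submodule.mem_orthogonal_singleton_iff_inner_right, inner_sub_right, inner_smul_right,
      real_inner_self_eq_norm_sq, he]; ring⟩, ⟪e, x⟫)
  left_inv p := by
    have h : ⟪e, (p.1 : E)⟫ = 0 := Submodule.mem_orthogonal_singleton_iff_inner_right.1 p.1.2
    have h2 : ⟪e, (p.1 : E) + p.2 • e⟫ = p.2 := by
      rw [inner_add_right, h, inner_smul_right, real_inner_self_eq_norm_sq, he]; ring
    ext
    · simp [h2]
    · simp [h2]
  right_inv x := by simp

lemma inner_split {e : E} (he : ‖e‖ = 1) (y : (ℝ ∙ e)ᗮ) (t : ℝ) : ⟪e, (y : E) + t • e⟫ = t := by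
  have h : ⟪e, (y : E)⟫ = 0 := Submodule.mem_orthogonal_singleton_iff_inner_right.1 y.2
  rw [inner_add_right, h, inner_smul_right, real_inner_self_eq_norm_sq, he]; ring

lemma norm_split {e : E} (he : ‖e‖ = 1) (y : (ℝ ∙ e)ᗮ) (t : ℝ) :
    ‖(y : E) + t • e‖^2 = ‖(y:E)‖^2 + t^2 := by
  have h : ⟪e, (y : E)⟫ = 0 := Submodule.mem_orthogonal_singleton_iff_inner_right.1 y.2
  rw [← real_inner_self_eq_norm_sq, ← real_inner_self_eq_norm_sq]
  simp only [inner_add_left, inner_add_right, inner_smul_left, inner_smul_right,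
    real_inner_comm e (y:E), h]
  rw [real_inner_self_eq_norm_sq e, he]
  simp [h]
  ring

lemma norm_split_le {e : E} (he : ‖e‖ = 1) (y : (ℝ ∙ e)ᗮ) {t t' : ℝ} (h : |t| ≤ |t'|) :
    ‖(y : E) + t • e‖ ≤ ‖(y : E) + t' • e‖ := by
  apply le_of_sq_le_sq _ (norm_nonneg _)
  rw [norm_split he, norm_split he]
  have := sq_le_sq.2 h
  linarith

lemma slc_split {e : E} (he : ‖e‖ = 1) (u : E → ℝ) (y : (ℝ ∙ e)ᗮ) (t s : ℝ) :
    slc e u ((y : E) + t • e) s = {τ : ℝ | s < u ((y : E) + τ • e)} := by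
  ext τ
  simp only [slc, mem_setOf_eq, inner_split he]
  have : (y : E) + t • e + (τ - t) • e = (y : E) + τ • e := by module
  rw [this]

variable [FiniteDimensional ℝ E] [MeasurableSpace E] [BorelSpace E]

lemma fub (μ : Measure E) [μ.IsAddHaarMeasure] {e : E} (he : ‖e‖ = 1) :
    ∃ c : ENNReal, c ≠ 0 ∧ c ≠ ⊤ ∧ ∀ S : Set E, MeasurableSet S →
      μ S = c * ∫⁻ y : (ℝ ∙ e)ᗮ, volume {t : ℝ | (y : E) + t • e ∈ S} := by
  set Φ : ((ℝ ∙ e)ᗮ × ℝ) ≃L[ℝ] E := (splitE e he).toContinuousLinearEquiv with hΦ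
  set ν : Measure ((ℝ ∙ e)ᗮ × ℝ) := (volume : Measure (ℝ ∙ e)ᗮ).prod volume with hν
  have hH : (ν.map Φ).IsAddHaarMeasure := Φ.isAddHaarMeasure_map ν
  refine ⟨Measure.addHaarScalarFactor μ (ν.map Φ), ?_, ENNReal.coe_ne_top, ?_⟩
  · have := Measure.addHaarScalarFactor_pos_of_isAddHaarMeasure μ (ν.map Φ)
    exact_mod_cast this.ne'
  · intro S hS
    conv_lhs => rw [Measure.isAddLeftInvariant_eq_smul μ (ν.map Φ)]
    rw [Measure.smul_apply, Measure.map_apply Φ.continuous.measurable hS]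
    have hp : ν (Φ ⁻¹' S) = ∫⁻ y : (ℝ ∙ e)ᗮ, volume (Prod.mk y ⁻¹' (Φ ⁻¹' S)) :=
      Measure.prod_apply (Φ.continuous.measurable hS)
    rw [hp]
    rfl

variable {ρ M κ : ℝ} {e : E} {u : E → ℝ}

lemma Adm.sec (hu : Adm ρ M u) (h0 : 0 < κ) (h1 : κ < 1) (he : ‖e‖ = 1) {s : ℝ} (hs : 0 ≤ s)
    (y : (ℝ ∙ e)ᗮ) :
    {t : ℝ | s < SSu κ e u ((y : E) + t • e)} = SS κ {τ : ℝ | s < u ((y : E) + τ • e)} := by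
  ext t
  simp only [mem_setOf_eq]
  rw [hu.lt_SSu h0 h1 _ hs, inner_split he, slc_split he]

lemma Adm.sec_open (hu : Adm ρ M u) (e : E) (s : ℝ)
    (y : (ℝ ∙ e)ᗮ) : IsOpen {τ : ℝ | s < u ((y : E) + τ • e)} := by
  have := hu.cont
  exact isOpen_lt continuous_const (by fun_prop)

lemma Adm.sec_sub (hu : Adm ρ M u) (he : ‖e‖ = 1) {s : ℝ} (hs : 0 ≤ s)
    (y : (ℝ ∙ e)ᗮ) : {τ : ℝ | s < u ((y : E) + τ • e)} ⊆ Ioo (-ρ) ρ := by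
  rw [← slc_split he u y 0 s]
  exact hu.slc_sub he _ hs

lemma vol_level_eq (μ : Measure E) [μ.IsAddHaarMeasure] (hu : Adm ρ M u) (h0 : 0 < κ) (h1 : κ < 1)
    (he : ‖e‖ = 1) (hc : Continuous (SSu κ e u)) {s : ℝ} (hs : 0 ≤ s) :
    μ {x | s < SSu κ e u x} = μ {x | s < u x} := by
  obtain ⟨c, -, -, h⟩ := fub μ he
  rw [h _ (measurableSet_lt measurable_const hc.measurable),
    h _ (measurableSet_lt measurable_const hu.cont.measurable)]
  congr 1
  apply lintegral_congr
  intro y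
  simp only [mem_setOf_eq]
  rw [hu.sec h0 h1 he hs]
  exact SS_vol h0 h1 hu.rho (hu.sec_open e s y) (hu.sec_sub he hs y)

/-- radial star-shaped sets -/
def StarE (D : Set E) : Prop := ∀ x x' : E, ‖x‖ ≤ ‖x'‖ → x' ∈ D → x ∈ D

lemma StarE.sec {D : Set E} (hD : StarE D) (he : ‖e‖ = 1) (y : (ℝ ∙ e)ᗮ) :
    StarS {t : ℝ | (y : E) + t • e ∈ D} := fun _ _ htt ht' => hD _ _ (norm_split_le he y htt) ht'

lemma open_sec {D : Set E} (hD : IsOpen D) (y : (ℝ ∙ e)ᗮ) :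
    IsOpen {t : ℝ | (y : E) + t • e ∈ D} :=
  hD.preimage (by fun_prop : Continuous fun t : ℝ => (y : E) + t • e)

lemma vol_level_le (μ : Measure E) [μ.IsAddHaarMeasure] (hu : Adm ρ M u) (h0 : 0 < κ) (h1 : κ < 1)
    (he : ‖e‖ = 1) (hc : Continuous (SSu κ e u)) {s : ℝ} (hs : 0 ≤ s) {D : Set E} (hD : IsOpen D)
    (hDs : StarE D) :
    μ ({x | s < u x} ∩ D) ≤ μ ({x | s < SSu κ e u x} ∩ D) := by
  obtain ⟨c, -, -, h⟩ := fub μ he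
  rw [h _ ((measurableSet_lt measurable_const hc.measurable).inter hD.measurableSet),
    h _ ((measurableSet_lt measurable_const hu.cont.measurable).inter hD.measurableSet)]
  refine mul_le_mul_right (lintegral_mono fun y => ?_) c
  have := SS_vol_inter h0 h1 hu.rho (hu.sec_open e s y) (hu.sec_sub he hs y) (open_sec hD y)
    (hDs.sec he y)
  rw [← hu.sec h0 h1 he hs y] at this
  exact this

lemma vol_level_gain (μ : Measure E) [μ.IsAddHaarMeasure] (hu : Adm ρ M u) (he : ‖e‖ = 1)
    {δ d τ0 τ1 : ℝ} (hδ : 0 < δ) (hd : 0 < d) (hτ : |τ0| + 2 * δ < τ1) (y1 : (ℝ ∙ e)ᗮ) :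
    ∃ η : ℝ, 0 < η ∧ ∀ κ : ℝ, 1/2 ≤ κ → κ < 1 → (1 - κ) * 64 * (τ1 + δ)^2 ≤ δ^2 →
      τ1 + δ/2 < κ * (τ1 + δ) → Continuous (SSu κ e u) → ∀ s : ℝ, 0 ≤ s → ∀ D : Set E, IsOpen D →
      StarE D → (∀ y ∈ ball y1 d, ∀ t ∈ Ioo (τ1 - δ) (τ1 + δ), s < u ((y : E) + t • e)) →
      (∀ y ∈ ball y1 d, ∀ t ∈ Ioo (τ0 - δ) (τ0 + δ), u ((y : E) + t • e) ≤ s) →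
      (∀ y ∈ ball y1 d, (y : E) + (τ1 - δ/2) • e ∈ D) →
      (∀ y ∈ ball y1 d, (y : E) + (τ1 + δ/2) • e ∉ D) →
      μ ({x | s < u x} ∩ D) + ENNReal.ofReal ((1 - κ) * η) ≤ μ ({x | s < SSu κ e u x} ∩ D) := by
  obtain ⟨c, hc0, hct, h⟩ := fub μ he
  have hb0 : volume (ball y1 d) ≠ 0 := (measure_ball_pos _ _ hd).ne'
  have hbt : volume (ball y1 d) ≠ ⊤ := measure_ball_lt_top.ne
  refine ⟨δ * (c.toReal * volume.real (ball y1 d)), ?_, ?_⟩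
  · have h1 := ENNReal.toReal_pos hc0 hct
    have h2 : 0 < volume.real (ball y1 d) := ENNReal.toReal_pos hb0 hbt
    positivity
  intro κ hκ h1 hκ1 hκ2 hcont s hs D hD hDs hA hB hD1 hD2
  have h0 : 0 < κ := by linarith
  rw [h _ ((measurableSet_lt measurable_const hcont.measurable).inter hD.measurableSet),
    h _ ((measurableSet_lt measurable_const hu.cont.measurable).inter hD.measurableSet)]
  have e1 : ENNReal.ofReal ((1 - κ) * (δ * (c.toReal * volume.real (ball y1 d))))
      = c * ∫⁻ y : (ℝ ∙ e)ᗮ, (ball y1 d).indicator (fun _ => ENNReal.ofReal ((1 - κ) * δ)) y := by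
    rw [lintegral_indicator measurableSet_ball, setLIntegral_const, ← mul_assoc (1 - κ),
      ENNReal.ofReal_mul (by have : 0 < 1 - κ := by linarith
                             positivity), ENNReal.ofReal_mul ENNReal.toReal_nonneg,
      ENNReal.ofReal_toReal hct, ofReal_measureReal hbt]
    ring
  rw [e1, ← mul_add, ← lintegral_add_right _ (measurable_const.indicator measurableSet_ball)]
  gcongr with y
  by_cases hy : y ∈ ball y1 d
  · rw [indicator_of_mem hy]
    have := SS_gain hκ h1 hu.rho hδ hτ hκ1 hκ2 (hu.sec_open e s y) (hu.sec_sub he hs y)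
      (open_sec hD y) (hDs.sec he y) (fun t ht => hA y hy t ht)
      (fun t ht => not_lt.2 (hB y hy t ht)) (hD1 y hy) (hD2 y hy)
    rw [← hu.sec h0 h1 he hs y] at this
    exact this
  · rw [indicator_of_notMem hy, add_zero]
    have := SS_vol_inter h0 h1 hu.rho (hu.sec_open e s y) (hu.sec_sub he hs y) (open_sec hD y)
      (hDs.sec he y)
    rw [← hu.sec h0 h1 he hs y] at this
    exact this

lemma lint_SSu (μ : Measure E) [μ.IsAddHaarMeasure] (hu : Adm ρ M u) (h0 : 0 < κ) (h1 : κ < 1)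
    (he : ‖e‖ = 1) (hc : Continuous (SSu κ e u)) :
    ∫⁻ x, ENNReal.ofReal (SSu κ e u x) ∂μ = ∫⁻ x, ENNReal.ofReal (u x) ∂μ := by
  rw [lintegral_eq_lintegral_meas_lt μ (Filter.Eventually.of_forall fun x => SSu_nonneg x)
    hc.aemeasurable, lintegral_eq_lintegral_meas_lt μ (Filter.Eventually.of_forall hu.nonneg)
    hu.cont.aemeasurable]
  apply setLIntegral_congr_fun measurableSet_Ioi
  intro s hs
  exact vol_level_eq μ hu h0 h1 he hc (le_of_lt hs)

lemma Adm.integrable (μ : Measure E) [μ.IsAddHaarMeasure] (hu : Adm ρ M u) : Integrable u μ := by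
  apply hu.cont.integrable_of_hasCompactSupport
  apply HasCompactSupport.intro (isCompact_closedBall (0:E) ρ)
  intro x hx
  apply hu.supp
  simp at hx
  exact hx.le

lemma Adm.SSu_adm (hu : Adm ρ M u) (h0 : 0 < κ) (h1 : κ < 1)
    (he : ‖e‖ = 1) (hc : Continuous (SSu κ e u)) : Adm ρ M (SSu κ e u) :=
  ⟨hc, SSu_nonneg, hu.SSu_le h0 h1, SSu_supp hu he h0 h1, hu.rho⟩

lemma int_SSu (μ : Measure E) [μ.IsAddHaarMeasure] (hu : Adm ρ M u) (h0 : 0 < κ) (h1 : κ < 1)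
    (he : ‖e‖ = 1) (hc : Continuous (SSu κ e u)) :
    ∫ x, SSu κ e u x ∂μ = ∫ x, u x ∂μ := by
  rw [integral_eq_lintegral_of_nonneg_ae (Filter.Eventually.of_forall fun x => SSu_nonneg x)
    hc.aestronglyMeasurable, integral_eq_lintegral_of_nonneg_ae
    (Filter.Eventually.of_forall hu.nonneg) hu.cont.aestronglyMeasurable,
    lint_SSu μ hu h0 h1 he hc]

end fub

section layer
variable {E : Type*} [NormedAddCommGroup E] [InnerProductSpace ℝ E]
variable [FiniteDimensional ℝ E] [MeasurableSpace E] [BorelSpace E]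

/-- primitive in the second variable -/
noncomputable def PF (φ : ℝ → ℝ → ℝ) (r a : ℝ) : ℝ := ∫ s in (0:ℝ)..a, φ r s

lemma PF_cont {φ : ℝ → ℝ → ℝ} (hφ : Continuous (Function.uncurry φ)) {w : E → ℝ}
    (hw : Continuous w) : Continuous fun x : E => PF φ ‖x‖ (w x) := by
  unfold PF
  have h2 : Continuous (Function.uncurry fun (x : E) (s : ℝ) => φ ‖x‖ s) :=
    hφ.comp (by fun_prop : Continuous fun p : E × ℝ => (‖p.1‖, p.2))
  exact intervalIntegral.continuous_parametric_intervalIntegral_of_continuous h2 hw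

lemma PF_int (μ : Measure E) [μ.IsAddHaarMeasure] {φ : ℝ → ℝ → ℝ}
    (hφ : Continuous (Function.uncurry φ)) {ρ M : ℝ} {w : E → ℝ}
    (hw : Adm ρ M w) : Integrable (fun x : E => PF φ ‖x‖ (w x)) μ := by
  apply (PF_cont hφ hw.cont).integrable_of_hasCompactSupport
  apply HasCompactSupport.intro (isCompact_closedBall (0:E) ρ)
  intro x hx
  have : w x = 0 := by
    apply hw.supp
    simp at hx
    exact hx.le
  simp [PF, this]

lemma PF_layer (μ : Measure E) [μ.IsAddHaarMeasure] {φ : ℝ → ℝ → ℝ}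
    (hφ : Continuous (Function.uncurry φ)) (h0 : ∀ r s, 0 ≤ φ r s) {ρ M : ℝ} {w : E → ℝ}
    (hw : Adm ρ M w) :
    ENNReal.ofReal (∫ x, PF φ ‖x‖ (w x) ∂μ) =
      ∫⁻ s in Ioi (0:ℝ), ∫⁻ σ in Ioi (0:ℝ), μ ({x | s < w x} ∩ {x | σ < φ ‖x‖ s}) := by
  have hs : ∀ r, Continuous (φ r) := fun r => hφ.comp (by fun_prop : Continuous fun s => (r, s))
  have hr : ∀ s, Continuous fun x : E => φ ‖x‖ s :=
    fun s => hφ.comp (by fun_prop : Continuous fun x : E => (‖x‖, s))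
  rw [ofReal_integral_eq_lintegral_ofReal (PF_int μ hφ hw) (Filter.Eventually.of_forall fun x =>
    intervalIntegral.integral_nonneg (hw.nonneg x) fun s _ => h0 _ _)]
  have e1 : ∀ x : E, ENNReal.ofReal (PF φ ‖x‖ (w x)) =
      ∫⁻ s in Ioi (0:ℝ), ({p : E × ℝ | p.2 < w p.1}.indicator
        (fun p => ENNReal.ofReal (φ ‖p.1‖ p.2))) (x, s) := by
    intro x
    unfold PF
    rw [intervalIntegral.integral_of_le (hw.nonneg x), ofReal_integral_eq_lintegral_ofReal
      (((hs _).intervalIntegrable _ _).1) (Filter.Eventually.of_forall fun s => h0 _ _)]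
    have : ∀ s, ({p : E × ℝ | p.2 < w p.1}.indicator
        (fun p => ENNReal.ofReal (φ ‖p.1‖ p.2))) (x, s) =
        (Iio (w x)).indicator (fun s => ENNReal.ofReal (φ ‖x‖ s)) s := by
      intro s
      by_cases h : s < w x
      · rw [indicator_of_mem (by exact h), indicator_of_mem (by exact h)]
      · rw [indicator_of_notMem (by exact h), indicator_of_notMem (by exact h)]
    simp_rw [this]
    rw [lintegral_indicator measurableSet_Iio, Measure.restrict_restrict measurableSet_Iio]
    rw [inter_comm, Ioi_inter_Iio]
    exact (setLIntegral_congr Ioo_ae_eq_Ioc).symm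
  simp_rw [e1]
  rw [lintegral_lintegral_swap]
  · apply lintegral_congr
    intro s
    have e2 : ∀ x : E, ({p : E × ℝ | p.2 < w p.1}.indicator
        (fun p => ENNReal.ofReal (φ ‖p.1‖ p.2))) (x, s) =
        {x | s < w x}.indicator (fun x => ENNReal.ofReal (φ ‖x‖ s)) x := by
      intro x
      by_cases h : s < w x
      · rw [indicator_of_mem (by exact h), indicator_of_mem (by exact h)]
      · rw [indicator_of_notMem (by exact h), indicator_of_notMem (by exact h)]
    simp_rw [e2]
    have hm : MeasurableSet {x | s < w x} := measurableSet_lt measurable_const hw.cont.measurable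
    rw [lintegral_indicator hm, lintegral_eq_lintegral_meas_lt _
      (Filter.Eventually.of_forall fun x => h0 _ _) (hr s).aemeasurable]
    apply lintegral_congr
    intro σ
    rw [Measure.restrict_apply (measurableSet_lt measurable_const (hr s).measurable), inter_comm]
  · apply Measurable.aemeasurable
    apply Measurable.indicator
    · apply ENNReal.measurable_ofReal.comp
      exact (hφ.comp (by fun_prop : Continuous fun p : E × ℝ => (‖p.1‖, p.2))).measurable
    · exact measurableSet_lt measurable_snd (hw.cont.measurable.comp measurable_fst)

lemma PF_gain (μ : Measure E) [μ.IsAddHaarMeasure] {φ : ℝ → ℝ → ℝ}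
    (hφ : Continuous (Function.uncurry φ)) (h0 : ∀ r s, 0 ≤ φ r s)
    (ha : ∀ r r' s, r ≤ r' → φ r' s ≤ φ r s) {ρ M : ℝ} {u : E → ℝ} {e : E}
    (hu : Adm ρ M u) (he : ‖e‖ = 1)
    {δ d τ0 τ1 r1 r2 s1 s2 : ℝ} (hδ : 0 < δ) (hd : 0 < d) (hτ : |τ0| + 2 * δ < τ1)
    (y1 : (ℝ ∙ e)ᗮ)
    (hA : ∀ y ∈ ball y1 d, ∀ t ∈ Ioo (τ1 - δ) (τ1 + δ), s2 ≤ u ((y : E) + t • e))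
    (hB : ∀ y ∈ ball y1 d, ∀ t ∈ Ioo (τ0 - δ) (τ0 + δ), u ((y : E) + t • e) ≤ s1)
    (hD1 : ∀ y ∈ ball y1 d, ‖(y : E) + (τ1 - δ/2) • e‖ ≤ r1)
    (hD2 : ∀ y ∈ ball y1 d, r2 ≤ ‖(y : E) + (τ1 + δ/2) • e‖)
    (hs1 : 0 ≤ s1) (hs : s1 < s2) (hst : ∀ s ∈ Ioo s1 s2, φ r2 s < φ r1 s) :
    ∃ c0 : ℝ, 0 < c0 ∧ ∀ κ : ℝ, 1/2 ≤ κ → κ < 1 → (1 - κ) * 64 * (τ1 + δ)^2 ≤ δ^2 →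
      τ1 + δ/2 < κ * (τ1 + δ) → Continuous (SSu κ e u) →
      (∫ x, PF φ ‖x‖ (u x) ∂μ) + c0 * (1 - κ) ≤ ∫ x, PF φ ‖x‖ (SSu κ e u x) ∂μ := by
  have hsc : ∀ r, Continuous (φ r) := fun r => hφ.comp (by fun_prop : Continuous fun s => (r, s))
  have hr : ∀ s, Continuous fun x : E => φ ‖x‖ s :=
    fun s => hφ.comp (by fun_prop : Continuous fun x : E => (‖x‖, s))
  obtain ⟨η, hη, H⟩ := vol_level_gain μ hu he hδ hd hτ y1
  have hinteg : 0 < ∫ s in s1..s2, (φ r1 s - φ r2 s) :=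
    intervalIntegral.intervalIntegral_pos_of_pos_on
      (((hsc r1).sub (hsc r2)).intervalIntegrable _ _)
      (fun s hs' => sub_pos.2 (hst s hs')) hs
  refine ⟨η * ∫ s in s1..s2, (φ r1 s - φ r2 s), by positivity, ?_⟩
  intro κ hκ h1 hκ1 hκ2 hc
  have h0' : 0 < κ := by linarith
  have hκ0 : 0 < 1 - κ := by linarith
  have hv := hu.SSu_adm h0' h1 he hc
  have nn : ∀ w : E → ℝ, Adm ρ M w → 0 ≤ ∫ x, PF φ ‖x‖ (w x) ∂μ := fun w hw =>
    integral_nonneg fun x => intervalIntegral.integral_nonneg (hw.nonneg x) fun s _ => h0 _ _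
  rw [← ENNReal.ofReal_le_ofReal_iff (nn _ hv), ENNReal.ofReal_add (nn _ hu) (by positivity),
    PF_layer μ hφ h0 hu, PF_layer μ hφ h0 hv]
  have hDo : ∀ σ s, IsOpen {x : E | σ < φ ‖x‖ s} := fun σ s => isOpen_lt continuous_const (hr s)
  have hDs : ∀ σ s, StarE {x : E | σ < φ ‖x‖ s} := fun σ s x x' hx hx' =>
    lt_of_lt_of_le hx' (ha _ _ _ hx)
  set Γ : ℝ → ENNReal := fun s => ENNReal.ofReal ((1 - κ) * η * (φ r1 s - φ r2 s)) with hΓ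
  have hΓm : Measurable Γ := by
    apply ENNReal.measurable_ofReal.comp
    exact (continuous_const.mul ((hsc r1).sub (hsc r2))).measurable
  have e1 : ENNReal.ofReal (η * (∫ s in s1..s2, (φ r1 s - φ r2 s)) * (1 - κ)) =
      ∫⁻ s in Ioi (0:ℝ), (Ioo s1 s2).indicator Γ s := by
    rw [lintegral_indicator measurableSet_Ioo, Measure.restrict_restrict measurableSet_Ioo,
      inter_eq_left.2 (show Ioo s1 s2 ⊆ Ioi 0 from fun s hs' => lt_of_le_of_lt hs1 hs'.1), hΓ,
      ← ofReal_integral_eq_lintegral_ofReal]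
    · congr 1
      rw [integral_const_mul, intervalIntegral.integral_of_le hs.le, integral_Ioc_eq_integral_Ioo]
      ring
    · exact ((continuous_const.mul ((hsc r1).sub (hsc r2))).integrableOn_Icc (a := s1)
        (b := s2)).mono_set Ioo_subset_Icc_self
    · refine (ae_restrict_iff' measurableSet_Ioo).2 (Filter.Eventually.of_forall fun s hs' => ?_)
      have := sub_pos.2 (hst s hs')
      simp only [Pi.zero_apply]
      positivity
  rw [e1, ← lintegral_add_right _ (hΓm.indicator measurableSet_Ioo)]
  apply setLIntegral_mono' measurableSet_Ioi
  intro s hs0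
  have hs0' : 0 ≤ s := le_of_lt hs0
  by_cases hs' : s ∈ Ioo s1 s2
  · rw [indicator_of_mem hs']
    have hp := sub_pos.2 (hst s hs')
    have e2 : Γ s = ∫⁻ σ in Ioi (0:ℝ), (Ioo (φ r2 s) (φ r1 s)).indicator
        (fun _ => ENNReal.ofReal ((1 - κ) * η)) σ := by
      rw [lintegral_indicator measurableSet_Ioo, Measure.restrict_restrict measurableSet_Ioo,
        inter_eq_left.2 (show Ioo (φ r2 s) (φ r1 s) ⊆ Ioi 0 from
          fun σ hσ => lt_of_le_of_lt (h0 _ _) hσ.1), setLIntegral_const, Real.volume_Ioo, hΓ]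
      simp only
      rw [ENNReal.ofReal_mul (by positivity)]
    rw [e2, ← lintegral_add_right _ (measurable_const.indicator measurableSet_Ioo)]
    apply lintegral_mono
    intro σ
    by_cases hσ : σ ∈ Ioo (φ r2 s) (φ r1 s)
    · simp only [indicator_of_mem hσ]
      apply H κ hκ h1 hκ1 hκ2 hc s hs0' _ (hDo σ s) (hDs σ s)
      · intro y hy t ht
        exact lt_of_lt_of_le hs'.2 (hA y hy t ht)
      · intro y hy t ht
        exact (hB y hy t ht).trans hs'.1.le
      · intro y hy
        exact lt_of_lt_of_le hσ.2 (ha _ _ _ (hD1 y hy))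
      · intro y hy
        exact not_lt.2 ((ha _ _ _ (hD2 y hy)).trans hσ.1.le)
    · simp only [indicator_of_notMem hσ, add_zero]
      exact vol_level_le μ hu h0' h1 he hc hs0' (hDo σ s) (hDs σ s)
  · rw [indicator_of_notMem hs', add_zero]
    apply lintegral_mono
    intro σ
    exact vol_level_le μ hu h0' h1 he hc hs0' (hDo σ s) (hDs σ s)

end layer

section QQs
variable {E : Type*} [NormedAddCommGroup E] [InnerProductSpace ℝ E]

/-- sup-convolution type operator -/
noncomputable def QQ (k : ℝ → ℝ) (ρ h : ℝ) (w : E → ℝ) (x : E) : ℝ :=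
  ⨆ z : closedBall (0:E) ρ, (w (x + h • (z:E)) - h * k ‖(z:E)‖)

variable {R M ρ h κ : ℝ} {k : ℝ → ℝ} {w u : E → ℝ} {e : E}

lemma k_nonneg (hk : Monotone k) (hk0 : k 0 = 0) (z : E) : 0 ≤ k ‖z‖ := by
  rw [← hk0]; exact hk (norm_nonneg z)

lemma le_QQ (hw : Adm R M w) (hk : Monotone k) (hk0 : k 0 = 0) (hh : 0 ≤ h) (x : E) {z : E}
    (hz : ‖z‖ ≤ ρ) : w (x + h • z) - h * k ‖z‖ ≤ QQ k ρ h w x := by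
  have hb : BddAbove (range fun z : closedBall (0:E) ρ => (w (x + h • (z:E)) - h * k ‖(z:E)‖)) := by
    refine ⟨M, ?_⟩
    rintro _ ⟨z, rfl⟩
    have := mul_nonneg hh (k_nonneg hk hk0 (z:E))
    have := hw.le (x + h • (z:E))
    simp only
    linarith
  exact le_ciSup hb ⟨z, by simpa using hz⟩

lemma QQ_le (hρ : 0 ≤ ρ) {x : E} {a : ℝ} (H : ∀ z : E, ‖z‖ ≤ ρ → w (x + h • z) - h * k ‖z‖ ≤ a) :
    QQ k ρ h w x ≤ a := by
  haveI : Nonempty (closedBall (0:E) ρ) := ⟨⟨0, by simpa using hρ⟩⟩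
  exact ciSup_le fun z => H z (mem_closedBall_zero_iff.1 z.2)

lemma self_le_QQ (hw : Adm R M w) (hk : Monotone k) (hk0 : k 0 = 0) (hh : 0 ≤ h) (hρ : 0 ≤ ρ)
    (x : E) : w x ≤ QQ k ρ h w x := by
  have := le_QQ (ρ := ρ) hw hk hk0 hh x (z := 0) (by simpa using hρ)
  simpa [hk0] using this

lemma QQ_lip (hw : Adm R M w) (hk : Monotone k) (hk0 : k 0 = 0) (hh : 0 ≤ h) (hρ : 0 ≤ ρ)
    {K : ℝ} (hL : ∀ x y, |w x - w y| ≤ K * ‖x - y‖) (x y : E) :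
    |QQ k ρ h w x - QQ k ρ h w y| ≤ K * ‖x - y‖ := by
  have key : ∀ x y, QQ k ρ h w x ≤ QQ k ρ h w y + K * ‖x - y‖ := by
    intro x y
    apply QQ_le hρ
    intro z hz
    have h1 := le_QQ hw hk hk0 hh y hz
    have h2 := (abs_le.1 (hL (x + h • z) (y + h • z))).2
    rw [add_sub_add_right_eq_sub] at h2
    linarith
  rw [abs_le]
  have h1 := key x y
  have h2 := key y x
  rw [norm_sub_rev] at h2
  constructor <;> linarith

lemma QQ_le_add (hk : Monotone k) (hk0 : k 0 = 0) (hh : 0 ≤ h) (hρ : 0 ≤ ρ)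
    {K : ℝ} (hK : 0 ≤ K) (hL : ∀ x y, |w x - w y| ≤ K * ‖x - y‖) (x : E) :
    QQ k ρ h w x ≤ w x + h * (K * ρ) := by
  apply QQ_le hρ
  intro z hz
  have h2 := (abs_le.1 (hL (x + h • z) x)).2
  rw [add_sub_cancel_left, norm_smul, Real.norm_of_nonneg hh] at h2
  have := mul_nonneg hh (k_nonneg hk hk0 z)
  have h3 : K * (h * ‖z‖) ≤ h * (K * ρ) := by
    have := mul_le_mul_of_nonneg_left hz (mul_nonneg hK hh)
    nlinarith
  linarith

lemma cont_of_lip {K : ℝ} (hK : 0 ≤ K) (hL : ∀ x y, |w x - w y| ≤ K * ‖x - y‖) :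
    LipschitzWith ⟨K, hK⟩ w := by
  apply LipschitzWith.of_dist_le_mul
  intro x y
  rw [Real.dist_eq, dist_eq_norm]
  exact hL x y

lemma QQ_adm (hw : Adm R M w) (hk : Monotone k) (hk0 : k 0 = 0) (hh : 0 ≤ h) (hρ : 0 ≤ ρ)
    {K : ℝ} (hK : 0 ≤ K) (hL : ∀ x y, |w x - w y| ≤ K * ‖x - y‖) :
    Adm (R + h * ρ) M (QQ k ρ h w) where
  cont := (cont_of_lip hK (QQ_lip hw hk hk0 hh hρ hL)).continuous
  nonneg x := (hw.nonneg x).trans (self_le_QQ hw hk hk0 hh hρ x)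
  le x := QQ_le hρ fun z hz => by
    have := mul_nonneg hh (k_nonneg hk hk0 z)
    have := hw.le (x + h • z)
    linarith
  supp x hx := by
    refine le_antisymm ?_ ((hw.nonneg x).trans (self_le_QQ hw hk hk0 hh hρ x))
    apply QQ_le hρ
    intro z hz
    have : w (x + h • z) = 0 := by
      apply hw.supp
      have h1 : ‖x‖ ≤ ‖x + h • z‖ + ‖h • z‖ := by
        have := norm_sub_le (x + h • z) (h • z)
        rwa [add_sub_cancel_right] at this
      rw [norm_smul, Real.norm_of_nonneg hh] at h1
      have := mul_le_mul_of_nonneg_left hz hh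
      linarith
    have := mul_nonneg hh (k_nonneg hk hk0 z)
    linarith
  rho := by have := hw.rho; positivity

lemma QQ_SSu (hu : Adm R M u) (he : ‖e‖ = 1) (h0 : 0 < κ) (h1 : κ < 1)
    (hk : Monotone k) (hk0 : k 0 = 0) (hh : 0 < h) (hρ : 0 ≤ ρ)
    {K : ℝ} (hK : 0 ≤ K) (hL : ∀ x y, |u x - u y| ≤ K * ‖x - y‖) (x : E) :
    QQ k ρ h (SSu κ e u) x ≤ SSu κ e (QQ k ρ h u) x := by
  apply QQ_le hρ
  intro z hz
  rw [sub_le_iff_le_add]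
  apply SSu_comp hu (QQ_adm hu hk hk0 hh.le hρ hK hL) he h0 h1
    (mul_nonneg hh.le (k_nonneg hk hk0 z))
  intro y θ hθ
  have h3 := norm_perp he (h • z) hθ
  set ζ := h • z - ⟪e, h • z⟫ • e + θ • e with hζ
  have h4 : ‖h⁻¹ • ζ‖ ≤ ‖z‖ := by
    rw [norm_smul, norm_inv, Real.norm_of_nonneg hh.le]
    rw [norm_smul, Real.norm_of_nonneg hh.le] at h3
    rw [inv_mul_le_iff₀ hh]
    exact h3
  have h5 := le_QQ (ρ := ρ) hu hk hk0 hh.le y (h4.trans hz)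
  rw [smul_inv_smul₀ hh.ne'] at h5
  have h6 := mul_le_mul_of_nonneg_left (hk h4) hh.le
  linarith

variable [FiniteDimensional ℝ E] [MeasurableSpace E] [BorelSpace E]

lemma QQ_int (μ : Measure E) [μ.IsAddHaarMeasure]
    (hu : Adm R M u) (he : ‖e‖ = 1) (h0 : 0 < κ) (h1 : κ < 1)
    (hk : Monotone k) (hk0 : k 0 = 0) (hh : 0 < h) (hρ : 0 ≤ ρ)
    {K : ℝ} (hK : 0 ≤ K) (hL : ∀ x y, |u x - u y| ≤ K * ‖x - y‖) :
    ∫ x, (QQ k ρ h (SSu κ e u) x - SSu κ e u x) ∂μ ≤ ∫ x, (QQ k ρ h u x - u x) ∂μ := by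
  have hvL := SSu_lip hK hu he h0 h1 hL
  have hvc := (cont_of_lip hK hvL).continuous
  have hv := hu.SSu_adm h0 h1 he hvc
  have hq := QQ_adm hu hk hk0 hh.le hρ hK hL
  have hqL := QQ_lip hu hk hk0 hh.le hρ hL
  have hqc := (cont_of_lip hK (SSu_lip hK hq he h0 h1 hqL)).continuous
  have hqv := QQ_adm hv hk hk0 hh.le hρ hK hvL
  rw [integral_sub (hqv.integrable μ) (hv.integrable μ),
    integral_sub (hq.integrable μ) (hu.integrable μ), int_SSu μ hu h0 h1 he hvc,
    ← int_SSu μ hq h0 h1 he hqc]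
  gcongr
  · exact hqv.integrable μ
  · exact (hq.SSu_adm h0 h1 he hqc).integrable μ
  · exact fun x => QQ_SSu hu he h0 h1 hk hk0 hh hρ hK hL x

end QQs

section energy
variable {E : Type*} [NormedAddCommGroup E] [InnerProductSpace ℝ E]
variable [FiniteDimensional ℝ E] [MeasurableSpace E] [BorelSpace E]
variable {R M ρ κ : ℝ} {k : ℝ → ℝ} {u : E → ℝ} {e : E}

/-- the step sequence -/
noncomputable def hn (n : ℕ) : ℝ := 1 / ((n:ℝ) + 1)

lemma hn_pos (n : ℕ) : 0 < hn n := by unfold hn; positivity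
lemma hn_le (n : ℕ) : hn n ≤ 1 := by
  unfold hn
  rw [div_le_one (by positivity)]
  have : (0:ℝ) ≤ n := n.cast_nonneg
  linarith
lemma hn_tendsto : Filter.Tendsto hn Filter.atTop (nhds 0) := tendsto_one_div_add_atTop_nhds_zero_nat

lemma diff_quot {w : E → ℝ} {x z : E} (hw : DifferentiableAt ℝ w x) :
    Filter.Tendsto (fun n => (w (x + hn n • z) - w x) / hn n) Filter.atTop
      (nhds (fderiv ℝ w x z)) := by
  have h1 : HasDerivAt (fun t : ℝ => w (x + t • z)) (fderiv ℝ w x z) 0 := by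
    have h2 : HasFDerivAt w (fderiv ℝ w x) (x + (0:ℝ) • z) := by simpa using hw.hasFDerivAt
    have h3 : HasDerivAt (fun t : ℝ => x + t • z) z 0 := by
      simpa using ((hasDerivAt_id (0:ℝ)).smul_const z).const_add x
    exact h2.comp_hasDerivAt _ h3
  have h4 := h1.tendsto_slope_zero
  have h5 : Filter.Tendsto hn Filter.atTop (nhdsWithin 0 {0}ᶜ) :=
    tendsto_nhdsWithin_iff.2 ⟨hn_tendsto, Filter.Eventually.of_forall fun n => (hn_pos n).ne'⟩
  have h6 := h4.comp h5
  refine h6.congr fun n => ?_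
  simp only [Function.comp, zero_add, zero_smul, add_zero, smul_eq_mul]
  rw [div_eq_inv_mul]

lemma quot_le {w : E → ℝ} {K : ℝ} (hK : 0 ≤ K) (hL : ∀ x y, |w x - w y| ≤ K * ‖x - y‖) {x z : E}
    (hz : ‖z‖ ≤ ρ) {h : ℝ} (hh : 0 < h) : |(w (x + h • z) - w x) / h| ≤ K * ρ := by
  rw [abs_div, abs_of_pos hh, div_le_iff₀ hh]
  have := hL (x + h • z) x
  rw [add_sub_cancel_left, norm_smul, Real.norm_of_nonneg hh.le] at this
  have := mul_le_mul_of_nonneg_left hz (mul_nonneg hK hh.le)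
  nlinarith

/-- pointwise convergence of the sup-convolution quotient -/
lemma QQ_quot (hu : Adm R M u) (hk : Monotone k) (hk0 : k 0 = 0) (hρ : 0 ≤ ρ) {x z : E}
    (hz : ‖z‖ ≤ ρ) (hd : DifferentiableAt ℝ u x)
    (hmax : ∀ z', ‖z'‖ ≤ ρ → fderiv ℝ u x z' - k ‖z'‖ ≤ fderiv ℝ u x z - k ‖z‖) :
    Filter.Tendsto (fun n => (QQ k ρ (hn n) u x - u x) / hn n) Filter.atTop
      (nhds (fderiv ℝ u x z - k ‖z‖)) := by
  rw [Metric.tendsto_atTop]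
  intro ε hε
  -- lower bound
  have hlow := (diff_quot (z := z) hd).sub_const (k ‖z‖)
  rw [Metric.tendsto_atTop] at hlow
  obtain ⟨N1, hN1⟩ := hlow ε hε
  have hdd := hd.hasFDerivAt
  rw [hasFDerivAt_iff_isLittleO_nhds_zero] at hdd
  have hc : 0 < ε / (2 * (ρ + 1)) := by positivity
  have hdd2 := hdd.def hc
  rw [Metric.eventually_nhds_iff] at hdd2
  obtain ⟨δ, hδ, hδ2⟩ := hdd2
  have h3 := Metric.tendsto_atTop.1 hn_tendsto (δ / (ρ + 1)) (by positivity)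
  obtain ⟨N2, hN2⟩ := h3
  refine ⟨max N1 N2, fun n hn' => ?_⟩
  have hp := hn_pos n
  have hlt : hn n < δ / (ρ + 1) := by
    have := hN2 n ((le_max_right _ _).trans hn')
    rw [Real.dist_eq, sub_zero, abs_of_pos hp] at this
    exact this
  rw [lt_div_iff₀ (by positivity)] at hlt
  have hup : (QQ k ρ (hn n) u x - u x) / hn n ≤ fderiv ℝ u x z - k ‖z‖ + ε / 2 := by
    rw [div_le_iff₀ hp, sub_le_iff_le_add]
    apply QQ_le hρ
    intro z' hz'
    have h4 : ‖hn n • z'‖ ≤ hn n * ρ := by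
      rw [norm_smul, Real.norm_of_nonneg hp.le]
      exact mul_le_mul_of_nonneg_left hz' hp.le
    have h5 := hδ2 (y := hn n • z') (by
      rw [dist_zero_right]
      nlinarith)
    rw [map_smul, smul_eq_mul, Real.norm_eq_abs] at h5
    have h6 := (abs_le.1 h5).2
    have h7 := hmax z' hz'
    have h8 : ε / (2 * (ρ + 1)) * ‖hn n • z'‖ ≤ ε / 2 * hn n := by
      calc ε / (2 * (ρ + 1)) * ‖hn n • z'‖ ≤ ε / (2 * (ρ + 1)) * (hn n * (ρ + 1)) := by
            gcongr
            nlinarith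
        _ = ε / 2 * hn n := by field_simp
    have h9 := mul_le_mul_of_nonneg_left h7 hp.le
    nlinarith
  have hlo : (u (x + hn n • z) - u x) / hn n - k ‖z‖ ≤ (QQ k ρ (hn n) u x - u x) / hn n := by
    have := le_QQ (ρ := ρ) hu hk hk0 hp.le x hz
    rw [le_div_iff₀ hp, sub_mul, div_mul_cancel₀ _ hp.ne']
    linarith
  have h10 := hN1 n ((le_max_left _ _).trans hn')
  rw [Real.dist_eq, abs_lt] at h10 ⊢
  constructor
  · linarith [h10.1]
  · linarith

lemma energy (μ : Measure E) [μ.IsAddHaarMeasure] [Nontrivial E]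
    (hu : Adm R M u) (he : ‖e‖ = 1) (h0 : 0 < κ) (h1 : κ < 1)
    (hk : Monotone k) (hk0 : k 0 = 0) (hρ : 0 ≤ ρ)
    {K : ℝ} (hK : 0 ≤ K) (hL : ∀ x y, |u x - u y| ≤ K * ‖x - y‖)
    {ζ : E → E} (hζm : Measurable ζ) (hζ : ∀ x, ‖ζ x‖ ≤ ρ) (hζ0 : ∀ x, x ∉ ball (0:E) R → ζ x = 0)
    (hd : ∀ x ∈ ball (0:E) R, DifferentiableAt ℝ u x)
    (hmax : ∀ x ∈ ball (0:E) R, ∀ z', ‖z'‖ ≤ ρ →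
      fderiv ℝ u x z' - k ‖z'‖ ≤ fderiv ℝ u x (ζ x) - k ‖ζ x‖) :
    ∫ x in ball (0:E) R, fderiv ℝ (SSu κ e u) x (ζ x) ∂μ ≤
      ∫ x in ball (0:E) R, fderiv ℝ u x (ζ x) ∂μ := by
  set v := SSu κ e u with hvdef
  have hvL : ∀ x y, |v x - v y| ≤ K * ‖x - y‖ := SSu_lip hK hu he h0 h1 hL
  have hvlip := cont_of_lip hK hvL
  have hulip := cont_of_lip hK hL
  have hv : Adm R M v := hu.SSu_adm h0 h1 he hvlip.continuous
  have hkm := hk.measurable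
  have hkρ : ∀ x, |k ‖ζ x‖| ≤ k ρ := fun x => by
    rw [abs_of_nonneg (k_nonneg hk hk0 _)]; exact hk (hζ x)
  have hkρ0 : 0 ≤ k ρ := by rw [← hk0]; exact hk hρ
  -- measurability and integrability
  have hKρ : 0 ≤ K * ρ := by positivity
  have fm : ∀ w : E → ℝ, Measurable fun x => fderiv ℝ w x (ζ x) := fun w =>
    ContinuousLinearMap.measurable_apply₂.comp ((measurable_fderiv ℝ w).prodMk hζm)
  have fb : ∀ w : E → ℝ, LipschitzWith ⟨K, hK⟩ w → ∀ x, ‖fderiv ℝ w x (ζ x)‖ ≤ K * ρ := by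
    intro w hw x
    refine ((fderiv ℝ w x).le_opNorm _).trans ?_
    exact mul_le_mul (norm_fderiv_le_of_lipschitz ℝ hw) (hζ x) (norm_nonneg _) hK
  have finB : μ (ball (0:E) R) < ⊤ := measure_ball_lt_top
  have fi : ∀ w : E → ℝ, LipschitzWith ⟨K, hK⟩ w →
      IntegrableOn (fun x => fderiv ℝ w x (ζ x)) (ball 0 R) μ := by
    intro w hw
    exact Measure.integrableOn_of_bounded finB.ne (fm w).aestronglyMeasurable
      (Filter.Eventually.of_forall (fb w hw))
  have ki : IntegrableOn (fun x => k ‖ζ x‖) (ball 0 R) μ :=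
    Measure.integrableOn_of_bounded finB.ne (hkm.comp hζm.norm).aestronglyMeasurable
      (Filter.Eventually.of_forall hkρ)
  suffices hs : ∫ x in ball (0:E) R, (fderiv ℝ v x (ζ x) - k ‖ζ x‖) ∂μ ≤
      ∫ x in ball (0:E) R, (fderiv ℝ u x (ζ x) - k ‖ζ x‖) ∂μ by
    rw [integral_sub (fi v hvlip) ki, integral_sub (fi u hulip) ki] at hs
    linarith
  -- left limit
  have left : Filter.Tendsto (fun n => ∫ x in ball (0:E) R,
      ((v (x + hn n • ζ x) - v x) / hn n - k ‖ζ x‖) ∂μ) Filter.atTop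
      (nhds (∫ x in ball (0:E) R, (fderiv ℝ v x (ζ x) - k ‖ζ x‖) ∂μ)) := by
    apply tendsto_integral_of_dominated_convergence (fun _ => K * ρ + k ρ)
    · intro n
      apply Measurable.aestronglyMeasurable
      have := hv.cont.measurable
      have h2 : Measurable fun x => v (x + hn n • ζ x) :=
        this.comp (measurable_id.add (hζm.const_smul _))
      exact ((h2.sub this).div_const _).sub (hkm.comp hζm.norm)
    · exact integrableOn_const finB.ne
    · intro n
      refine Filter.Eventually.of_forall fun x => ?_
      refine (norm_sub_le _ _).trans (add_le_add ?_ (hkρ x))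
      exact quot_le hK hvL (hζ x) (hn_pos n)
    · refine ae_restrict_of_ae ?_
      filter_upwards [hvlip.ae_differentiableAt (μ := μ)] with x hx
      exact (diff_quot hx).sub_const _
  -- right limit
  have right : Filter.Tendsto (fun n => ∫ x, (QQ k ρ (hn n) u x - u x) / hn n ∂μ) Filter.atTop
      (nhds (∫ x, (ball (0:E) R).indicator (fun x => fderiv ℝ u x (ζ x) - k ‖ζ x‖) x ∂μ)) := by
    apply tendsto_integral_of_dominated_convergence
      ((ball (0:E) (R + ρ)).indicator fun _ => K * ρ)
    · intro n
      have hq := QQ_adm hu hk hk0 (hn_pos n).le hρ hK hL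
      exact ((hq.cont.sub hu.cont).div_const _).aestronglyMeasurable
    · exact (integrable_indicator_iff measurableSet_ball).2
        (integrableOn_const measure_ball_lt_top.ne)
    · intro n
      have hp := hn_pos n
      refine Filter.Eventually.of_forall fun x => ?_
      by_cases hx : x ∈ ball (0:E) (R + ρ)
      · rw [indicator_of_mem hx, Real.norm_eq_abs, abs_of_nonneg (div_nonneg
          (sub_nonneg.2 (self_le_QQ hu hk hk0 hp.le hρ x)) hp.le), div_le_iff₀ hp]
        have := QQ_le_add hk hk0 hp.le hρ hK hL x
        linarith
      · rw [indicator_of_notMem hx]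
        have hx' : R + ρ ≤ ‖x‖ := by simpa using hx
        have hq := QQ_adm hu hk hk0 hp.le hρ hK hL
        have := mul_le_mul_of_nonneg_right (hn_le n) hρ
        rw [hq.supp x (by linarith), hu.supp x (by linarith)]
        simp
    · have hsph : ∀ᵐ x ∂μ, x ∉ sphere (0:E) R := measure_eq_zero_iff_ae_notMem.1
        (Measure.addHaar_sphere μ 0 R)
      filter_upwards [hsph] with x hx
      by_cases hxb : x ∈ ball (0:E) R
      · rw [indicator_of_mem hxb]
        exact QQ_quot hu hk hk0 hρ (hζ x) (hd x hxb) (hmax x hxb)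
      · rw [indicator_of_notMem hxb]
        have h2 : R < ‖x‖ := by
          rw [mem_sphere_zero_iff_norm] at hx
          rw [mem_ball_zero_iff, not_lt] at hxb
          exact lt_of_le_of_ne hxb (Ne.symm hx)
        have h3 : Filter.Tendsto (fun n => R + hn n * ρ) Filter.atTop (nhds (R + 0 * ρ)) :=
          (hn_tendsto.mul_const ρ).const_add R
        rw [zero_mul, add_zero] at h3
        have h4 := h3.eventually (gt_mem_nhds h2)
        apply tendsto_const_nhds.congr'
        filter_upwards [h4] with n hn4
        have hq := QQ_adm hu hk hk0 (hn_pos n).le hρ hK hL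
        rw [hq.supp x hn4.le, hu.supp x h2.le]
        simp
  rw [integral_indicator measurableSet_ball] at right
  refine le_of_tendsto_of_tendsto' left right fun n => ?_
  have hp := hn_pos n
  have hqv := QQ_adm hv hk hk0 hp.le hρ hK hvL
  have hiq : Integrable (fun x => (QQ k ρ (hn n) v x - v x) / hn n) μ :=
    ((hqv.integrable μ).sub (hv.integrable μ)).div_const _
  calc ∫ x in ball (0:E) R, ((v (x + hn n • ζ x) - v x) / hn n - k ‖ζ x‖) ∂μ
      ≤ ∫ x in ball (0:E) R, (QQ k ρ (hn n) v x - v x) / hn n ∂μ := by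
        refine integral_mono ?_ hiq.integrableOn fun x => ?_
        · refine Measure.integrableOn_of_bounded (M := K * ρ + k ρ) finB.ne ?_
            (Filter.Eventually.of_forall fun x => ?_)
          · apply Measurable.aestronglyMeasurable
            have := hv.cont.measurable
            have h2 : Measurable fun x => v (x + hn n • ζ x) :=
              this.comp (measurable_id.add (hζm.const_smul _))
            exact ((h2.sub this).div_const _).sub (hkm.comp hζm.norm)
          · refine (norm_sub_le _ _).trans (add_le_add ?_ (hkρ x))
            exact quot_le hK hvL (hζ x) (hn_pos n)
        · have := le_QQ (ρ := ρ) hv hk hk0 hp.le x (hζ x)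
          simp only
          rw [le_div_iff₀ hp, sub_mul, div_mul_cancel₀ _ hp.ne']
          linarith
    _ ≤ ∫ x, (QQ k ρ (hn n) v x - v x) / hn n ∂μ := by
        apply setIntegral_le_integral hiq
        exact Filter.Eventually.of_forall fun x => div_nonneg
          (sub_nonneg.2 (self_le_QQ hv hk hk0 hp.le hρ x)) hp.le
    _ ≤ ∫ x, (QQ k ρ (hn n) u x - u x) / hn n ∂μ := by
        rw [integral_div, integral_div]
        exact div_le_div_of_nonneg_right (QQ_int μ hu he h0 h1 hk hk0 hp hρ hK hL) hp.le

end energy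

section weakform
variable {E : Type*} [NormedAddCommGroup E] [InnerProductSpace ℝ E]
variable [FiniteDimensional ℝ E] [MeasurableSpace E] [BorelSpace E]

/-- the weak formulation in the ball, abstractly -/
def WForm (μ : Measure E) (R : ℝ) (ζ : E → E) (q : E → ℝ) (φ : E → ℝ) : Prop :=
  ∫ x in ball (0:E) R, fderiv ℝ φ x (ζ x) ∂μ = ∫ x in ball (0:E) R, q x * φ x ∂μ

lemma fderiv_sm (μ : Measure E) (w : E → ℝ) : AEStronglyMeasurable (fderiv ℝ w) μ :=
  (measurable_fderiv ℝ w).aestronglyMeasurable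

open scoped Convolution in
lemma moll_fderiv (μ : Measure E) [μ.IsAddHaarMeasure] (b : ContDiffBump (0:E)) {φ : E → ℝ} {K : ℝ}
    (hK : 0 ≤ K) (hL : ∀ x y, |φ x - φ y| ≤ K * ‖x - y‖) (x : E) :
    fderiv ℝ (b.normed μ ⋆[ContinuousLinearMap.lsmul ℝ ℝ, μ] φ) x =
      (b.normed μ ⋆[ContinuousLinearMap.lsmul ℝ ℝ, μ] (fderiv ℝ φ)) x := by
  have hlip := cont_of_lip hK hL
  have hbc : Continuous (b.normed μ) := b.continuous_normed
  have key := hasFDerivAt_integral_of_dominated_loc_of_lip (𝕜 := ℝ) (μ := μ)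
    (F := fun (x : E) (t : E) => b.normed μ t • φ (x - t))
    (F' := fun t => b.normed μ t • fderiv ℝ φ (x - t)) (x₀ := x) (s := univ)
    (bound := fun t => b.normed μ t * K) Filter.univ_mem
    (Filter.Eventually.of_forall fun y => by
      have := hlip.continuous
      exact (by fun_prop : Continuous fun t => b.normed μ t • φ (y - t)).aestronglyMeasurable)
    (by
      have := hlip.continuous
      have hc : Continuous fun t => b.normed μ t • φ (x - t) := by fun_prop
      apply hc.integrable_of_hasCompactSupport
      exact b.hasCompactSupport_normed.smul_right)
    (by
      apply AEStronglyMeasurable.smul hbc.aestronglyMeasurable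
      exact ((measurable_fderiv ℝ φ).comp (measurable_const.sub measurable_id)).aestronglyMeasurable)
    (Filter.Eventually.of_forall fun t => by
      apply LipschitzWith.lipschitzOnWith
      apply LipschitzWith.of_dist_le_mul
      intro y y'
      have hb := b.nonneg_normed (μ := μ) t
      rw [Real.dist_eq, dist_eq_norm, Real.coe_nnabs, abs_of_nonneg (mul_nonneg hb hK), ← smul_sub,
        smul_eq_mul, abs_mul, abs_of_nonneg hb, mul_assoc]
      apply mul_le_mul_of_nonneg_left _ hb
      have := hL (y - t) (y' - t)
      rwa [sub_sub_sub_cancel_right] at this)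
    (b.integrable_normed.mul_const K)
    (by
      have h1 := hlip.ae_differentiableAt (μ := μ)
      have h2 : ∀ᵐ t ∂μ, DifferentiableAt ℝ φ (x - t) :=
        (Measure.measurePreserving_sub_left μ x).quasiMeasurePreserving.ae h1
      filter_upwards [h2] with t ht
      have h3 : HasFDerivAt (fun y : E => y - t) (ContinuousLinearMap.id ℝ E) x :=
        (hasFDerivAt_id x).sub_const t
      have h4 : HasFDerivAt (fun y : E => φ (y - t)) (fderiv ℝ φ (x - t)) x := by
        have := HasFDerivAt.comp x (f := fun y : E => y - t) ht.hasFDerivAt h3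
        rwa [ContinuousLinearMap.comp_id] at this
      exact h4.const_smul (b.normed μ t))
  exact key.2.fderiv

open scoped Convolution in
lemma weak_cpt (μ : Measure E) [μ.IsAddHaarMeasure] {R R' K C ρ Cq : ℝ} (hR : R' < R)
    {ζ : E → E} (hζm : Measurable ζ) (hζ : ∀ x, ‖ζ x‖ ≤ ρ) {q : E → ℝ} (hqm : Measurable q)
    (hq : ∀ x, |q x| ≤ Cq)
    (H : ∀ φ : E → ℝ, ContDiff ℝ (⊤ : ℕ∞) φ → HasCompactSupport φ → tsupport φ ⊆ ball 0 R →
      WForm μ R ζ q φ) {φ : E → ℝ} (hK : 0 ≤ K) (hL : ∀ x y, |φ x - φ y| ≤ K * ‖x - y‖)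
    (hC : ∀ x, |φ x| ≤ C) (h0 : ∀ x, R' ≤ ‖x‖ → φ x = 0) : WForm μ R ζ q φ := by
  have hlip := cont_of_lip hK hL
  have hρ : 0 ≤ ρ := (norm_nonneg _).trans (hζ 0)
  have hCq : 0 ≤ Cq := (abs_nonneg _).trans (hq 0)
  set ε := (R - R') / 2 with hε
  have hεp : 0 < ε := by rw [hε]; linarith
  let b : ℕ → ContDiffBump (0:E) := fun n =>
    ⟨hn n * ε / 2, hn n * ε, by have := hn_pos n; positivity, by
      have := hn_pos n
      have : 0 < hn n * ε := by positivity
      linarith⟩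
  have hbr : ∀ n, (b n).rOut = hn n * ε := fun n => rfl
  have hbi : ∀ n, (b n).rIn = hn n * ε / 2 := fun n => rfl
  have hbt : Filter.Tendsto (fun n => (b n).rOut) Filter.atTop (nhds 0) := by
    simp_rw [hbr]
    simpa using hn_tendsto.mul_const ε
  have hgl : LocallyIntegrable (fderiv ℝ φ) μ := by
    intro x
    refine ⟨ball x 1, ball_mem_nhds x one_pos, ?_⟩
    exact Measure.integrableOn_of_bounded measure_ball_lt_top.ne (fderiv_sm μ φ)
      (Filter.Eventually.of_forall fun y => norm_fderiv_le_of_lipschitz ℝ hlip)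
  have conv1 := ContDiffBump.ae_convolution_tendsto_right_of_locallyIntegrable (μ := μ) (φ := b)
    (l := Filter.atTop) (K := 2) hbt (Filter.Eventually.of_forall fun n => by
      rw [hbr, hbi]; linarith) hgl
  have conv2 := ContDiffBump.convolution_tendsto_right_of_continuous (μ := μ) (φ := b)
    (l := Filter.atTop) hbt hlip.continuous
  set ψ : ℕ → E → ℝ := fun n => (b n).normed μ ⋆[ContinuousLinearMap.lsmul ℝ ℝ, μ] φ with hψ
  have hval : ∀ n x, ψ n x = ∫ t, (b n).normed μ t • φ (x - t) ∂μ := fun n x => rfl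
  have hzero : ∀ n x, R' + ε ≤ ‖x‖ → ψ n x = 0 := by
    intro n x hx
    rw [hval]
    have : ∀ t, (b n).normed μ t • φ (x - t) = 0 := by
      intro t
      by_cases ht : t ∈ ball (0:E) (b n).rOut
      · rw [h0 (x - t), smul_zero]
        rw [mem_ball_zero_iff, hbr] at ht
        have h1 := norm_sub_norm_le x t
        have h2 := mul_le_mul_of_nonneg_right (hn_le n) hεp.le
        linarith
      · rw [← ContDiffBump.support_normed_eq (μ := μ), Function.notMem_support] at ht
        rw [ht, zero_smul]
    simp_rw [this]
    exact integral_zero _ _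
  have hle : ∀ n x, |ψ n x| ≤ C := by
    intro n x
    have h1 : ∀ t, ‖(b n).normed μ t • φ (x - t)‖ ≤ (b n).normed μ t * C := by
      intro t
      have hb := (b n).nonneg_normed (μ := μ) t
      rw [norm_smul, Real.norm_of_nonneg hb]
      exact mul_le_mul_of_nonneg_left (hC _) hb
    have h2 := norm_integral_le_of_norm_le ((b n).integrable_normed.mul_const C)
      (Filter.Eventually.of_forall h1)
    rw [integral_mul_const, ContDiffBump.integral_normed, one_mul] at h2
    rw [hval]
    exact h2
  have hdle : ∀ n x, ‖fderiv ℝ (ψ n) x‖ ≤ K := by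
    intro n x
    have h1 : ∀ t, ‖(b n).normed μ t • fderiv ℝ φ (x - t)‖ ≤ (b n).normed μ t * K := by
      intro t
      have hb := (b n).nonneg_normed (μ := μ) t
      rw [norm_smul, Real.norm_of_nonneg hb]
      exact mul_le_mul_of_nonneg_left (norm_fderiv_le_of_lipschitz ℝ hlip) hb
    have h2 := norm_integral_le_of_norm_le ((b n).integrable_normed.mul_const K)
      (Filter.Eventually.of_forall h1)
    rw [integral_mul_const, ContDiffBump.integral_normed, one_mul] at h2
    simp only [hψ]
    rw [moll_fderiv μ (b n) hK hL]
    exact h2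
  have hsm : ∀ n, ContDiff ℝ (⊤ : ℕ∞) (ψ n) := fun n =>
    (b n).hasCompactSupport_normed.contDiff_convolution_left _ (b n).contDiff_normed
      hlip.continuous.locallyIntegrable
  have hts : ∀ n, tsupport (ψ n) ⊆ closedBall 0 (R' + ε) := by
    intro n
    apply closure_minimal _ isClosed_closedBall
    intro x hx
    rw [mem_closedBall_zero_iff]
    by_contra hcon
    exact hx (hzero n x (not_le.1 hcon).le)
  have hW : ∀ n, WForm μ R ζ q (ψ n) := by
    intro n
    apply H _ (hsm n)
    · exact HasCompactSupport.of_support_subset_isCompact (isCompact_closedBall (0:E) (R' + ε))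
        ((subset_tsupport _).trans (hts n))
    · refine (hts n).trans (closedBall_subset_ball ?_)
      rw [hε]; linarith
  have t1 : Filter.Tendsto (fun n => ∫ x in ball (0:E) R, fderiv ℝ (ψ n) x (ζ x) ∂μ) Filter.atTop
      (nhds (∫ x in ball (0:E) R, fderiv ℝ φ x (ζ x) ∂μ)) := by
    apply tendsto_integral_of_dominated_convergence (fun _ => K * ρ)
    · intro n
      exact (ContinuousLinearMap.measurable_apply₂.comp
        ((measurable_fderiv ℝ (ψ n)).prodMk hζm)).aestronglyMeasurable
    · exact integrableOn_const measure_ball_lt_top.ne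
    · intro n
      refine Filter.Eventually.of_forall fun x => ((fderiv ℝ (ψ n) x).le_opNorm _).trans ?_
      exact mul_le_mul (hdle n x) (hζ x) (norm_nonneg _) hK
    · refine ae_restrict_of_ae ?_
      filter_upwards [conv1] with x hx
      have : Filter.Tendsto (fun n => fderiv ℝ (ψ n) x) Filter.atTop (nhds (fderiv ℝ φ x)) := by
        refine hx.congr fun n => ?_
        exact (moll_fderiv μ (b n) hK hL x).symm
      exact ((ContinuousLinearMap.apply ℝ ℝ (ζ x)).continuous.tendsto _).comp this
  have t2 : Filter.Tendsto (fun n => ∫ x in ball (0:E) R, q x * ψ n x ∂μ) Filter.atTop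
      (nhds (∫ x in ball (0:E) R, q x * φ x ∂μ)) := by
    apply tendsto_integral_of_dominated_convergence (fun _ => Cq * C)
    · intro n
      exact (hqm.mul (hsm n).continuous.measurable).aestronglyMeasurable
    · exact integrableOn_const measure_ball_lt_top.ne
    · intro n
      refine Filter.Eventually.of_forall fun x => ?_
      rw [norm_mul]
      exact mul_le_mul (hq x) (hle n x) (norm_nonneg _) hCq
    · exact Filter.Eventually.of_forall fun x => (conv2 x).const_mul _
  exact tendsto_nhds_unique t1 (t2.congr fun n => (hW n).symm)

lemma weak_lip (μ : Measure E) [μ.IsAddHaarMeasure] [Nontrivial E] {R K C ρ Cq : ℝ} (hR : 0 < R)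
    {ζ : E → E} (hζm : Measurable ζ) (hζ : ∀ x, ‖ζ x‖ ≤ ρ) {q : E → ℝ} (hqm : Measurable q)
    (hq : ∀ x, |q x| ≤ Cq)
    (H : ∀ φ : E → ℝ, ContDiff ℝ (⊤ : ℕ∞) φ → HasCompactSupport φ → tsupport φ ⊆ ball 0 R →
      WForm μ R ζ q φ) {φ : E → ℝ} (hK : 0 ≤ K) (hL : ∀ x y, |φ x - φ y| ≤ K * ‖x - y‖)
    (hC : ∀ x, |φ x| ≤ C) (h0 : ∀ x, R ≤ ‖x‖ → φ x = 0) : WForm μ R ζ q φ := by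
  have hlip := cont_of_lip hK hL
  have hCq : 0 ≤ Cq := (abs_nonneg _).trans (hq 0)
  have hbd : ∀ x, ‖x‖ < R → |φ x| ≤ K * (R - ‖x‖) := by
    intro x hx
    by_cases hx0 : x = 0
    · subst hx0
      obtain ⟨y, hy⟩ := exists_ne (0:E)
      have hy' : 0 < ‖y‖ := norm_pos_iff.2 hy
      have hn : ‖(R / ‖y‖) • y‖ = R := by
        rw [norm_smul, norm_div, norm_norm, Real.norm_of_nonneg hR.le]; field_simp
      have := hL 0 ((R / ‖y‖) • y)
      rw [h0 _ hn.ge, sub_zero, zero_sub, norm_neg, hn] at this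
      simpa using this
    · have hx' : 0 < ‖x‖ := norm_pos_iff.2 hx0
      have hn : ‖(R / ‖x‖) • x‖ = R := by
        rw [norm_smul, norm_div, norm_norm, Real.norm_of_nonneg hR.le]; field_simp
      have h1 : ‖x - (R / ‖x‖) • x‖ = R - ‖x‖ := by
        have : x - (R / ‖x‖) • x = (1 - R / ‖x‖) • x := by module
        rw [this, norm_smul, Real.norm_eq_abs, abs_of_nonpos, ]
        · field_simp; ring
        · rw [sub_nonpos, le_div_iff₀ hx']; linarith
      have := hL x ((R / ‖x‖) • x)
      rwa [h0 _ hn.ge, sub_zero, h1] at this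
  let bb : ℕ → E → ℝ := fun n x => (K + 1) * max (R - hn n * R - ‖x‖) 0
  have hbbc : ∀ n, Continuous (bb n) := fun n => by simp only [bb]; fun_prop
  have hbb0 : ∀ n x, 0 ≤ bb n x := fun n x => mul_nonneg (by linarith) (le_max_right _ _)
  have hbbL : ∀ n x y, |bb n x - bb n y| ≤ (K + 1) * ‖x - y‖ := by
    intro n x y
    simp only [bb]
    rw [← mul_sub, abs_mul, abs_of_nonneg (by linarith : 0 ≤ K + 1)]
    apply mul_le_mul_of_nonneg_left _ (by linarith)
    refine (abs_max_sub_max_le_abs _ _ _).trans ?_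
    have := abs_norm_sub_norm_le y x
    rw [norm_sub_rev x y]
    refine le_trans (le_of_eq ?_) this
    congr 1
    ring
  let ψ : ℕ → E → ℝ := fun n x => max (-bb n x) (min (φ x) (bb n x))
  have hψL : ∀ n x y, |ψ n x - ψ n y| ≤ (K + 1) * ‖x - y‖ := by
    intro n x y
    have h1 := abs_le.1 (hL x y)
    have h2 := abs_le.1 (hbbL n x y)
    have h3 : K * ‖x - y‖ ≤ (K + 1) * ‖x - y‖ := by nlinarith [norm_nonneg (x - y)]
    simp only [ψ]
    refine (abs_max_sub_max_le_max _ _ _ _).trans (max_le ?_ ((abs_min_sub_min_le_max _ _ _ _).trans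
      (max_le ((hL x y).trans h3) (hbbL n x y))))
    rw [neg_sub_neg, abs_sub_comm]
    exact hbbL n x y
  have hψle : ∀ n x, |ψ n x| ≤ |φ x| := by
    intro n x
    have := hbb0 n x
    simp only [ψ]
    rw [abs_le]
    constructor
    · apply le_max_of_le_right
      apply le_min (neg_abs_le _)
      linarith [abs_nonneg (φ x)]
    · apply max_le
      · linarith [abs_nonneg (φ x)]
      · exact (min_le_left _ _).trans (le_abs_self _)
  have hψ0 : ∀ n x, R - hn n * R ≤ ‖x‖ → ψ n x = 0 := by
    intro n x hx
    have : bb n x = 0 := by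
      simp only [bb]
      rw [max_eq_right (by linarith), mul_zero]
    simp only [ψ, this, neg_zero]
    exact max_eq_left (min_le_right _ _)
  have hW : ∀ n, WForm μ R ζ q (ψ n) := fun n =>
    weak_cpt μ (by have := mul_pos (hn_pos n) hR; linarith : R - hn n * R < R) hζm hζ hqm hq H
      (by linarith : 0 ≤ K + 1) (hψL n) (fun x => (hψle n x).trans (hC x)) (hψ0 n)
  have hev : ∀ x ∈ ball (0:E) R, ∀ᶠ n in Filter.atTop, ψ n =ᶠ[nhds x] φ := by
    intro x hx
    rw [mem_ball_zero_iff] at hx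
    have h1 : Filter.Tendsto (fun n => (K + 1) * (R - hn n * R - ‖x‖)) Filter.atTop
        (nhds ((K + 1) * (R - 0 * R - ‖x‖))) :=
      (((hn_tendsto.mul_const R).const_sub R).sub_const _).const_mul _
    have h2 : |φ x| < (K + 1) * (R - 0 * R - ‖x‖) := by
      have := hbd x hx
      nlinarith
    filter_upwards [h1.eventually (lt_mem_nhds h2)] with n hn'
    have h3 : |φ x| < bb n x := lt_of_lt_of_le hn'
      (mul_le_mul_of_nonneg_left (le_max_left _ _) (by linarith))
    have h4 : ∀ᶠ y in nhds x, |φ y| < bb n y :=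
      (hlip.continuous.abs.continuousAt.eventually_lt (hbbc n).continuousAt h3)
    filter_upwards [h4] with y hy
    rw [abs_lt] at hy
    simp only [ψ]
    rw [min_eq_left hy.2.le, max_eq_right hy.1.le]
  have t1 : Filter.Tendsto (fun n => ∫ x in ball (0:E) R, fderiv ℝ (ψ n) x (ζ x) ∂μ) Filter.atTop
      (nhds (∫ x in ball (0:E) R, fderiv ℝ φ x (ζ x) ∂μ)) := by
    apply tendsto_integral_of_dominated_convergence (fun _ => (K + 1) * ρ)
    · intro n
      exact (ContinuousLinearMap.measurable_apply₂.comp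
        ((measurable_fderiv ℝ (ψ n)).prodMk hζm)).aestronglyMeasurable
    · exact integrableOn_const measure_ball_lt_top.ne
    · intro n
      refine Filter.Eventually.of_forall fun x => ((fderiv ℝ (ψ n) x).le_opNorm _).trans ?_
      exact mul_le_mul (norm_fderiv_le_of_lipschitz ℝ (cont_of_lip (by linarith : 0 ≤ K + 1)
        (hψL n))) (hζ x) (norm_nonneg _) (by linarith)
    · refine (ae_restrict_iff' measurableSet_ball).2 (Filter.Eventually.of_forall fun x hx => ?_)
      apply tendsto_const_nhds.congr'
      filter_upwards [hev x hx] with n hn'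
      rw [hn'.fderiv_eq]
  have t2 : Filter.Tendsto (fun n => ∫ x in ball (0:E) R, q x * ψ n x ∂μ) Filter.atTop
      (nhds (∫ x in ball (0:E) R, q x * φ x ∂μ)) := by
    apply tendsto_integral_of_dominated_convergence (fun _ => Cq * C)
    · intro n
      exact (hqm.mul (cont_of_lip (by linarith : 0 ≤ K + 1)
        (hψL n)).continuous.measurable).aestronglyMeasurable
    · exact integrableOn_const measure_ball_lt_top.ne
    · intro n
      refine Filter.Eventually.of_forall fun x => ?_
      rw [norm_mul]
      exact mul_le_mul (hq x) ((hψle n x).trans (hC x)) (norm_nonneg _) hCq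
    · refine (ae_restrict_iff' measurableSet_ball).2 (Filter.Eventually.of_forall fun x hx => ?_)
      apply tendsto_const_nhds.congr'
      filter_upwards [hev x hx] with n hn'
      rw [hn'.eq_of_nhds]
  exact tendsto_nhds_unique t1 (t2.congr fun n => (hW n).symm)

end weakform

lemma PF_diff {φ : ℝ → ℝ → ℝ} (hφ : Continuous (Function.uncurry φ)) {r a b ε δ : ℝ}
    (huc : ∀ r s s', |s - s'| ≤ δ → |φ r s - φ r s'| ≤ ε) (hab : |b - a| ≤ δ) :
    PF φ r b - PF φ r a ≤ φ r a * (b - a) + ε * |b - a| := by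
  have hs : Continuous (φ r) := hφ.comp (by fun_prop : Continuous fun s => (r, s))
  have h1 : PF φ r b - PF φ r a = ∫ s in a..b, φ r s := by
    unfold PF
    exact intervalIntegral.integral_interval_sub_left (hs.intervalIntegrable _ _)
      (hs.intervalIntegrable _ _)
  have h2 : ∫ s in a..b, φ r s = φ r a * (b - a) + ∫ s in a..b, (φ r s - φ r a) := by
    rw [intervalIntegral.integral_sub (hs.intervalIntegrable _ _)
      (by simp), intervalIntegral.integral_const, smul_eq_mul]
    ring
  have h3 : ‖∫ s in a..b, (φ r s - φ r a)‖ ≤ ε * |b - a| := by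
    apply intervalIntegral.norm_integral_le_of_norm_le_const
    intro s hs'
    apply huc
    refine le_trans ?_ hab
    rcases le_total a b with h | h
    · rw [uIoc_of_le h] at hs'
      rw [abs_of_pos (by linarith [hs'.1]), abs_of_nonneg (by linarith)]
      linarith [hs'.2]
    · rw [uIoc_of_ge h] at hs'
      rw [abs_of_nonpos (by linarith [hs'.2]), abs_of_nonpos (by linarith)]
      linarith [hs'.1]
  rw [h1, h2]
  have := (abs_le.1 h3).2
  linarith

section concl
variable {E : Type*} [NormedAddCommGroup E] [InnerProductSpace ℝ E]
variable [FiniteDimensional ℝ E] [MeasurableSpace E] [BorelSpace E]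
variable {R M ρ κ : ℝ} {k : ℝ → ℝ} {u : E → ℝ} {e : E}

/-- all the data extracted from the equation -/
structure SolData (μ : Measure E) (R M K ρ C : ℝ) (k : ℝ → ℝ) (f : ℝ → ℝ → ℝ) (ζ : E → E)
    (u : E → ℝ) : Prop where
  R_pos : 0 < R
  adm : Adm R M u
  K_nonneg : 0 ≤ K
  lip : ∀ x y, |u x - u y| ≤ K * ‖x - y‖
  k_mono : Monotone k
  k_zero : k 0 = 0
  ζ_meas : Measurable ζ
  ζ_le : ∀ x, ‖ζ x‖ ≤ ρ
  ζ_zero : ∀ x, x ∉ ball (0:E) R → ζ x = 0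
  diff : ∀ x ∈ ball (0:E) R, DifferentiableAt ℝ u x
  max : ∀ x ∈ ball (0:E) R, ∀ z', ‖z'‖ ≤ ρ →
      fderiv ℝ u x z' - k ‖z'‖ ≤ fderiv ℝ u x (ζ x) - k ‖ζ x‖
  f_cont : Continuous (Function.uncurry f)
  f_le : ∀ r s, |f r s| ≤ C
  f_anti : ∀ r r' s, r ≤ r' → f r' s ≤ f r s
  f_uc : ∀ ε > 0, ∃ δ > 0, ∀ r s s', |s - s'| ≤ δ → |f r s - f r s'| ≤ ε
  f_strict : ∀ r1 r2 s, 0 ≤ r1 → r1 < r2 → r2 ≤ R → 0 ≤ s → s ≤ M → f r2 s < f r1 s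
  weak : ∀ φ : E → ℝ, ContDiff ℝ (⊤ : ℕ∞) φ → HasCompactSupport φ → tsupport φ ⊆ ball 0 R →
      WForm μ R ζ (fun x => f ‖x‖ (u x)) φ

lemma whole_int (μ : Measure E) {w : E → ℝ} {R : ℝ} (h : ∀ x, R ≤ ‖x‖ → w x = 0) :
    ∫ x in ball (0:E) R, w x ∂μ = ∫ x, w x ∂μ := by
  apply setIntegral_eq_integral_of_forall_compl_eq_zero
  intro x hx
  exact h x (by simpa using hx)

lemma sol_no_gain (μ : Measure E) [μ.IsAddHaarMeasure] [Nontrivial E] {K C : ℝ} {f : ℝ → ℝ → ℝ}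
    {ζ : E → E} (S : SolData μ R M K ρ C k f ζ u) (he : ‖e‖ = 1) {ε : ℝ} (hε : 0 < ε) :
    ∃ δ > 0, ∀ κ : ℝ, 1/2 ≤ κ → κ < 1 → 10 * K * R * (1 - κ) ≤ δ →
      ∫ x, PF (fun r s => f r s + C) ‖x‖ (SSu κ e u x) ∂μ ≤
        (∫ x, PF (fun r s => f r s + C) ‖x‖ (u x) ∂μ) +
          ε * (10 * K * R * (1 - κ)) * μ.real (ball (0:E) R) := by
  obtain ⟨δ, hδ, huc⟩ := S.f_uc ε hε
  refine ⟨δ, hδ, fun κ hκ h1 hκδ => ?_⟩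
  have h0 : 0 < κ := by linarith
  have hu := S.adm
  have hvL := SSu_lip S.K_nonneg hu he h0 h1 S.lip
  have hvc := (cont_of_lip S.K_nonneg hvL).continuous
  have hv := hu.SSu_adm h0 h1 he hvc
  have hρ : 0 ≤ ρ := (norm_nonneg _).trans (S.ζ_le 0)
  set v := SSu κ e u with hvdef
  have hclose : ∀ x, |v x - u x| ≤ 10 * K * R * (1 - κ) :=
    SSu_close S.K_nonneg hu he hκ h1 S.lip
  have hen := energy μ hu he h0 h1 S.k_mono S.k_zero hρ S.K_nonneg S.lip S.ζ_meas S.ζ_le S.ζ_zero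
    S.diff S.max
  have hqc : Continuous fun x : E => f ‖x‖ (u x) :=
    S.f_cont.comp (continuous_norm.prodMk hu.cont)
  have hle : ∀ w : E → ℝ, Adm R M w → ∀ x, |w x| ≤ M := fun w hw x => by
    rw [abs_of_nonneg (hw.nonneg x)]; exact hw.le x
  have w1 := weak_lip μ S.R_pos S.ζ_meas S.ζ_le hqc.measurable (fun x => S.f_le _ _) S.weak
    S.K_nonneg hvL (hle _ hv) hv.supp
  have w2 := weak_lip μ S.R_pos S.ζ_meas S.ζ_le hqc.measurable (fun x => S.f_le _ _) S.weak
    S.K_nonneg S.lip (hle _ hu) hu.supp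
  unfold WForm at w1 w2
  rw [w1, w2, whole_int μ (fun x hx => by rw [hv.supp x hx, mul_zero]),
    whole_int μ (fun x hx => by rw [hu.supp x hx, mul_zero])] at hen
  have hφc : Continuous (Function.uncurry fun r s => f r s + C) := by
    have := S.f_cont
    exact this.add continuous_const
  have qi : ∀ w : E → ℝ, Adm R M w → Integrable (fun x => f ‖x‖ (u x) * w x) μ := fun w hw =>
    (hw.integrable μ).bdd_mul (c := C) hqc.aestronglyMeasurable
      (Filter.Eventually.of_forall fun x => S.f_le _ _)
  have hpt : ∀ x, PF (fun r s => f r s + C) ‖x‖ (v x) ≤ PF (fun r s => f r s + C) ‖x‖ (u x) +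
      (f ‖x‖ (u x) * v x - f ‖x‖ (u x) * u x) + C * (v x - u x) +
      (ball (0:E) R).indicator (fun _ => ε * (10 * K * R * (1 - κ))) x := by
    intro x
    by_cases hx : x ∈ ball (0:E) R
    · rw [indicator_of_mem hx]
      have := PF_diff hφc (r := ‖x‖) (a := u x) (b := v x) (ε := ε) (δ := δ)
        (fun r s s' hss => by simpa using huc r s s' hss) ((hclose x).trans hκδ)
      have h2 := mul_le_mul_of_nonneg_left (hclose x) hε.le
      linarith
    · have hx' : R ≤ ‖x‖ := by simpa using hx
      rw [indicator_of_notMem hx, hu.supp x hx', hv.supp x hx']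
      simp
  have i1 := PF_int μ hφc hu
  have i2 : Integrable (fun x => f ‖x‖ (u x) * v x - f ‖x‖ (u x) * u x) μ := (qi v hv).sub (qi u hu)
  have i3 : Integrable (fun x => C * (v x - u x)) μ :=
    ((hv.integrable μ).sub (hu.integrable μ)).const_mul C
  have i4 : Integrable ((ball (0:E) R).indicator (fun _ => ε * (10 * K * R * (1 - κ)))) μ :=
    (integrable_indicator_iff measurableSet_ball).2 (integrableOn_const measure_ball_lt_top.ne)
  have i12 : Integrable (fun x => PF (fun r s => f r s + C) ‖x‖ (u x) +
      (f ‖x‖ (u x) * v x - f ‖x‖ (u x) * u x)) μ := i1.add i2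
  have i123 : Integrable (fun x => PF (fun r s => f r s + C) ‖x‖ (u x) +
      (f ‖x‖ (u x) * v x - f ‖x‖ (u x) * u x) + C * (v x - u x)) μ := i12.add i3
  have hI := integral_mono (PF_int μ hφc hv) (i123.add i4) hpt
  have e1 : ∫ x, (PF (fun r s => f r s + C) ‖x‖ (u x) +
      (f ‖x‖ (u x) * v x - f ‖x‖ (u x) * u x) + C * (v x - u x) +
      (ball (0:E) R).indicator (fun _ => ε * (10 * K * R * (1 - κ))) x) ∂μ =
      (∫ x, PF (fun r s => f r s + C) ‖x‖ (u x) ∂μ) +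
      ((∫ x, f ‖x‖ (u x) * v x ∂μ) - ∫ x, f ‖x‖ (u x) * u x ∂μ) +
      C * ((∫ x, v x ∂μ) - ∫ x, u x ∂μ) + ε * (10 * K * R * (1 - κ)) * μ.real (ball (0:E) R) := by
    rw [integral_add i123 i4, integral_add i12 i3, integral_add i1 i2,
      integral_sub (qi v hv) (qi u hu), integral_const_mul,
      integral_sub (hv.integrable μ) (hu.integrable μ), integral_indicator measurableSet_ball,
      setIntegral_const, smul_eq_mul]
    ring
  have e2 : ∫ x, v x ∂μ = ∫ x, u x ∂μ := int_SSu μ hu h0 h1 he hvc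
  have hI' := hI.trans (le_of_eq e1)
  rw [e2] at hI'
  linarith

lemma sol_mono (μ : Measure E) [μ.IsAddHaarMeasure] [Nontrivial E] {K C : ℝ} {f : ℝ → ℝ → ℝ}
    {ζ : E → E} (S : SolData μ R M K ρ C k f ζ u) {x0 x1 : E} (hx : ‖x0‖ < ‖x1‖) (hx1 : ‖x1‖ ≤ R) :
    u x1 ≤ u x0 := by
  by_contra hcon
  push Not at hcon
  have hu := S.adm
  have hne : x1 - x0 ≠ 0 := by
    intro h
    rw [sub_eq_zero.1 h] at hx
    exact lt_irrefl _ hx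
  have hnp : 0 < ‖x1 - x0‖ := norm_pos_iff.2 hne
  obtain ⟨e, he, hee⟩ : ∃ e : E, ‖e‖ = 1 ∧ x1 = x0 + ‖x1 - x0‖ • e := by
    refine ⟨‖x1 - x0‖⁻¹ • (x1 - x0), ?_, ?_⟩
    · rw [norm_smul, norm_inv, norm_norm, inv_mul_cancel₀ hnp.ne']
    · rw [smul_inv_smul₀ hnp.ne']; abel
  set ℓ := ‖x1 - x0‖ with hℓ
  obtain ⟨y1, τ0, hx0⟩ : ∃ (y : (ℝ ∙ e)ᗮ) (t : ℝ), x0 = (y : E) + t • e :=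
    ⟨((splitE e he).symm x0).1, ((splitE e he).symm x0).2,
      ((splitE e he).apply_symm_apply x0).symm⟩
  set τ1 := τ0 + ℓ with hτ1
  have hx1' : x1 = (y1 : E) + τ1 • e := by rw [hee, hx0, hτ1]; module
  have hτlt : τ0 < τ1 := by linarith
  have habs : |τ0| < |τ1| := by
    apply sq_lt_sq.1
    have h1 := norm_split he y1 τ0
    have h2 := norm_split he y1 τ1
    rw [← hx0] at h1
    rw [← hx1'] at h2
    have := pow_lt_pow_left₀ hx (norm_nonneg _) two_ne_zero
    linarith
  have hτpos : 0 < τ1 := by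
    by_contra h
    push Not at h
    rw [abs_of_nonpos h, abs_of_nonpos (by linarith)] at habs
    linarith
  rw [abs_of_pos hτpos] at habs
  obtain ⟨s1, hs1a, hs1b⟩ := exists_between hcon
  obtain ⟨s2, hs2a, hs2b⟩ := exists_between hs1b
  have hs10 : 0 ≤ s1 := (hu.nonneg x0).trans hs1a.le
  have hs2M : s2 ≤ M := hs2b.le.trans (hu.le x1)
  have hUc : Continuous fun p : (ℝ ∙ e)ᗮ × ℝ => u ((p.1 : E) + p.2 • e) :=
    hu.cont.comp (by fun_prop)
  have n1 : ∀ᶠ p in nhds (y1, τ1), s2 < u (((p : (ℝ ∙ e)ᗮ × ℝ).1 : E) + p.2 • e) :=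
    hUc.continuousAt.eventually (lt_mem_nhds (by simpa [← hx1'] using hs2b))
  have n0 : ∀ᶠ p in nhds (y1, τ0), u (((p : (ℝ ∙ e)ᗮ × ℝ).1 : E) + p.2 • e) < s1 :=
    hUc.continuousAt.eventually (gt_mem_nhds (by simpa [← hx0] using hs1a))
  obtain ⟨d1, hd1, n1⟩ := Metric.eventually_nhds_iff.1 n1
  obtain ⟨d0, hd0, n0⟩ := Metric.eventually_nhds_iff.1 n0
  obtain ⟨δ, hδ, hδ1, hδ0, hδτ⟩ : ∃ δ > 0, δ ≤ d1 ∧ δ ≤ d0 ∧ |τ0| + 2 * δ < τ1 := by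
    refine ⟨min (min d1 d0) ((τ1 - |τ0|) / 4), ?_, ?_, ?_, ?_⟩
    · have : 0 < (τ1 - |τ0|) / 4 := by linarith
      positivity
    · exact (min_le_left _ _).trans (min_le_left _ _)
    · exact (min_le_left _ _).trans (min_le_right _ _)
    · have := min_le_right (min d1 d0) ((τ1 - |τ0|) / 4)
      linarith
  have hτnn := abs_nonneg τ0
  have hnm : ∀ t t' : ℝ, 0 ≤ t → t < t' → ‖(y1 : E) + t • e‖ < ‖(y1 : E) + t' • e‖ := by
    intro t t' ht htt
    apply lt_of_pow_lt_pow_left₀ 2 (norm_nonneg _)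
    rw [norm_split he, norm_split he]
    nlinarith
  have hr1 := hnm (τ1 - δ/2) τ1 (by linarith) (by linarith)
  have hr2 := hnm τ1 (τ1 + δ/2) (by linarith) (by linarith)
  rw [← hx1'] at hr1 hr2
  obtain ⟨r1, hr1a, hr1b⟩ := exists_between hr1
  have hr10 : 0 ≤ r1 := (norm_nonneg _).trans hr1a.le
  have hNc : ∀ t : ℝ, Continuous fun y : (ℝ ∙ e)ᗮ => ‖(y : E) + t • e‖ := fun t => by fun_prop
  have m1 : ∀ᶠ y : (ℝ ∙ e)ᗮ in nhds y1, ‖(y : E) + (τ1 - δ/2) • e‖ < r1 :=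
    (hNc _).continuousAt.eventually (gt_mem_nhds hr1a)
  have m2 : ∀ᶠ y : (ℝ ∙ e)ᗮ in nhds y1, ‖x1‖ < ‖(y : E) + (τ1 + δ/2) • e‖ :=
    (hNc _).continuousAt.eventually (lt_mem_nhds hr2)
  obtain ⟨d2, hd2, m12⟩ := Metric.eventually_nhds_iff.1 (m1.and m2)
  obtain ⟨d, hd, hdδ, hdd⟩ : ∃ d > 0, d ≤ δ ∧ d ≤ d2 :=
    ⟨min δ d2, by positivity, min_le_left _ _, min_le_right _ _⟩
  have hφc : Continuous (Function.uncurry fun r s => f r s + C) := by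
    have := S.f_cont
    exact this.add continuous_const
  have hdist : ∀ y ∈ ball y1 d, ∀ τ t, t ∈ Ioo (τ - δ) (τ + δ) → dist (y, t) (y1, τ) < δ := by
    intro y hy τ t ht
    rw [Prod.dist_eq, max_lt_iff]
    refine ⟨lt_of_lt_of_le hy hdδ, ?_⟩
    rw [Real.dist_eq, abs_lt]
    exact ⟨by linarith [ht.1], by linarith [ht.2]⟩
  obtain ⟨c0, hc0, hgain⟩ := PF_gain μ hφc
    (fun r s => by have := (abs_le.1 (S.f_le r s)).1; linarith)
    (fun r r' s h => by have := S.f_anti r r' s h; linarith) hu he hδ hd hδτ y1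
    (s1 := s1) (s2 := s2) (r1 := r1) (r2 := ‖x1‖)
    (fun y hy t ht => (n1 (lt_of_lt_of_le (hdist y hy τ1 t ht) hδ1)).le)
    (fun y hy t ht => (n0 (lt_of_lt_of_le (hdist y hy τ0 t ht) hδ0)).le)
    (fun y hy => (m12 (lt_of_lt_of_le hy hdd)).1.le)
    (fun y hy => (m12 (lt_of_lt_of_le hy hdd)).2.le)
    hs10 hs2a
    (fun s hs => by
      have := S.f_strict r1 ‖x1‖ s hr10 hr1b hx1 (hs10.trans hs.1.le) (hs.2.le.trans hs2M)
      linarith)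
  have hKR : 0 ≤ 10 * K * R := by
    have := S.K_nonneg; have := S.R_pos; positivity
  set A := 10 * K * R * μ.real (ball (0:E) R) with hA
  have hA0 : 0 ≤ A := mul_nonneg hKR measureReal_nonneg
  obtain ⟨δ', hδ', hno⟩ := sol_no_gain μ S he (ε := c0 / (2 * (A + 1))) (by positivity)
  -- choose κ
  have hev : ∀ᶠ κ in nhdsWithin (1:ℝ) (Iio 1), 1/2 ≤ κ ∧ κ < 1 ∧
      (1 - κ) * 64 * (τ1 + δ)^2 ≤ δ^2 ∧ τ1 + δ/2 < κ * (τ1 + δ) ∧ 10 * K * R * (1 - κ) ≤ δ' := by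
    have a1 : ∀ᶠ κ in nhds (1:ℝ), 1/2 < κ := lt_mem_nhds (by norm_num)
    have a2 : ∀ᶠ κ in nhds (1:ℝ), (1 - κ) * 64 * (τ1 + δ)^2 < δ^2 :=
      (by fun_prop : Continuous fun κ : ℝ => (1 - κ) * 64 * (τ1 + δ)^2).continuousAt.eventually
        (gt_mem_nhds (by simp; positivity))
    have a3 : ∀ᶠ κ in nhds (1:ℝ), τ1 + δ/2 < κ * (τ1 + δ) :=
      (by fun_prop : Continuous fun κ : ℝ => κ * (τ1 + δ)).continuousAt.eventually
        (lt_mem_nhds (by linarith))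
    have a4 : ∀ᶠ κ in nhds (1:ℝ), 10 * K * R * (1 - κ) < δ' :=
      (by fun_prop : Continuous fun κ : ℝ => 10 * K * R * (1 - κ)).continuousAt.eventually
        (gt_mem_nhds (by simpa using hδ'))
    filter_upwards [nhdsWithin_le_nhds a1, nhdsWithin_le_nhds a2, nhdsWithin_le_nhds a3,
      nhdsWithin_le_nhds a4, self_mem_nhdsWithin] with κ b1 b2 b3 b4 b5
    exact ⟨b1.le, b5, b2.le, b3, b4.le⟩
  obtain ⟨κ, k1, k2, k3, k4, k5⟩ := hev.exists
  have hcont := (cont_of_lip S.K_nonneg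
    (SSu_lip S.K_nonneg hu he (by linarith : 0 < κ) k2 S.lip)).continuous
  have g1 := hgain κ k1 k2 k3 k4 hcont
  have g2 := hno κ k1 k2 k5
  have g3 : c0 * (1 - κ) ≤ c0 / (2 * (A + 1)) * A * (1 - κ) := by
    have : c0 / (2 * (A + 1)) * (10 * K * R * (1 - κ)) * μ.real (ball (0:E) R) =
      c0 / (2 * (A + 1)) * A * (1 - κ) := by rw [hA]; ring
    linarith
  have g4 := le_of_mul_le_mul_right g3 (by linarith : 0 < 1 - κ)
  have g5 : c0 / (2 * (A + 1)) * A < c0 := by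
    rw [div_mul_eq_mul_div, div_lt_iff₀ (by positivity)]
    nlinarith
  linarith

end concl

lemma GCond.mono {g : ℝ → ℝ} (hg : GCond g) : MonotoneOn g (Ici 0) := by
  obtain ⟨hc, -, -, hd⟩ := hg
  apply StrictMonoOn.monotoneOn
  apply strictMonoOn_of_deriv_pos (convex_Ici 0) hc
  intro x hx
  rw [interior_Ici] at hx
  exact hd x hx

lemma GCond.nonneg {g : ℝ → ℝ} (hg : GCond g) {t : ℝ} (ht : 0 ≤ t) : 0 ≤ g t := by
  have := hg.mono (mem_Ici.2 le_rfl) (mem_Ici.2 ht) ht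
  rwa [hg.2.2.1] at this

lemma conj_exists {g : ℝ → ℝ} (hg : GCond g) {L : ℝ} (hL : 0 ≤ L) :
    ∃ k G : ℝ → ℝ, Monotone k ∧ k 0 = 0 ∧ (∀ τ, ∀ t ∈ Icc 0 L, τ * t ≤ G t + k τ) ∧
      ∀ t ∈ Icc 0 L, g t * t - k (g t) = G t := by
  have hii : ∀ a b : ℝ, 0 ≤ a → 0 ≤ b → IntervalIntegrable g volume a b := fun a b ha hb =>
    (hg.1.mono fun x hx => (le_min ha hb).trans hx.1).intervalIntegrable
  set G : ℝ → ℝ := fun t => ∫ s in (0:ℝ)..t, g s with hG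
  have hG0 : G 0 = 0 := by simp [hG]
  have hGn : ∀ t, 0 ≤ t → 0 ≤ G t := fun t ht =>
    intervalIntegral.integral_nonneg ht fun s hs => hg.nonneg hs.1
  have hGd : ∀ s t, 0 ≤ s → 0 ≤ t → G t - G s ≤ (t - s) * g t := by
    intro s t hs ht
    have h1 : G t - G s = ∫ x in s..t, g x :=
      intervalIntegral.integral_interval_sub_left (hii 0 t le_rfl ht) (hii 0 s le_rfl hs)
    rw [h1]
    rcases le_total s t with h | h
    · have := intervalIntegral.integral_mono_on h (hii s t hs ht)
        (intervalIntegrable_const (c := g t))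
        (fun x hx => hg.mono (mem_Ici.2 (hs.trans hx.1)) (mem_Ici.2 ht) hx.2)
      simpa using this
    · have := intervalIntegral.integral_mono_on h (intervalIntegrable_const (c := g t))
        (hii t s ht hs)
        (fun x hx => hg.mono (mem_Ici.2 ht) (mem_Ici.2 (ht.trans hx.1)) hx.1)
      rw [intervalIntegral.integral_symm]
      simp at this
      linarith
  have hb : ∀ τ, BddAbove ((fun t => τ * t - G t) '' Icc 0 L) := by
    intro τ
    refine ⟨|τ| * L, ?_⟩
    rintro _ ⟨t, ht, rfl⟩
    have h1 := hGn t ht.1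
    have h2 : τ * t ≤ |τ| * L := 
      (mul_le_mul_of_nonneg_right (le_abs_self τ) ht.1).trans
        (mul_le_mul_of_nonneg_left ht.2 (abs_nonneg τ))
    show τ * t - G t ≤ _
    linarith
  have hne : ∀ τ, ((fun t => τ * t - G t) '' Icc 0 L).Nonempty := fun τ =>
    ⟨_, 0, ⟨le_rfl, hL⟩, rfl⟩
  have hle : ∀ τ, ∀ t ∈ Icc 0 L, τ * t - G t ≤ sSup ((fun t => τ * t - G t) '' Icc 0 L) :=
    fun τ t ht => le_csSup (hb τ) ⟨t, ht, rfl⟩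
  refine ⟨fun τ => sSup ((fun t => τ * t - G t) '' Icc 0 L), G, ?_, ?_, ?_, ?_⟩
  · intro a b hab
    apply csSup_le (hne a)
    rintro _ ⟨t, ht, rfl⟩
    refine le_trans ?_ (hle b t ht)
    have := mul_le_mul_of_nonneg_right hab ht.1
    show a * t - G t ≤ b * t - G t
    linarith
  · apply le_antisymm
    · apply csSup_le (hne 0)
      rintro _ ⟨t, ht, rfl⟩
      have := hGn t ht.1
      show 0 * t - G t ≤ 0
      linarith
    · have := hle 0 0 ⟨le_rfl, hL⟩
      simpa [hG0] using this
  · intro τ t ht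
    have := hle τ t ht
    show τ * t ≤ G t + sSup ((fun t => τ * t - G t) '' Icc 0 L)
    linarith
  · intro t ht
    have h1 : sSup ((fun s => g t * s - G s) '' Icc 0 L) = g t * t - G t := by
      apply le_antisymm
      · apply csSup_le (hne _)
        rintro _ ⟨s, hs, rfl⟩
        have := hGd s t hs.1 ht.1
        show g t * s - G s ≤ g t * t - G t
        linarith
      · exact hle _ t ht
    show g t * t - sSup ((fun s => g t * s - G s) '' Icc 0 L) = G t
    rw [h1]; ring

section
variable {E : Type*} [NormedAddCommGroup E] [InnerProductSpace ℝ E] [FiniteDimensional ℝ E]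

lemma c1_bound {R : ℝ} (hR : 0 < R) {u : E → ℝ} (hu : ContDiffOn ℝ 1 u (closedBall 0 R)) :
    ∃ L, 0 ≤ L ∧ (∀ x ∈ closedBall (0:E) R, ∀ y ∈ closedBall (0:E) R, |u x - u y| ≤ L * ‖x - y‖) ∧
      ∀ x ∈ ball (0:E) R, DifferentiableAt ℝ u x ∧ ‖fderiv ℝ u x‖ ≤ L := by
  have hud : UniqueDiffOn ℝ (closedBall (0:E) R) :=
    uniqueDiffOn_convex (convex_closedBall _ _) (by
      rw [interior_closedBall _ hR.ne']; exact ⟨0, by simpa using hR⟩)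
  obtain ⟨L, hL⟩ := (isCompact_closedBall (0:E) R).exists_bound_of_continuousOn
    (hu.continuousOn_fderivWithin hud le_rfl)
  have hL0 : 0 ≤ L := (norm_nonneg _).trans (hL 0 (by simpa using hR.le))
  have hdiff := hu.differentiableOn one_ne_zero
  refine ⟨L, hL0, fun x hx y hy => ?_, fun x hx => ?_⟩
  · have := (convex_closedBall (0:E) R).norm_image_sub_le_of_norm_fderivWithin_le hdiff hL hy hx
    simpa using this
  · have hn : closedBall (0:E) R ∈ nhds x :=
      Filter.mem_of_superset (isOpen_ball.mem_nhds hx) ball_subset_closedBall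
    refine ⟨(hdiff x (ball_subset_closedBall hx)).differentiableAt hn, ?_⟩
    rw [← fderivWithin_of_mem_nhds hn]
    exact hL x (ball_subset_closedBall hx)

/-- extension by zero -/
noncomputable def zext (R : ℝ) (u : E → ℝ) (x : E) : ℝ := if ‖x‖ ≤ R then u x else 0

lemma zext_lip {R L : ℝ} {u : E → ℝ} (hL : 0 ≤ L)
    (hl : ∀ x ∈ closedBall (0:E) R, ∀ y ∈ closedBall (0:E) R, |u x - u y| ≤ L * ‖x - y‖)
    (hs : ∀ x ∈ sphere (0:E) R, u x = 0) (x y : E) :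
    |zext R u x - zext R u y| ≤ L * ‖x - y‖ := by
  have key : ∀ x y : E, ‖x‖ ≤ R → R < ‖y‖ → |u x| ≤ L * ‖x - y‖ := by
    intro x y hx hy
    have hc : ContinuousOn (fun s : ℝ => ‖x + s • (y - x)‖) (Icc 0 1) := by fun_prop
    obtain ⟨s, hs1, hs2⟩ := intermediate_value_Icc zero_le_one hc
      (show R ∈ Icc _ _ from ⟨by simpa using hx, by simpa using hy.le⟩)
    have h1 := hl x (by simpa using hx) (x + s • (y - x)) (by simpa using le_of_eq hs2)
    rw [hs (x + s • (y - x)) (by simpa using hs2), sub_zero] at h1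
    refine h1.trans (mul_le_mul_of_nonneg_left ?_ hL)
    rw [show x - (x + s • (y - x)) = s • (x - y) by module, norm_smul, Real.norm_eq_abs,
      abs_of_nonneg hs1.1]
    exact mul_le_of_le_one_left (norm_nonneg _) hs1.2
  unfold zext
  split_ifs with h1 h2 h2
  · exact hl x (by simpa using h1) y (by simpa using h2)
  · simpa using key x y h1 (not_le.1 h2)
  · have := key y x h2 (not_le.1 h1)
    rw [norm_sub_rev] at this
    simpa using this
  · simp; positivity

lemma zext_eq {R : ℝ} {u : E → ℝ} {x : E} (hx : x ∈ ball (0:E) R) :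
    zext R u =ᶠ[nhds x] u := by
  filter_upwards [isOpen_ball.mem_nhds hx] with y hy
  have : ‖y‖ < R := by simpa using hy
  simp [zext, this.le]
end

lemma fclamp {R M : ℝ} (hR : 0 ≤ R) (hM : 0 ≤ M) {f : ℝ → ℝ → ℝ} (hf : FCond R f) :
    ∃ (f' : ℝ → ℝ → ℝ) (C : ℝ), Continuous (Function.uncurry f') ∧ (∀ r s, |f' r s| ≤ C) ∧
      (∀ r r' s, r ≤ r' → f' r' s ≤ f' r s) ∧
      (∀ ε > 0, ∃ δ > 0, ∀ r s s', |s - s'| ≤ δ → |f' r s - f' r s'| ≤ ε) ∧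
      ∀ r ∈ Icc 0 R, ∀ s ∈ Icc 0 M, f' r s = f r s := by
  set c : ℝ × ℝ → ℝ × ℝ := fun p => ((projIcc 0 R hR p.1 : ℝ), (projIcc 0 M hM p.2 : ℝ)) with hc
  have hcc : Continuous c := by
    have := @continuous_projIcc ℝ _ 0 R hR _ _
    have := @continuous_projIcc ℝ _ 0 M hM _ _
    fun_prop
  have hcm : ∀ p, c p ∈ Icc 0 R ×ˢ Icc 0 M := fun p =>
    ⟨(projIcc 0 R hR p.1).2, (projIcc 0 M hM p.2).2⟩
  have hF : ContinuousOn (fun q : ℝ × ℝ => f q.1 q.2) (Icc 0 R ×ˢ Icc 0 M) :=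
    hf.1.mono (prod_mono le_rfl Icc_subset_Ici_self)
  have hK : IsCompact (Icc (0:ℝ) R ×ˢ Icc (0:ℝ) M) := isCompact_Icc.prod isCompact_Icc
  obtain ⟨C, hC⟩ := hK.exists_bound_of_continuousOn hF
  have huc := Metric.uniformContinuousOn_iff.1 (hK.uniformContinuousOn_of_continuous hF)
  refine ⟨fun r s => f (c (r, s)).1 (c (r, s)).2, C, ?_, fun r s => hC _ (hcm _), ?_, ?_, ?_⟩
  · exact hF.comp_continuous hcc hcm
  · intro r r' s h
    exact hf.2 _ (hcm (0, s)).2.1 _ (hcm (r, s)).1 _ (hcm (r', s)).1 (monotone_projIcc hR h)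
  · intro ε hε
    obtain ⟨δ, hδ, h⟩ := huc ε hε
    refine ⟨δ / 2, by positivity, fun r s s' hss => ?_⟩
    have := h (c (r, s)) (hcm _) (c (r, s')) (hcm _) (by
      rw [Prod.dist_eq, max_lt_iff]
      refine ⟨by simpa [hc] using hδ, ?_⟩
      have : dist (c (r, s)).2 (c (r, s')).2 ≤ |s - s'| := abs_projIcc_sub_projIcc hM
      linarith)
    exact this.le
  · intro r hr s hs
    simp [hc, projIcc_of_mem hR hr, projIcc_of_mem hM hs]

lemma gvec_norm {N : ℕ} {g : ℝ → ℝ} (hg : GCond g) (y : EuclideanSpace ℝ (Fin N)) :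
    ‖gvec g y‖ = g ‖y‖ := by
  unfold gvec
  split_ifs with h
  · rw [h, norm_zero, hg.2.2.1]
  · have hp : 0 < ‖y‖ := norm_pos_iff.2 h
    rw [norm_smul, Real.norm_eq_abs, abs_of_nonneg (div_nonneg (hg.nonneg hp.le) hp.le),
      div_mul_cancel₀ _ hp.ne']

lemma gvec_inner {N : ℕ} {g : ℝ → ℝ} (y : EuclideanSpace ℝ (Fin N)) :
    ⟪y, gvec g y⟫ = g ‖y‖ * ‖y‖ := by
  unfold gvec
  split_ifs with h
  · simp [h]
  · have hp : 0 < ‖y‖ := norm_pos_iff.2 h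
    rw [real_inner_smul_right, real_inner_self_eq_norm_sq]
    field_simp

lemma gvec_meas {N : ℕ} {g : ℝ → ℝ} (hg : GCond g) :
    Measurable (gvec g : EuclideanSpace ℝ (Fin N) → EuclideanSpace ℝ (Fin N)) := by
  have h1 : Continuous fun y : EuclideanSpace ℝ (Fin N) => g ‖y‖ :=
    hg.1.comp_continuous continuous_norm fun y => norm_nonneg y
  unfold gvec
  refine Measurable.ite (measurableSet_singleton 0) measurable_const ?_
  exact (h1.measurable.div measurable_norm).smul measurable_id

lemma fderiv_gradient {N : ℕ} (u : EuclideanSpace ℝ (Fin N) → ℝ) (x z : EuclideanSpace ℝ (Fin N)) :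
    fderiv ℝ u x z = ⟪gradient u x, z⟫ := by
  unfold gradient
  rw [InnerProductSpace.toDual_symm_apply]

lemma gradient_norm {N : ℕ} (u : EuclideanSpace ℝ (Fin N) → ℝ) (x : EuclideanSpace ℝ (Fin N)) :
    ‖gradient u x‖ = ‖fderiv ℝ u x‖ := by
  unfold gradient
  exact LinearIsometryEquiv.norm_map _ _

lemma gradient_meas {N : ℕ} (u : EuclideanSpace ℝ (Fin N) → ℝ) : Measurable (gradient u) := by
  unfold gradient
  exact (LinearIsometryEquiv.continuous _).measurable.comp (measurable_fderiv ℝ u)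

lemma build {N : ℕ} (R : ℝ) (hR : 0 < R) (g : ℝ → ℝ) (f : ℝ → ℝ → ℝ)
    (hg : GCond g) (hf : FCond R f)
    (u : EuclideanSpace ℝ (Fin N) → ℝ) (hu : IsWeakSolP R g f u)
    (hstrict : ∀ t ∈ Icc (0:ℝ) (sSup (u '' closedBall (0:EuclideanSpace ℝ (Fin N)) R)),
      ∀ r₁ ∈ Icc (0:ℝ) R, ∀ r₂ ∈ Icc (0:ℝ) R, r₁ < r₂ → f r₂ t < f r₁ t) :
    ∃ (M K ρ C : ℝ) (k : ℝ → ℝ) (f' : ℝ → ℝ → ℝ)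
      (ζ : EuclideanSpace ℝ (Fin N) → EuclideanSpace ℝ (Fin N)),
      SolData volume R M K ρ C k f' ζ (zext R u) := by
  obtain ⟨hC1, hnn, -, hsph, hsol⟩ := hu
  obtain ⟨L, hL0, hlip, hder⟩ := c1_bound hR hC1
  obtain ⟨k, G, hkm, hk0, hkG, hkg⟩ := conj_exists hg hL0
  set M := sSup (u '' closedBall (0:EuclideanSpace ℝ (Fin N)) R) with hM
  have hbd : BddAbove (u '' closedBall (0:EuclideanSpace ℝ (Fin N)) R) :=
    ((isCompact_closedBall _ _).image_of_continuousOn hC1.continuousOn).bddAbove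
  have hle : ∀ x ∈ closedBall (0:EuclideanSpace ℝ (Fin N)) R, u x ≤ M := fun x hx =>
    le_csSup hbd ⟨x, hx, rfl⟩
  have h0m : (0:EuclideanSpace ℝ (Fin N)) ∈ closedBall (0:EuclideanSpace ℝ (Fin N)) R := by
    simpa using hR.le
  have hM0 : 0 ≤ M := (hnn 0 h0m).trans (hle 0 h0m)
  obtain ⟨f', C, f1, f2, f3, f4, f5⟩ := fclamp hR.le hM0 hf
  have hzl := zext_lip hL0 hlip hsph
  set ζ : EuclideanSpace ℝ (Fin N) → EuclideanSpace ℝ (Fin N) :=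
    (ball (0:EuclideanSpace ℝ (Fin N)) R).indicator (fun x => gvec g (gradient u x)) with hζ
  have hgr : ∀ x ∈ ball (0:EuclideanSpace ℝ (Fin N)) R, ‖gradient u x‖ ∈ Icc 0 L := fun x hx =>
    ⟨norm_nonneg _, by rw [gradient_norm]; exact (hder x hx).2⟩
  refine ⟨M, L, g L, C, k, f', ζ, ?_⟩
  refine
    { R_pos := hR
      adm :=
        { cont := (cont_of_lip hL0 hzl).continuous
          nonneg := ?_
          le := ?_
          supp := ?_
          rho := hR.le }
      K_nonneg := hL0
      lip := hzl
      k_mono := hkm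
      k_zero := hk0
      ζ_meas := ((gvec_meas hg).comp (gradient_meas u)).indicator measurableSet_ball
      ζ_le := ?_
      ζ_zero := fun x hx => indicator_of_notMem hx _
      diff := fun x hx => (zext_eq hx).differentiableAt_iff.2 (hder x hx).1
      max := ?_
      f_cont := f1
      f_le := f2
      f_anti := f3
      f_uc := f4
      f_strict := ?_
      weak := ?_ }
  · intro x
    unfold zext
    split_ifs with h
    · exact hnn x (by simpa using h)
    · exact le_rfl
  · intro x
    unfold zext
    split_ifs with h
    · exact hle x (by simpa using h)
    · exact hM0
  · intro x hx
    unfold zext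
    split_ifs with h
    · exact hsph x (by simpa using le_antisymm h hx)
    · rfl
  · intro x
    by_cases hx : x ∈ ball (0:EuclideanSpace ℝ (Fin N)) R
    · rw [hζ, indicator_of_mem hx, gvec_norm hg]
      exact hg.mono (mem_Ici.2 (norm_nonneg _)) (mem_Ici.2 hL0) (hgr x hx).2
    · rw [hζ, indicator_of_notMem hx, norm_zero]
      exact hg.nonneg hL0
  · intro x hx z' hz'
    rw [(zext_eq hx).fderiv_eq, hζ, indicator_of_mem hx, fderiv_gradient, fderiv_gradient,
      gvec_inner, gvec_norm hg, hkg _ (hgr x hx)]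
    have h1 := hkG ‖z'‖ _ (hgr x hx)
    have h2 := real_inner_le_norm (gradient u x) z'
    linarith
  · intro r1 r2 s h1 h12 h2 hs hsM
    rw [f5 r1 ⟨h1, by linarith⟩ s ⟨hs, hsM⟩, f5 r2 ⟨by linarith, h2⟩ s ⟨hs, hsM⟩]
    exact hstrict s ⟨hs, hsM⟩ r1 ⟨h1, by linarith⟩ r2 ⟨by linarith, h2⟩ h12
  · intro φ hφ1 hφ2 hφ3
    have := hsol φ ⟨hφ1, hφ2, hφ3⟩
    unfold WForm
    refine Eq.trans ?_ (this.trans ?_)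
    · apply setIntegral_congr_fun measurableSet_ball
      intro x hx
      show fderiv ℝ φ x (ζ x) = _
      rw [hζ, indicator_of_mem hx, fderiv_gradient, real_inner_comm]
    · apply setIntegral_congr_fun measurableSet_ball
      intro x hx
      have hx' : ‖x‖ < R := by simpa using hx
      have hxc := ball_subset_closedBall hx
      show f ‖x‖ (u x) * φ x = f' ‖x‖ (zext R u x) * φ x
      rw [show zext R u x = u x from (zext_eq hx).eq_of_nhds,
        f5 _ ⟨norm_nonneg _, hx'.le⟩ _ ⟨hnn x hxc, hle x hxc⟩]

lemma radial_final {N : ℕ} (hN : 1 ≤ N) (R : ℝ) (hR : 0 < R)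
    (u : EuclideanSpace ℝ (Fin N) → ℝ)
    (hC1 : ContDiffOn ℝ 1 u (closedBall (0:EuclideanSpace ℝ (Fin N)) R))
    (hmono : ∀ x y : EuclideanSpace ℝ (Fin N), ‖x‖ < ‖y‖ → ‖y‖ ≤ R → u y ≤ u x) :
    ∃ U U' : ℝ → ℝ, RadialNonincreasing R u U U' := by
  haveI : Nonempty (Fin N) := ⟨⟨0, hN⟩⟩
  obtain ⟨e, he⟩ := exists_norm_eq (EuclideanSpace ℝ (Fin N)) (zero_le_one)
  have hle : ∀ x y : EuclideanSpace ℝ (Fin N), ‖x‖ = ‖y‖ → ‖y‖ ≤ R → u y ≤ u x := by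
    intro x y hxy hy
    rcases eq_or_ne x 0 with h | h
    · have : y = 0 := by rw [h, norm_zero] at hxy; exact norm_eq_zero.1 hxy.symm
      rw [h, this]
    have hxp : 0 < ‖x‖ := norm_pos_iff.2 h
    have hxR : ‖x‖ ≤ R := hxy ▸ hy
    have hc : ContinuousWithinAt (fun l : ℝ => u (l • x)) (Icc 0 1) 1 := by
      have : ContinuousOn (fun l : ℝ => u (l • x)) (Icc 0 1) := by
        apply hC1.continuousOn.comp (by fun_prop)
        intro l hl
        simp only [mem_closedBall, dist_zero_right, norm_smul, Real.norm_eq_abs, abs_of_nonneg hl.1]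
        exact (mul_le_of_le_one_left hxp.le hl.2).trans hxR
      exact this 1 ⟨zero_le_one, le_rfl⟩
    have hc' : Filter.Tendsto (fun l : ℝ => u (l • x)) (nhdsWithin 1 (Ioo 0 1)) (nhds (u x)) := by
      have := (hc.mono Ioo_subset_Icc_self).tendsto
      simpa using this
    have hne : (nhdsWithin (1:ℝ) (Ioo 0 1)).NeBot := right_nhdsWithin_Ioo_neBot zero_lt_one
    refine ge_of_tendsto hc' ?_
    filter_upwards [self_mem_nhdsWithin] with l hl
    apply hmono _ _ _ hy
    rw [norm_smul, Real.norm_eq_abs, abs_of_pos hl.1, ← hxy]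
    exact mul_lt_of_lt_one_left hxp hl.2
  have hmaps : MapsTo (fun r : ℝ => r • e) (Icc 0 R) (closedBall (0:EuclideanSpace ℝ (Fin N)) R) := by
    intro r hr
    simpa [norm_smul, he, abs_of_nonneg hr.1] using hr.2
  have hU : ContDiffOn ℝ 1 (fun r : ℝ => u (r • e)) (Icc 0 R) :=
    hC1.comp (by fun_prop) hmaps
  have hn : ∀ r : ℝ, 0 ≤ r → ‖r • e‖ = r := fun r hr => by
    rw [norm_smul, he, mul_one, Real.norm_eq_abs, abs_of_nonneg hr]
  refine ⟨fun r => u (r • e), derivWithin (fun r : ℝ => u (r • e)) (Icc 0 R), ⟨?_, ?_⟩, ?_, ?_⟩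
  · exact hU.continuousOn_derivWithin (uniqueDiffOn_Icc hR) le_rfl
  · intro r hr
    exact (hU.differentiableOn one_ne_zero r hr).hasDerivWithinAt
  · intro a ha b hb hab
    rcases hab.eq_or_lt with h | h
    · rw [h]
    · exact hmono _ _ (by rw [hn a ha.1, hn b hb.1]; exact h) (by rw [hn b hb.1]; exact hb.2)
  · intro x hx
    have hx' : ‖x‖ ≤ R := by simpa using hx
    have h1 := hn ‖x‖ (norm_nonneg x)
    exact le_antisymm (hle _ _ h1 hx') (hle _ _ h1.symm (by rw [h1]; exact hx'))

/-- Corollary 2.5: if `r ↦ f(r,t)` is strictly decreasing, then every weak solution of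
problem (P) is radially symmetric and radially non-increasing. -/
theorem weak_solution_radially_symmetric_of_strict
    {N : ℕ} (hN : 1 ≤ N) (R : ℝ) (hR : 0 < R) (g : ℝ → ℝ) (f : ℝ → ℝ → ℝ)
    (hg : GCond g) (hf : FCond R f)
    (u : EuclideanSpace ℝ (Fin N) → ℝ) (hu : IsWeakSolP R g f u)
    (hstrict : ∀ t ∈ Icc (0:ℝ) (sSup (u '' closedBall (0:EuclideanSpace ℝ (Fin N)) R)),
      ∀ r₁ ∈ Icc (0:ℝ) R, ∀ r₂ ∈ Icc (0:ℝ) R, r₁ < r₂ → f r₂ t < f r₁ t) :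
    ∃ U U' : ℝ → ℝ, RadialNonincreasing R u U U' := by
  haveI : Nonempty (Fin N) := ⟨⟨0, hN⟩⟩
  obtain ⟨M, K, ρ, C, k, f', ζ, S⟩ := build R hR g f hg hf u hu hstrict
  refine radial_final hN R hR u hu.1 fun x y hxy hy => ?_
  have := sol_mono volume S hxy hy
  unfold zext at this
  rwa [if_pos hy, if_pos (hxy.le.trans hy)] at this
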